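/- For every n ≥ 2, the formal power series H_n(x) = Σ_{m≥0} p_{m,n} x^m is rational with denominator S_n(x); precisely, S_n(x)·H_n(x) is a polynomial in x, where S_n(x) = (1−x)^{2n−1}(1+x)^{max(2n−7,0)} if n is even and S_n(x) = (1−x)^{2n−1}(1+x)^{max(2n−8,0)} if n is odd. -/

import Mathlib

/-- A directed lattice path of `n` steps: each step is a unit step east or north. -/
def IsDirectedPath (n : ℕ) (p : Fin (n + 1) → ℤ × ℤ) : Prop :=
  ∀ i : Fin n, p i.succ - p i.castSucc = (1, 0) ∨ p i.succ - p i.castSucc = (0, 1)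

/-- `p, q` form a staircase polygon of half-perimeter `n`: two distinct directed paths of
`n` steps, both starting at the origin, ending at the same point, and sharing no
vertices other than their common start and end. -/
def IsStaircasePair (n : ℕ) (p q : Fin (n + 1) → ℤ × ℤ) : Prop :=
  IsDirectedPath n p ∧ IsDirectedPath n q ∧
  p 0 = (0, 0) ∧ q 0 = (0, 0) ∧ p ≠ q ∧
  p (Fin.last n) = q (Fin.last n) ∧
  ∀ i j : Fin (n + 1), p i = q j →
    (i = 0 ∧ j = 0) ∨ (i = Fin.last n ∧ j = Fin.last n)

/-- The number of staircase polygons of half-perimeter `n`, counted as unordered pairs. -/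
noncomputable def staircaseCount (n : ℕ) : ℕ :=
  Nat.card {s : Sym2 (Fin (n + 1) → ℤ × ℤ) //
    ∃ p q, s = s(p, q) ∧ IsStaircasePair n p q}

/-- The `i`-th step of a walk. -/
def walkStep (n : ℕ) (w : Fin (n + 1) → ℤ × ℤ) (i : Fin n) : ℤ × ℤ :=
  w i.succ - w i.castSucc

/-- The three-choice condition: a step immediately following an east step is east or
north, and a step immediately following a west step is west or south. -/
def ThreeChoiceCond (n : ℕ) (w : Fin (n + 1) → ℤ × ℤ) : Prop :=
  ∀ i j : Fin n, (j : ℕ) = (i : ℕ) + 1 →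
    (walkStep n w i = (1, 0) → walkStep n w j = (1, 0) ∨ walkStep n w j = (0, 1)) ∧
    (walkStep n w i = (-1, 0) → walkStep n w j = (-1, 0) ∨ walkStep n w j = (0, -1))

/-- A three-choice walk of `n` steps: a self-avoiding walk on `ℤ²` starting at the
origin with unit steps, satisfying the three-choice condition. -/
def IsThreeChoiceWalk (n : ℕ) (w : Fin (n + 1) → ℤ × ℤ) : Prop :=
  w 0 = (0, 0) ∧
  (∀ i : Fin n, walkStep n w i ∈ ({(1, 0), (-1, 0), (0, 1), (0, -1)} : Set (ℤ × ℤ))) ∧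
  Function.Injective w ∧
  ThreeChoiceCond n w

/-- The number of three-choice walks of `n` steps. -/
noncomputable def threeChoiceWalkCount (n : ℕ) : ℕ :=
  Nat.card {w : Fin (n + 1) → ℤ × ℤ // IsThreeChoiceWalk n w}

/-- A three-choice polygon of perimeter `2n`: a three-choice walk of `2n` steps ending at
the origin, visiting no vertex twice except that its first vertex equals its last. -/
def IsThreeChoicePolygon (n : ℕ) (w : Fin (2 * n + 1) → ℤ × ℤ) : Prop :=
  w 0 = (0, 0) ∧ w (Fin.last (2 * n)) = (0, 0) ∧
  (∀ i : Fin (2 * n),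
    walkStep (2 * n) w i ∈ ({(1, 0), (-1, 0), (0, 1), (0, -1)} : Set (ℤ × ℤ))) ∧
  (∀ i j : Fin (2 * n), w i.castSucc = w j.castSucc → i = j) ∧
  ThreeChoiceCond (2 * n) w

/-- The number of three-choice polygons of perimeter `2n`. -/
noncomputable def threeChoicePolygonCount (n : ℕ) : ℕ :=
  Nat.card {w : Fin (2 * n + 1) → ℤ × ℤ // IsThreeChoicePolygon n w}

/-- The set of lattice edges traversed by a path of `n` steps. -/
def pathEdges (n : ℕ) (p : Fin (n + 1) → ℤ × ℤ) : Set (Sym2 (ℤ × ℤ)) :=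
  {e | ∃ i : Fin n, e = s(p i.castSucc, p i.succ)}

/-- The edge set of a three-choice polygon of perimeter `2n`. -/
def polygonEdges (n : ℕ) (w : Fin (2 * n + 1) → ℤ × ℤ) : Set (Sym2 (ℤ × ℤ)) :=
  {e | ∃ i : Fin (2 * n), e = s(w i.castSucc, w i.succ)}

/-- Translation of a set of lattice edges by the vector `v`. -/
def translateEdges (v : ℤ × ℤ) (E : Set (Sym2 (ℤ × ℤ))) : Set (Sym2 (ℤ × ℤ)) :=
  (Sym2.map (· + v)) '' E

/-- `E` is the edge set of some staircase polygon. -/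
def IsStaircaseEdgeSet (E : Set (Sym2 (ℤ × ℤ))) : Prop :=
  ∃ (n : ℕ) (p q : Fin (n + 1) → ℤ × ℤ),
    IsStaircasePair n p q ∧ E = pathEdges n p ∪ pathEdges n q

/-- `E` is a translate of the edge set of some staircase polygon. -/
def IsStaircaseTranslate (E : Set (Sym2 (ℤ × ℤ))) : Prop :=
  ∃ (v : ℤ × ℤ) (F : Set (Sym2 (ℤ × ℤ))), IsStaircaseEdgeSet F ∧ E = translateEdges v F

/-- Two edge sets are translation-equivalent. -/
def TransEquiv (E F : Set (Sym2 (ℤ × ℤ))) : Prop :=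
  ∃ v : ℤ × ℤ, F = translateEdges v E

/-- The number of imperfect staircase polygons of perimeter `2n`: translation-equivalence
classes of edge sets of three-choice polygons of perimeter `2n` that are not translates of
the edge set of any staircase polygon. -/
noncomputable def imperfectCount (n : ℕ) : ℕ :=
  Nat.card {C : Set (Set (Sym2 (ℤ × ℤ))) //
    ∃ w : Fin (2 * n + 1) → ℤ × ℤ, IsThreeChoicePolygon n w ∧
      ¬ IsStaircaseTranslate (polygonEdges n w) ∧
      C = {F | TransEquiv (polygonEdges n w) F}}

/-- A lattice edge is horizontal. -/
def IsHorizontalEdge (e : Sym2 (ℤ × ℤ)) : Prop :=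
  ∃ a : ℤ × ℤ, e = s(a, a + (1, 0))

/-- A lattice edge is vertical. -/
def IsVerticalEdge (e : Sym2 (ℤ × ℤ)) : Prop :=
  ∃ a : ℤ × ℤ, e = s(a, a + (0, 1))

/-- The number of horizontal edges in a set of lattice edges. -/
noncomputable def horizCount (E : Set (Sym2 (ℤ × ℤ))) : ℕ :=
  Nat.card {e : Sym2 (ℤ × ℤ) // e ∈ E ∧ IsHorizontalEdge e}

/-- The number of vertical edges in a set of lattice edges. -/
noncomputable def vertCount (E : Set (Sym2 (ℤ × ℤ))) : ℕ :=
  Nat.card {e : Sym2 (ℤ × ℤ) // e ∈ E ∧ IsVerticalEdge e}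

/-- `p_{m,n}`: the number of imperfect staircase polygons with exactly `2m` horizontal
edges and `2n` vertical edges (translation-equivalence classes of edge sets). -/
noncomputable def imperfectCountAniso (m n : ℕ) : ℕ :=
  Nat.card {C : Set (Set (Sym2 (ℤ × ℤ))) //
    ∃ w : Fin (2 * (m + n) + 1) → ℤ × ℤ, IsThreeChoicePolygon (m + n) w ∧
      ¬ IsStaircaseTranslate (polygonEdges (m + n) w) ∧
      horizCount (polygonEdges (m + n) w) = 2 * m ∧
      vertCount (polygonEdges (m + n) w) = 2 * n ∧
      C = {F | TransEquiv (polygonEdges (m + n) w) F}}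

/-- `H_n(x) = Σ_{m ≥ 0} p_{m,n} x^m` as a formal power series over `ℚ`. -/
noncomputable def Hgf (n : ℕ) : PowerSeries ℚ :=
  PowerSeries.mk fun m => (imperfectCountAniso m n : ℚ)

/-- The conjectured denominator `S_n(x)`. -/
noncomputable def Sden (n : ℕ) : Polynomial ℚ :=
  (1 - Polynomial.X) ^ (2 * n - 1) *
    (1 + Polynomial.X) ^ (if Even n then 2 * n - 7 else 2 * n - 8)

/-- Bivariate generating function of a set, the outer and the inner variable
marking `(w a).1` and `(w a).2`. -/
noncomputable def bigf {α : Type*} (A : Set α) (w : α → ℕ × ℕ) : PowerSeries (PowerSeries ℚ) :=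
  PowerSeries.mk fun k => PowerSeries.mk fun n => (({a | a ∈ A ∧ w a = (k, n)} : Set α).ncard : ℚ)

/-- The monomial of weight `s`. -/
noncomputable def bimon (s : ℕ × ℕ) : PowerSeries (PowerSeries ℚ) :=
  PowerSeries.C ((PowerSeries.X : PowerSeries ℚ) ^ s.2) * PowerSeries.X ^ s.1

theorem coeff_bimon_mul (s : ℕ × ℕ) (G : PowerSeries (PowerSeries ℚ)) (k n : ℕ) :
    PowerSeries.coeff n (PowerSeries.coeff k (bimon s * G)) =
      if s.1 ≤ k ∧ s.2 ≤ n then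
        PowerSeries.coeff (n - s.2) (PowerSeries.coeff (k - s.1) G) else 0 := by
  unfold bimon
  rw [mul_assoc, PowerSeries.coeff_C_mul, PowerSeries.coeff_X_pow_mul',
    PowerSeries.coeff_X_pow_mul']
  by_cases h1 : s.1 ≤ k <;> by_cases h2 : s.2 ≤ n <;> simp [h1, h2]

theorem bigf_decomp {α α' β : Type*} [Fintype β] (A : Set α) (w : α → ℕ × ℕ)
    (A' : β → Set α') (w' : α' → ℕ × ℕ) (f : β → α' → α) (s : β → ℕ × ℕ)
    (hA : ∀ a, a ∈ A ↔ ∃ b, ∃ a' ∈ A' b, f b a' = a)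
    (hf : ∀ b b' a a', f b a = f b' a' → b = b' ∧ a = a')
    (hw : ∀ b a, w (f b a) = w' a + s b)
    (hfin : ∀ p, {a | w' a = p}.Finite) :
    bigf A w = ∑ b, bimon (s b) * bigf (A' b) w' := by
  ext k n
  rw [map_sum, map_sum]
  simp only [coeff_bimon_mul]
  simp only [bigf, PowerSeries.coeff_mk]
  have hset : {a | a ∈ A ∧ w a = (k, n)} =
      ⋃ b ∈ (Finset.univ : Finset β), f b '' {a | a ∈ A' b ∧ w' a + s b = (k, n)} := by
    ext a
    simp only [Set.mem_ofPred_eq, Finset.mem_univ, Set.iUnion_true, Set.mem_iUnion, Set.mem_image]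
    rw [hA]
    constructor
    · rintro ⟨⟨b, a', ha', rfl⟩, h⟩
      exact ⟨b, a', ⟨ha', by rw [← hw, h]⟩, rfl⟩
    · rintro ⟨b, a', ⟨ha', h⟩, rfl⟩
      exact ⟨⟨b, a', ha', rfl⟩, by rw [hw, h]⟩
  have hfin' : ∀ b, {a | a ∈ A' b ∧ w' a + s b = (k, n)}.Finite := by
    intro b
    refine (hfin (k - (s b).1, n - (s b).2)).subset ?_
    rintro a ⟨-, h⟩
    have h1 := congrArg Prod.fst h
    have h2 := congrArg Prod.snd h
    simp only [Prod.fst_add, Prod.snd_add] at h1 h2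
    simp only [Set.mem_ofPred_eq, Prod.ext_iff]
    omega
  rw [hset]
  have key : (⋃ b ∈ (Finset.univ : Finset β),
      f b '' {a | a ∈ A' b ∧ w' a + s b = (k, n)}).ncard =
      ∑ b, ({a | a ∈ A' b ∧ w' a + s b = (k, n)}).ncard := by
    have := Set.ncard_iUnion_of_finite (s := fun b => f b '' {a | a ∈ A' b ∧ w' a + s b = (k, n)})
      (fun b => (hfin' b).image _) (by
        intro b b' hbb'
        rw [Function.onFun, Set.disjoint_left]
        rintro x ⟨a, -, rfl⟩ ⟨a', -, h⟩
        exact hbb' (hf _ _ _ _ h).1.symm)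
    simp only [Finset.mem_univ, Set.iUnion_true]
    rw [this, finsum_eq_sum_of_fintype]
    refine Finset.sum_congr rfl fun b _ => Set.ncard_image_of_injective _ ?_
    intro a a' h
    exact (hf _ _ _ _ h).2
  rw [key]
  push_cast
  refine Finset.sum_congr rfl fun b _ => ?_
  split_ifs with h
  · congr 2
    ext a
    simp only [Set.mem_ofPred_eq, Prod.ext_iff, Prod.fst_add, Prod.snd_add]
    refine and_congr_right fun _ => ?_
    omega
  · rw [Nat.cast_eq_zero, Set.ncard_eq_zero (hfin' b)]
    ext a
    simp only [Set.mem_ofPred_eq, Prod.ext_iff, Prod.fst_add, Prod.snd_add, Set.mem_empty_iff_false,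
      iff_false]
    omega

theorem bigf_union {α : Type*} (A B : Set α) (w : α → ℕ × ℕ) (h : Disjoint A B)
    (hfin : ∀ p, {a | w a = p}.Finite) : bigf (A ∪ B) w = bigf A w + bigf B w := by
  ext k n
  simp only [bigf, PowerSeries.coeff_mk, map_add]
  rw [← Nat.cast_add, ← Set.ncard_union_eq
    (Set.disjoint_left.2 fun a ha hb => Set.disjoint_left.1 h ha.1 hb.1)
    ((hfin _).subset fun a ha => ha.2) ((hfin _).subset fun a ha => ha.2)]
  congr 2
  ext a
  simp only [Set.mem_ofPred_eq, Set.mem_union]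
  tauto

theorem bigf_empty {α : Type*} (w : α → ℕ × ℕ) : bigf (∅ : Set α) w = 0 := by
  ext k n; simp [bigf]

theorem bigf_singleton {α : Type*} (a : α) (w : α → ℕ × ℕ) : bigf {a} w = bimon (w a) := by
  ext k n
  have := coeff_bimon_mul (w a) 1 k n
  rw [mul_one] at this
  rw [this]
  simp only [bigf, PowerSeries.coeff_mk]
  by_cases h : w a = (k, n)
  · rw [h]
    have : {b | b ∈ ({a} : Set α) ∧ w b = (k, n)} = {a} := by
      ext b; simp only [Set.mem_singleton_iff, Set.mem_ofPred_eq]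
      exact ⟨fun h => h.1, fun hb => ⟨hb, hb ▸ h⟩⟩
    rw [this]; simp
  · have : {b | b ∈ ({a} : Set α) ∧ w b = (k, n)} = ∅ := by
      ext b
      simp only [Set.mem_singleton_iff, Set.mem_ofPred_eq, Set.mem_empty_iff_false, iff_false]
      rintro ⟨rfl, h'⟩; exact h h'
    rw [this]
    simp only [Set.ncard_empty, Nat.cast_zero]
    rw [Prod.ext_iff] at h
    simp only [PowerSeries.coeff_one]
    split_ifs <;> simp_all [PowerSeries.coeff_one]
    omega

/-- Weight of a list of simultaneous moves: (number of vertical moves, number of moves). -/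
def lw (L : List (Bool × Bool)) : ℕ × ℕ :=
  ((L.map fun b => b.1.toNat + b.2.toNat).sum, L.length)

theorem lw_nil : lw [] = (0, 0) := rfl

theorem lw_cons (b : Bool × Bool) (L : List (Bool × Bool)) :
    lw (b :: L) = lw L + (b.1.toNat + b.2.toNat, 1) := by
  simp [lw, add_comm]

/-- The integer value of a bit. -/
def bz (b : Bool) : ℤ := if b then 1 else 0

theorem bz_eq_toNat (b : Bool) : bz b = (b.toNat : ℤ) := by cases b <;> rfl

/-- `L` encodes two paths starting at heights `l ≤ u`, first meeting at the very end. -/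
def Valid2 : List (Bool × Bool) → ℤ → ℤ → Prop
  | [], l, u => l = u
  | b :: L, l, u => l < u ∧ Valid2 L (l - bz b.1) (u - bz b.2)

/-- Four non-intersecting paths starting at `l ≤ i < j ≤ u`, where the lower two and the upper two
first meet at the ends of `low` and of `hi`. -/
def Valid4 : List (Bool × Bool) → List (Bool × Bool) → ℤ → ℤ → ℤ → ℤ → Prop
  | [], hi, l, i, j, u => l = i ∧ i < j ∧ Valid2 hi j u
  | b :: low, [], l, i, j, u => i < j ∧ j = u ∧ Valid2 (b :: low) l i
  | b :: low, c :: hi, l, i, j, u => (l < i ∧ i < j ∧ j < u) ∧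
      Valid4 low hi (l - bz b.1) (i - bz b.2) (j - bz c.1) (u - bz c.2)

/-- Two paths starting at `l < u`, followed for `rl.length` moves, after which the origin
lies strictly between them and a two-legged notch opens. -/
def ValidE : List (Bool × Bool) → List (Bool × Bool) → List (Bool × Bool) → ℤ → ℤ → Prop
  | [], low, hi, l, u => l < 0 ∧ 0 < u ∧ ∃ b b' low' hi', low = (b, true) :: low' ∧
      hi = (false, b') :: hi' ∧ Valid4 low' hi' (l - bz b) (-1) 0 (u - bz b')
  | b :: rl, low, hi, l, u => l < u ∧ ValidE rl low hi (l - bz b.1) (u - bz b.2)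

noncomputable def V2 (l u : ℤ) : PowerSeries (PowerSeries ℚ) := bigf {L | Valid2 L l u} lw

noncomputable def V4 (l i j u : ℤ) : PowerSeries (PowerSeries ℚ) :=
  bigf {p : List (Bool × Bool) × List (Bool × Bool) | Valid4 p.1 p.2 l i j u}
    fun p => lw p.1 + lw p.2

noncomputable def VE (l u : ℤ) : PowerSeries (PowerSeries ℚ) :=
  bigf {p : List (Bool × Bool) × List (Bool × Bool) × List (Bool × Bool) |
    ValidE p.1 p.2.1 p.2.2 l u} fun p => lw p.1 + (lw p.2.1 + lw p.2.2)

theorem finite_lw (p : ℕ × ℕ) : {L | lw L = p}.Finite := by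
  refine (List.finite_length_eq (Bool × Bool) p.2).subset ?_
  rintro L rfl
  rfl

theorem finite_lw_le (n : ℕ) : {L | (lw L).2 ≤ n}.Finite :=
  List.finite_length_le (Bool × Bool) n

theorem finite_lw2 (p : ℕ × ℕ) :
    {a : List (Bool × Bool) × List (Bool × Bool) | lw a.1 + lw a.2 = p}.Finite := by
  refine ((finite_lw_le p.2).prod (finite_lw_le p.2)).subset ?_
  rintro ⟨a, b⟩ rfl
  simp [Set.mem_prod]

theorem finite_lw3 (p : ℕ × ℕ) :
    {a : List (Bool × Bool) × List (Bool × Bool) × List (Bool × Bool) |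
      lw a.1 + (lw a.2.1 + lw a.2.2) = p}.Finite := by
  refine ((finite_lw_le p.2).prod ((finite_lw_le p.2).prod (finite_lw_le p.2))).subset ?_
  rintro ⟨a, b, c⟩ rfl
  simp only [Set.mem_prod, Set.mem_ofPred_eq, Prod.snd_add]
  omega

theorem bimon_zero : bimon 0 = 1 := by simp [bimon]

theorem Valid2.le {L : List (Bool × Bool)} {l u : ℤ} (h : Valid2 L l u) : l ≤ u := by
  cases L with
  | nil => exact le_of_eq h
  | cons b L => exact h.1.le

theorem V2_self (l : ℤ) : V2 l l = 1 := by
  have : {L | Valid2 L l l} = {[]} := by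
    ext L
    cases L <;> simp [Valid2]
  rw [V2, this, bigf_singleton, lw_nil]
  exact bimon_zero

theorem V2_of_lt {l u : ℤ} (h : u < l) : V2 l u = 0 := by
  have : {L | Valid2 L l u} = ∅ := by
    ext L
    simp only [Set.mem_ofPred_eq, Set.mem_empty_iff_false, iff_false]
    intro hL
    have := hL.le
    omega
  rw [V2, this, bigf_empty]

theorem V2_rec {l u : ℤ} (h : l < u) :
    V2 l u = ∑ b : Bool × Bool, bimon (b.1.toNat + b.2.toNat, 1) *
      V2 (l - bz b.1) (u - bz b.2) := by
  refine bigf_decomp _ _ (fun b : Bool × Bool => {L | Valid2 L (l - bz b.1) (u - bz b.2)}) lw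
    (fun b L => b :: L) _ ?_ ?_ ?_ finite_lw
  · intro L
    cases L with
    | nil => simp [Valid2, h.ne]
    | cons b L =>
      constructor
      · intro hL
        exact ⟨b, L, hL.2, rfl⟩
      · rintro ⟨b', L', hL, he⟩
        obtain ⟨rfl, rfl⟩ := List.cons_eq_cons.1 he
        exact ⟨h, hL⟩
  · intro b b' a a' hh
    exact List.cons_eq_cons.1 hh
  · intro b a
    exact lw_cons b a

theorem V4_low {l j u : ℤ} (h : l < j) : V4 l l j u = V2 j u := by
  have := bigf_decomp {p : List (Bool × Bool) × List (Bool × Bool) | Valid4 p.1 p.2 l l j u}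
    (fun p => lw p.1 + lw p.2) (fun _ : Unit => {L | Valid2 L j u}) lw (fun _ L => ([], L))
    (fun _ => 0) ?_ (by simp) (by simp [lw_nil, Prod.ext_iff]) finite_lw
  · simpa [V4, V2, bimon_zero] using this
  · rintro ⟨low, hi⟩
    rcases low with _ | ⟨b, low⟩
    · simp [Valid4, h]
    · rcases hi with _ | ⟨b', hi⟩ <;> simp [Valid4, Valid2]

theorem V4_hi {l i j : ℤ} (h : i < j) : V4 l i j j = V2 l i := by
  have := bigf_decomp {p : List (Bool × Bool) × List (Bool × Bool) | Valid4 p.1 p.2 l i j j}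
    (fun p => lw p.1 + lw p.2) (fun _ : Unit => {L | Valid2 L l i}) lw (fun _ L => (L, []))
    (fun _ => 0) ?_ (by simp) (by simp [lw_nil, Prod.ext_iff]) finite_lw
  · simpa [V4, V2, bimon_zero] using this
  · rintro ⟨low, hi⟩
    rcases hi with _ | ⟨b', hi⟩ <;> rcases low with _ | ⟨b, low⟩ <;> simp [Valid4, Valid2, h]

theorem V4_rec {l i j u : ℤ} (h1 : l < i) (h2 : i < j) (h3 : j < u) :
    V4 l i j u = ∑ b : (Bool × Bool) × (Bool × Bool),
      bimon (b.1.1.toNat + b.1.2.toNat + (b.2.1.toNat + b.2.2.toNat), 2) *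
      V4 (l - bz b.1.1) (i - bz b.1.2) (j - bz b.2.1) (u - bz b.2.2) := by
  refine bigf_decomp _ _ (fun b : (Bool × Bool) × (Bool × Bool) =>
    {p : List (Bool × Bool) × List (Bool × Bool) | Valid4 p.1 p.2
      (l - bz b.1.1) (i - bz b.1.2) (j - bz b.2.1) (u - bz b.2.2)}) (fun p => lw p.1 + lw p.2)
    (fun b p => (b.1 :: p.1, b.2 :: p.2)) _ ?_ ?_ ?_ finite_lw2
  · rintro ⟨low, hi⟩
    rcases low with _ | ⟨b, low⟩
    · simp [Valid4, h1.ne]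
    rcases hi with _ | ⟨b', hi⟩
    · simp [Valid4, h3.ne]
    constructor
    · intro hL
      exact ⟨(b, b'), (low, hi), hL.2, rfl⟩
    · rintro ⟨⟨c, c'⟩, ⟨a, a'⟩, hL, he⟩
      simp only [Prod.mk.injEq, List.cons.injEq] at he
      obtain ⟨⟨rfl, rfl⟩, rfl, rfl⟩ := he
      exact ⟨⟨h1, h2, h3⟩, hL⟩
  · rintro ⟨b, b'⟩ ⟨c, c'⟩ ⟨a, a'⟩ ⟨d, d'⟩ he
    simp only [Prod.mk.injEq, List.cons.injEq] at he ⊢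
    tauto
  · rintro ⟨b, b'⟩ ⟨a, a'⟩
    simp only [lw_cons, Prod.ext_iff, Prod.fst_add, Prod.snd_add]
    omega

theorem VE_of_le {l u : ℤ} (h : u ≤ l) : VE l u = 0 := by
  have : {p : List (Bool × Bool) × List (Bool × Bool) × List (Bool × Bool) |
    ValidE p.1 p.2.1 p.2.2 l u} = ∅ := by
    ext ⟨rl, low, hi⟩
    simp only [Set.mem_ofPred_eq, Set.mem_empty_iff_false, iff_false]
    cases rl with
    | nil => rintro ⟨h1, h2, -⟩; omega
    | cons b rl => rintro ⟨h1, -⟩; omega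
  rw [VE, this, bigf_empty]

/-- The contribution of the notch to `VE`. -/
noncomputable def notchSum (l u : ℤ) : PowerSeries (PowerSeries ℚ) :=
  if l < 0 ∧ 0 < u then ∑ b : Bool × Bool, bimon (b.1.toNat + b.2.toNat + 1, 2) *
      V4 (l - bz b.1) (-1) 0 (u - bz b.2) else 0

theorem VE_rec {l u : ℤ} (h : l < u) :
    VE l u = (∑ b : Bool × Bool, bimon (b.1.toNat + b.2.toNat, 1) *
      VE (l - bz b.1) (u - bz b.2)) + notchSum l u := by
  have hsplit : {p : List (Bool × Bool) × List (Bool × Bool) × List (Bool × Bool) |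
      ValidE p.1 p.2.1 p.2.2 l u} = {p | p.1 ≠ [] ∧ ValidE p.1 p.2.1 p.2.2 l u} ∪
      {p | p.1 = [] ∧ ValidE p.1 p.2.1 p.2.2 l u} := by
    ext p
    simp only [Set.mem_ofPred_eq, Set.mem_union]
    tauto
  rw [VE, hsplit, bigf_union _ _ _ _ finite_lw3]
  swap
  · rw [Set.disjoint_left]
    rintro a ⟨h1, -⟩ ⟨h2, -⟩
    exact h1 h2
  congr 1
  · refine bigf_decomp _ _ (fun b : Bool × Bool =>
      {p : List (Bool × Bool) × List (Bool × Bool) × List (Bool × Bool) |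
        ValidE p.1 p.2.1 p.2.2 (l - bz b.1) (u - bz b.2)}) _
      (fun b p => (b :: p.1, p.2)) _ ?_ ?_ ?_ finite_lw3
    · rintro ⟨rl, p⟩
      cases rl with
      | nil => simp
      | cons b rl =>
        constructor
        · rintro ⟨-, hL⟩
          exact ⟨b, (rl, p), hL.2, rfl⟩
        · rintro ⟨b', ⟨rl', p'⟩, hL, he⟩
          simp only [Prod.mk.injEq, List.cons.injEq] at he
          obtain ⟨⟨rfl, rfl⟩, rfl⟩ := he
          exact ⟨by simp, h, hL⟩
    · rintro b b' ⟨a, p⟩ ⟨a', p'⟩ he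
      simp only [Prod.mk.injEq, List.cons.injEq] at he ⊢
      tauto
    · rintro b ⟨a, p⟩
      simp only [lw_cons]
      abel
  · unfold notchSum
    split_ifs with h0
    · refine bigf_decomp _ _ (fun b : Bool × Bool =>
        {p : List (Bool × Bool) × List (Bool × Bool) |
          Valid4 p.1 p.2 (l - bz b.1) (-1) 0 (u - bz b.2)}) _
        (fun b p => ([], (b.1, true) :: p.1, (false, b.2) :: p.2)) _ ?_ ?_ ?_ finite_lw2
      · rintro ⟨rl, low, hi⟩
        constructor
        · rintro ⟨rfl, -, -, b, b', low', hi', rfl, rfl, hv⟩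
          exact ⟨(b, b'), (low', hi'), hv, rfl⟩
        · rintro ⟨⟨b, b'⟩, ⟨low', hi'⟩, hv, he⟩
          simp only [Prod.mk.injEq] at he
          obtain ⟨rfl, rfl, rfl⟩ := he
          exact ⟨rfl, h0.1, h0.2, b, b', low', hi', rfl, rfl, hv⟩
      · rintro ⟨b, b'⟩ ⟨c, c'⟩ ⟨a, a'⟩ ⟨d, d'⟩ he
        simp only [Prod.mk.injEq, List.cons.injEq] at he ⊢
        tauto
      · rintro ⟨b, b'⟩ ⟨a, a'⟩
        simp only [lw_cons, lw_nil, Prod.ext_iff, Prod.fst_add, Prod.snd_add, Bool.toNat_true,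
          Bool.toNat_false]
        omega
    · have : {p : List (Bool × Bool) × List (Bool × Bool) × List (Bool × Bool) |
          p.1 = [] ∧ ValidE p.1 p.2.1 p.2.2 l u} = ∅ := by
        ext ⟨rl, low, hi⟩
        simp only [Set.mem_ofPred_eq, Set.mem_empty_iff_false, iff_false]
        rintro ⟨rfl, h1, h2, -⟩
        exact h0 ⟨h1, h2⟩
      rw [this, bigf_empty]

theorem V4_of_le {l i j u : ℤ} (h : j ≤ i) : V4 l i j u = 0 := by
  have : {p : List (Bool × Bool) × List (Bool × Bool) | Valid4 p.1 p.2 l i j u} = ∅ := by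
    ext ⟨low, hi⟩
    simp only [Set.mem_ofPred_eq, Set.mem_empty_iff_false, iff_false]
    rcases low with _ | ⟨b, low⟩
    · rintro ⟨-, h1, -⟩; omega
    · rcases hi with _ | ⟨b', hi⟩
      · rintro ⟨h1, -⟩; omega
      · rintro ⟨⟨-, h1, -⟩, -⟩; omega
  rw [V4, this, bigf_empty]

/-- Pairs of paths that start apart. -/
noncomputable def Q2 (l u : ℤ) : PowerSeries (PowerSeries ℚ) := if l < u then V2 l u else 0

/-- The Kronecker delta of the two heights. -/
noncomputable def D2 (l u : ℤ) : PowerSeries (PowerSeries ℚ) := if l = u then 1 else 0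

/-- The one-step meeting term. -/
noncomputable def S2 (l u : ℤ) : PowerSeries (PowerSeries ℚ) :=
  if u = l + 1 then bimon (1, 1) else 0

theorem V2_eq_add (l u : ℤ) : V2 l u = Q2 l u + D2 l u := by
  unfold Q2 D2
  rcases lt_trichotomy l u with h | h | h
  · simp [h, h.ne]
  · subst h; simp [V2_self]
  · simp [V2_of_lt h, h.not_gt, h.ne']

theorem sum_bool_prod {M : Type*} [AddCommMonoid M] (f : Bool × Bool → M) :
    ∑ b, f b = f (false, false) + f (false, true) + f (true, false) + f (true, true) := by
  simp [Fintype.sum_prod_type]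
  abel

theorem D2_rec {l u : ℤ} (h : l < u) :
    S2 l u = ∑ b : Bool × Bool, bimon (b.1.toNat + b.2.toNat, 1) *
      D2 (l - bz b.1) (u - bz b.2) := by
  simp only [sum_bool_prod, D2, S2, bz]
  by_cases hu : u = l + 1
  · subst hu
    simp only [Bool.toNat_true, Bool.toNat_false]
    have h1 : l - 1 ≠ l + 1 := by omega
    simp [h1]
  · have h1 : l ≠ u := h.ne
    have h2 : l ≠ u - 1 := by omega
    have h3 : l - 1 ≠ u := by omega
    simp [hu, h1, h2, h3]

theorem Q2_rec {l u : ℤ} (h : l < u) :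
    Q2 l u = S2 l u + ∑ b : Bool × Bool, bimon (b.1.toNat + b.2.toNat, 1) *
      Q2 (l - bz b.1) (u - bz b.2) := by
  have h1 := V2_rec h
  simp only [V2_eq_add (_ - _)] at h1
  simp only [mul_add, Finset.sum_add_distrib] at h1
  rw [← D2_rec h] at h1
  rw [Q2, if_pos h, h1, add_comm]

/-- Pfaffian of the pair series. -/
noncomputable def Pf (l i j u : ℤ) : PowerSeries (PowerSeries ℚ) :=
  Q2 l i * Q2 j u - Q2 l j * Q2 i u + Q2 l u * Q2 i j

/-- The defect between the Pfaffian and the four-path series. -/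
noncomputable def defect (l i j u : ℤ) : PowerSeries (PowerSeries ℚ) :=
  if l < i ∧ i < j ∧ j < u then Pf l i j u - V4 l i j u else 0

/-- Boundary values of the four-path series. -/
noncomputable def bdry (l i j u : ℤ) : PowerSeries (PowerSeries ℚ) :=
  D2 l i * V2 j u + V2 l i * D2 j u - D2 l i * D2 j u

theorem S2_of_ne {l u : ℤ} (h : u ≠ l + 1) : S2 l u = 0 := if_neg h

theorem bimon_split (a b c d : ℕ) : bimon (a + b + (c + d), 2) =
    bimon (0, 1) ^ 2 * PowerSeries.X ^ a * PowerSeries.X ^ b * PowerSeries.X ^ c *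
      PowerSeries.X ^ d := by
  simp only [bimon, pow_add, map_pow]
  ring

theorem bimon_split2 (a b : ℕ) : bimon (a + b, 1) =
    bimon (0, 1) * PowerSeries.X ^ a * PowerSeries.X ^ b := by
  simp only [bimon, pow_add]
  ring

theorem sum_mul_sum12 (f g : Bool → Bool → PowerSeries (PowerSeries ℚ)) :
    (∑ b : Bool × Bool, bimon (b.1.toNat + b.2.toNat, 1) * f b.1 b.2) *
    (∑ b : Bool × Bool, bimon (b.1.toNat + b.2.toNat, 1) * g b.1 b.2) =
    ∑ b : (Bool × Bool) × (Bool × Bool),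
      bimon (b.1.1.toNat + b.1.2.toNat + (b.2.1.toNat + b.2.2.toNat), 2) *
      (f b.1.1 b.1.2 * g b.2.1 b.2.2) := by
  simp only [bimon_split, bimon_split2, Fintype.sum_prod_type, Fintype.sum_bool]
  ring

theorem sum_mul_sum13 (f g : Bool → Bool → PowerSeries (PowerSeries ℚ)) :
    (∑ b : Bool × Bool, bimon (b.1.toNat + b.2.toNat, 1) * f b.1 b.2) *
    (∑ b : Bool × Bool, bimon (b.1.toNat + b.2.toNat, 1) * g b.1 b.2) =
    ∑ b : (Bool × Bool) × (Bool × Bool),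
      bimon (b.1.1.toNat + b.1.2.toNat + (b.2.1.toNat + b.2.2.toNat), 2) *
      (f b.1.1 b.2.1 * g b.1.2 b.2.2) := by
  simp only [bimon_split, bimon_split2, Fintype.sum_prod_type, Fintype.sum_bool]
  ring

theorem sum_mul_sum14 (f g : Bool → Bool → PowerSeries (PowerSeries ℚ)) :
    (∑ b : Bool × Bool, bimon (b.1.toNat + b.2.toNat, 1) * f b.1 b.2) *
    (∑ b : Bool × Bool, bimon (b.1.toNat + b.2.toNat, 1) * g b.1 b.2) =
    ∑ b : (Bool × Bool) × (Bool × Bool),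
      bimon (b.1.1.toNat + b.1.2.toNat + (b.2.1.toNat + b.2.2.toNat), 2) *
      (f b.1.1 b.2.2 * g b.1.2 b.2.1) := by
  simp only [bimon_split, bimon_split2, Fintype.sum_prod_type, Fintype.sum_bool]
  ring

theorem Pf_rec {l i j u : ℤ} (h1 : l < i) (h2 : i < j) (h3 : j < u) :
    Pf l i j u = (∑ b : (Bool × Bool) × (Bool × Bool),
      bimon (b.1.1.toNat + b.1.2.toNat + (b.2.1.toNat + b.2.2.toNat), 2) *
      Pf (l - bz b.1.1) (i - bz b.1.2) (j - bz b.2.1) (u - bz b.2.2)) +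
      (S2 l i * Q2 j u + Q2 l i * S2 j u - S2 l i * S2 j u) + S2 i j * Q2 l u := by
  have e12 := Q2_rec h1
  have e34 := Q2_rec h3
  have e13 := Q2_rec (h1.trans h2)
  have e24 := Q2_rec (h2.trans h3)
  have e14 := Q2_rec (h1.trans (h2.trans h3))
  have e23 := Q2_rec h2
  rw [S2_of_ne (by omega), zero_add] at e13 e24 e14
  have k12 := sum_mul_sum12 (fun b c => Q2 (l - bz b) (i - bz c))
    fun b c => Q2 (j - bz b) (u - bz c)
  have k13 := sum_mul_sum13 (fun b c => Q2 (l - bz b) (j - bz c))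
    fun b c => Q2 (i - bz b) (u - bz c)
  have k14 := sum_mul_sum14 (fun b c => Q2 (l - bz b) (u - bz c))
    fun b c => Q2 (i - bz b) (j - bz c)
  rw [← e13, ← e24] at k13
  rw [← e14, ← sub_eq_of_eq_add' e23] at k14
  rw [← sub_eq_of_eq_add' e12, ← sub_eq_of_eq_add' e34] at k12
  simp only [Pf, mul_add, mul_sub, Finset.sum_add_distrib, Finset.sum_sub_distrib]
  rw [← k12, ← k13, ← k14]
  ring

theorem Pf_of_tie {l i j u : ℤ} (h : l = i ∨ i = j ∨ j = u) : Pf l i j u = 0 := by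
  unfold Pf
  have h0 : ∀ a, Q2 a a = 0 := fun a => if_neg (lt_irrefl a)
  rcases h with rfl | rfl | rfl <;> rw [h0] <;> ring

theorem bdry_rec {l i j u : ℤ} (h1 : l < i) (h3 : j < u) :
    ∑ b : (Bool × Bool) × (Bool × Bool),
      bimon (b.1.1.toNat + b.1.2.toNat + (b.2.1.toNat + b.2.2.toNat), 2) *
      bdry (l - bz b.1.1) (i - bz b.1.2) (j - bz b.2.1) (u - bz b.2.2) =
      S2 l i * Q2 j u + Q2 l i * S2 j u - S2 l i * S2 j u := by
  have e12 := V2_rec h1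
  have e34 := V2_rec h3
  have d12 := D2_rec h1
  have d34 := D2_rec h3
  simp only [bdry, mul_add, mul_sub, Finset.sum_add_distrib, Finset.sum_sub_distrib]
  rw [← sum_mul_sum12 (fun b c => D2 (l - bz b) (i - bz c)) fun b c => V2 (j - bz b) (u - bz c),
    ← sum_mul_sum12 (fun b c => V2 (l - bz b) (i - bz c)) fun b c => D2 (j - bz b) (u - bz c),
    ← sum_mul_sum12 (fun b c => D2 (l - bz b) (i - bz c)) fun b c => D2 (j - bz b) (u - bz c)]
  rw [← e12, ← e34, ← d12, ← d34, Q2, Q2, if_pos h1, if_pos h3]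

theorem V4_eq_of_weak {l i j u : ℤ} (h1 : l ≤ i) (h2 : i ≤ j) (h3 : j ≤ u)
    (h4 : i = j → l < i ∧ j < u) :
    V4 l i j u = Pf l i j u - defect l i j u + bdry l i j u := by
  unfold defect
  split_ifs with h
  · have e1 : D2 l i = 0 := if_neg h.1.ne
    have e2 : D2 j u = 0 := if_neg h.2.2.ne
    simp [bdry, e1, e2]
  · rw [Pf_of_tie (by omega)]
    rcases eq_or_lt_of_le h2 with h5 | h5
    · rw [V4_of_le h5.ge]
      have e1 : D2 l i = 0 := if_neg (h4 h5).1.ne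
      have e2 : D2 j u = 0 := if_neg (h4 h5).2.ne
      simp [bdry, e1, e2]
    rcases eq_or_lt_of_le h1 with h6 | h6
    · subst h6
      rw [V4_low h5]
      simp [bdry, D2, V2_self]
    · have h7 : j = u := by omega
      subst h7
      rw [V4_hi h5]
      have e1 : D2 l i = 0 := if_neg h6.ne
      have e2 : D2 j j = 1 := if_pos rfl
      simp [bdry, e1, e2]

theorem bz_nonneg (b : Bool) : 0 ≤ bz b := by cases b <;> decide

theorem bz_le_one (b : Bool) : bz b ≤ 1 := by cases b <;> decide

theorem defect_rec {l i j u : ℤ} (h1 : l < i) (h2 : i < j) (h3 : j < u) :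
    defect l i j u = (∑ b : (Bool × Bool) × (Bool × Bool),
      bimon (b.1.1.toNat + b.1.2.toNat + (b.2.1.toNat + b.2.2.toNat), 2) *
      defect (l - bz b.1.1) (i - bz b.1.2) (j - bz b.2.1) (u - bz b.2.2)) +
      S2 i j * Q2 l u := by
  have hP := Pf_rec h1 h2 h3
  have hV := V4_rec h1 h2 h3
  have hB := bdry_rec (i := i) (j := j) h1 h3
  have hW : ∀ b : (Bool × Bool) × (Bool × Bool),
      V4 (l - bz b.1.1) (i - bz b.1.2) (j - bz b.2.1) (u - bz b.2.2) =
      Pf (l - bz b.1.1) (i - bz b.1.2) (j - bz b.2.1) (u - bz b.2.2) -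
      defect (l - bz b.1.1) (i - bz b.1.2) (j - bz b.2.1) (u - bz b.2.2) +
      bdry (l - bz b.1.1) (i - bz b.1.2) (j - bz b.2.1) (u - bz b.2.2) := by
    rintro ⟨⟨a, b⟩, ⟨c, d⟩⟩
    have := bz_nonneg a
    have := bz_nonneg b
    have := bz_nonneg c
    have := bz_nonneg d
    have := bz_le_one a
    have := bz_le_one b
    have := bz_le_one c
    have := bz_le_one d
    refine V4_eq_of_weak ?_ ?_ ?_ ?_ <;> dsimp only <;> omega
  simp only [hW, mul_add, mul_sub, Finset.sum_add_distrib, Finset.sum_sub_distrib] at hV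
  rw [hB] at hV
  have : defect l i j u = Pf l i j u - V4 l i j u := if_pos ⟨h1, h2, h3⟩
  rw [this, hP, hV]
  ring

/-- `f` is a rational function with denominator dividing `(1 - x)^a (1 + x)^b`. -/
def Den (a b : ℕ) (f : PowerSeries ℚ) : Prop :=
  ∃ R : Polynomial ℚ,
    (1 - PowerSeries.X) ^ a * (1 + PowerSeries.X) ^ b * f = (R : PowerSeries ℚ)

namespace Den

variable {a b : ℕ} {f g : PowerSeries ℚ}

theorem zero : Den a b 0 := ⟨0, by simp⟩

theorem add (hf : Den a b f) (hg : Den a b g) : Den a b (f + g) := by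
  obtain ⟨R, hR⟩ := hf
  obtain ⟨T, hT⟩ := hg
  exact ⟨R + T, by rw [mul_add, hR, hT, Polynomial.coe_add]⟩

theorem coe_mul (P : Polynomial ℚ) (hf : Den a b f) : Den a b ((P : PowerSeries ℚ) * f) := by
  obtain ⟨R, hR⟩ := hf
  exact ⟨P * R, by rw [Polynomial.coe_mul, ← hR]; ring⟩

theorem neg (hf : Den a b f) : Den a b (-f) := by
  simpa using hf.coe_mul (-1)

theorem sub (hf : Den a b f) (hg : Den a b g) : Den a b (f - g) := by
  rw [sub_eq_add_neg]
  exact hf.add hg.neg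

theorem X_pow_mul (n : ℕ) (hf : Den a b f) : Den a b (PowerSeries.X ^ n * f) := by
  simpa using hf.coe_mul (Polynomial.X ^ n)

theorem sum {ι : Type*} {s : Finset ι} {F : ι → PowerSeries ℚ} (h : ∀ i ∈ s, Den a b (F i)) :
    Den a b (∑ i ∈ s, F i) :=
  Finset.sum_induction F (Den a b) (fun _ _ => add) zero h

theorem mul {a' b' : ℕ} (hf : Den a b f) (hg : Den a' b' g) : Den (a + a') (b + b') (f * g) := by
  obtain ⟨R, hR⟩ := hf
  obtain ⟨T, hT⟩ := hg
  exact ⟨R * T, by rw [Polynomial.coe_mul, ← hR, ← hT]; ring⟩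

theorem mono {a' b' : ℕ} (hf : Den a b f) (ha : a ≤ a') (hb : b ≤ b') : Den a' b' f := by
  obtain ⟨R, hR⟩ := hf
  obtain ⟨c, rfl⟩ := Nat.exists_eq_add_of_le ha
  obtain ⟨d, rfl⟩ := Nat.exists_eq_add_of_le hb
  refine ⟨(1 - Polynomial.X) ^ c * (1 + Polynomial.X) ^ d * R, ?_⟩
  simp only [Polynomial.coe_mul, Polynomial.coe_pow, Polynomial.coe_sub, Polynomial.coe_add,
    Polynomial.coe_one, Polynomial.coe_X, ← hR]
  ring

theorem of_mul (h : Den a b ((1 - PowerSeries.X ^ 1) * f)) : Den (a + 1) b f := by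
  obtain ⟨R, hR⟩ := h
  exact ⟨R, by rw [← hR]; ring⟩

theorem of_mul_sq (h : Den a b ((1 - PowerSeries.X ^ 2) * f)) : Den (a + 1) (b + 1) f := by
  obtain ⟨R, hR⟩ := h
  exact ⟨R, by rw [← hR]; ring⟩

theorem one : Den a b 1 := by
  have : Den 0 0 1 := ⟨1, by simp⟩
  exact this.mono (Nat.zero_le _) (Nat.zero_le _)

end Den

theorem coeff_bimon_mul' (c n : ℕ) (G : PowerSeries (PowerSeries ℚ)) (k : ℕ) :
    PowerSeries.coeff k (bimon (c, n) * G) =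
      if c ≤ k then PowerSeries.X ^ n * PowerSeries.coeff (k - c) G else 0 := by
  unfold bimon
  rw [mul_assoc, PowerSeries.coeff_C_mul, PowerSeries.coeff_X_pow_mul']
  split_ifs <;> simp

theorem one_sub_X_pow_mul_eq_zero {n : ℕ} (hn : n ≠ 0) {f : PowerSeries ℚ}
    (h : (1 - PowerSeries.X ^ n) * f = 0) : f = 0 := by
  rcases mul_eq_zero.1 h with h | h
  · have := congrArg (PowerSeries.coeff 0) h
    simp [hn] at this
  · exact h

theorem coeff_V2_rec {l u : ℤ} (h : l < u) (k : ℕ) :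
    (1 - PowerSeries.X ^ 1) * PowerSeries.coeff k (V2 l u) =
      ∑ b : Bool × Bool, if b ≠ (false, false) ∧ b.1.toNat + b.2.toNat ≤ k then
        PowerSeries.X ^ 1 * PowerSeries.coeff (k - (b.1.toNat + b.2.toNat))
          (V2 (l - bz b.1) (u - bz b.2)) else 0 := by
  have := congrArg (PowerSeries.coeff k) (V2_rec h)
  simp only [sum_bool_prod, map_add, coeff_bimon_mul'] at this
  simp only [sum_bool_prod]
  simp [bz] at this ⊢
  linear_combination this

theorem coeff_V2_eq_zero (k : ℕ) : ∀ l u : ℤ, (k : ℤ) < u - l →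
    PowerSeries.coeff k (V2 l u) = 0 := by
  induction k using Nat.strong_induction_on with
  | _ k ih =>
    intro l u h
    refine one_sub_X_pow_mul_eq_zero one_ne_zero ?_
    rw [coeff_V2_rec (by omega)]
    refine Finset.sum_eq_zero fun b _ => ?_
    split_ifs with hb
    · rw [ih, mul_zero]
      · rcases b with ⟨_ | _, _ | _⟩ <;> simp_all <;> omega
      · rcases b with ⟨_ | _, _ | _⟩ <;> simp_all [bz] <;> omega
    · rfl

theorem den_coeff_V2 (k : ℕ) : ∀ l u : ℤ, Den k 0 (PowerSeries.coeff k (V2 l u)) := by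
  induction k using Nat.strong_induction_on with
  | _ k ih =>
    intro l u
    rcases lt_trichotomy l u with h | rfl | h
    · rcases Nat.eq_zero_or_pos k with rfl | hk
      · rw [coeff_V2_eq_zero 0 l u (by simpa using h)]
        exact Den.zero
      · obtain ⟨k, rfl⟩ := Nat.exists_eq_add_of_le' hk
        refine Den.of_mul ?_
        have := coeff_V2_rec h (k + 1)
        rw [this]
        refine Den.sum fun b _ => ?_
        split_ifs with hb
        · refine Den.X_pow_mul 1 ((ih _ ?_ _ _).mono ?_ le_rfl) <;>
            rcases b with ⟨_ | _, _ | _⟩ <;> simp_all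
        · exact Den.zero
    · rw [V2_self, PowerSeries.coeff_one]
      split_ifs
      · exact Den.one
      · exact Den.zero
    · rw [V2_of_lt h, map_zero]
      exact Den.zero

theorem den_coeff_mul {F G : PowerSeries (PowerSeries ℚ)}
    (hF : ∀ k, Den k 0 (PowerSeries.coeff k F)) (hG : ∀ k, Den k 0 (PowerSeries.coeff k G))
    (k : ℕ) : Den k 0 (PowerSeries.coeff k (F * G)) := by
  rw [PowerSeries.coeff_mul]
  refine Den.sum fun p hp => ?_
  rw [Finset.HasAntidiagonal.mem_antidiagonal] at hp
  exact ((hF p.1).mul (hG p.2)).mono hp.le le_rfl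

theorem den_coeff_Q2 (l u : ℤ) (k : ℕ) : Den k 0 (PowerSeries.coeff k (Q2 l u)) := by
  unfold Q2
  split_ifs
  · exact den_coeff_V2 k l u
  · rw [map_zero]
    exact Den.zero

theorem den_coeff_Pf (l i j u : ℤ) (k : ℕ) : Den k 0 (PowerSeries.coeff k (Pf l i j u)) := by
  simp only [Pf, map_add, map_sub]
  exact ((den_coeff_mul (den_coeff_Q2 _ _) (den_coeff_Q2 _ _) k).sub
    (den_coeff_mul (den_coeff_Q2 _ _) (den_coeff_Q2 _ _) k)).add
    (den_coeff_mul (den_coeff_Q2 _ _) (den_coeff_Q2 _ _) k)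

/-- Exponent of `1 + x` for the defect. -/
def e4 (s : ℤ) (k : ℕ) : ℕ := (if (s - k) % 4 = 2 then (k : ℤ) - 3 else (k : ℤ) - 4).toNat

theorem sum_bool_four {M : Type*} [AddCommMonoid M] (f : (Bool × Bool) × (Bool × Bool) → M) :
    ∑ b, f b = f ((false, false), (false, false)) +
      ∑ b, if b = ((false, false), (false, false)) then 0 else f b := by
  rw [← Finset.add_sum_erase Finset.univ f (Finset.mem_univ ((false, false), (false, false)))]
  congr 1
  rw [← Finset.sum_erase (s := Finset.univ)
    (f := fun b => if b = ((false, false), (false, false)) then 0 else f b)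
    (a := ((false, false), (false, false))) (by simp)]
  refine Finset.sum_congr rfl fun b hb => ?_
  rw [if_neg (Finset.ne_of_mem_erase hb)]

theorem coeff_S2_mul (l u : ℤ) (G : PowerSeries (PowerSeries ℚ)) (k : ℕ) :
    PowerSeries.coeff k (S2 l u * G) =
      if u = l + 1 ∧ 1 ≤ k then PowerSeries.X ^ 1 * PowerSeries.coeff (k - 1) G else 0 := by
  unfold S2
  by_cases h : u = l + 1
  · rw [if_pos h, coeff_bimon_mul']
    simp [h]
  · simp [h]

theorem coeff_defect_rec {l i j u : ℤ} (h1 : l < i) (h2 : i < j) (h3 : j < u) (k : ℕ) :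
    (1 - PowerSeries.X ^ 2) * PowerSeries.coeff k (defect l i j u) =
      (∑ b : (Bool × Bool) × (Bool × Bool), if b = ((false, false), (false, false)) then 0 else
        if b.1.1.toNat + b.1.2.toNat + (b.2.1.toNat + b.2.2.toNat) ≤ k then
        PowerSeries.X ^ 2 *
          PowerSeries.coeff (k - (b.1.1.toNat + b.1.2.toNat + (b.2.1.toNat + b.2.2.toNat)))
          (defect (l - bz b.1.1) (i - bz b.1.2) (j - bz b.2.1) (u - bz b.2.2)) else 0) +
      if j = i + 1 ∧ 1 ≤ k then PowerSeries.X ^ 1 * PowerSeries.coeff (k - 1) (Q2 l u) else 0 := by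
  have := congrArg (PowerSeries.coeff k) (defect_rec h1 h2 h3)
  rw [map_add, coeff_S2_mul, map_sum] at this
  simp only [coeff_bimon_mul'] at this
  rw [sum_bool_four] at this
  simp only [Bool.toNat_false, add_zero, Nat.zero_le, if_true, Nat.sub_zero, bz,
    Bool.false_eq_true, if_false, sub_zero] at this
  simp only [bz]
  linear_combination this

theorem toNat_sum_ne_zero {a b c d : Bool} (h : ¬((a, b), c, d) = ((false, false), false, false)) :
    a.toNat + b.toNat + (c.toNat + d.toNat) ≠ 0 := by
  revert a b c d; decide

theorem den_coeff_defect (k : ℕ) : ∀ l i j u : ℤ,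
    Den k (e4 (l + i + j + u) k) (PowerSeries.coeff k (defect l i j u)) ∧
    (e4 (l + i + j + u) k = 0 → PowerSeries.coeff k (defect l i j u) = 0) := by
  induction k using Nat.strong_induction_on with
  | _ k ih =>
    intro l i j u
    by_cases h : l < i ∧ i < j ∧ j < u
    swap
    · rw [defect, if_neg h, map_zero]
      exact ⟨Den.zero, fun _ => rfl⟩
    obtain ⟨h1, h2, h3⟩ := h
    have hrec := coeff_defect_rec h1 h2 h3 k
    set e := e4 (l + i + j + u) k with he
    rcases Nat.eq_zero_or_pos e with h0 | hpos
    · have hz : PowerSeries.coeff k (defect l i j u) = 0 := by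
        refine one_sub_X_pow_mul_eq_zero two_ne_zero ?_
        rw [hrec, Finset.sum_eq_zero, zero_add]
        · split_ifs with hj
          · have : k ≤ 4 := by unfold e4 at he; split_ifs at he <;> omega
            have hk : ((k - 1 : ℕ) : ℤ) < u - l := by
              unfold e4 at he; split_ifs at he <;> omega
            rw [Q2, if_pos (by omega), coeff_V2_eq_zero _ _ _ hk, mul_zero]
          · rfl
        · rintro ⟨⟨a, b⟩, ⟨c, d⟩⟩ -
          split_ifs with hb hk
          · rfl
          · dsimp only at hk ⊢
            have hne : a.toNat + b.toNat + (c.toNat + d.toNat) ≠ 0 := by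
              exact toNat_sum_ne_zero hb
            rw [(ih _ (by omega) _ _ _ _).2, mul_zero]
            simp only [bz_eq_toNat]
            unfold e4 at he ⊢; split_ifs at he ⊢ <;> omega
          · rfl
      rw [hz]
      exact ⟨Den.zero, fun _ => rfl⟩
    · refine ⟨?_, fun h => absurd h hpos.ne'⟩
      have hk : 1 ≤ k := by unfold e4 at he; split_ifs at he <;> omega
      obtain ⟨k, rfl⟩ := Nat.exists_eq_add_of_le' hk
      obtain ⟨e', he'⟩ := Nat.exists_eq_add_of_le' hpos
      rw [he']
      refine Den.of_mul_sq ?_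
      rw [hrec]
      refine (Den.sum fun b _ => ?_).add ?_
      · rcases b with ⟨⟨a, b⟩, ⟨c, d⟩⟩
        split_ifs with hb hk
        · exact Den.zero
        · dsimp only at hk ⊢
          have hne : a.toNat + b.toNat + (c.toNat + d.toNat) ≠ 0 := by
            exact toNat_sum_ne_zero hb
          refine Den.X_pow_mul 2 ((ih _ (by omega) _ _ _ _).1.mono (by omega) ?_)
          simp only [bz_eq_toNat]
          unfold e4 at he ⊢; split_ifs at he ⊢ <;> omega
        · exact Den.zero
      · split_ifs
        · exact Den.X_pow_mul 1 ((den_coeff_Q2 _ _ _).mono (by omega) (by omega))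
        · exact Den.zero

theorem den_coeff_V4 {l i j u : ℤ} (h1 : l ≤ i) (h2 : i < j) (h3 : j ≤ u) (k : ℕ) :
    (l < i ∧ j < u ∧ Den k (e4 (l + i + j + u) k) (PowerSeries.coeff k (V4 l i j u))) ∨
    Den k 0 (PowerSeries.coeff k (V4 l i j u)) := by
  rcases eq_or_lt_of_le h1 with rfl | h4
  · rw [V4_low h2]
    exact Or.inr (den_coeff_V2 _ _ _)
  rcases eq_or_lt_of_le h3 with rfl | h5
  · rw [V4_hi h2]
    exact Or.inr (den_coeff_V2 _ _ _)
  refine Or.inl ⟨h4, h5, ?_⟩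
  have : V4 l i j u = Pf l i j u - defect l i j u := by
    rw [defect, if_pos ⟨h4, h2, h5⟩]; ring
  rw [this, map_sub]
  exact ((den_coeff_Pf _ _ _ _ k).mono le_rfl (Nat.zero_le _)).sub (den_coeff_defect k l i j u).1

/-- Exponent of `1 + x` for the notched series. -/
def eE (d : ℤ) (k : ℕ) : ℕ := (if (k + d) % 4 = 0 then k + d - 7 else k + d - 8).toNat

theorem den_coeff_notchSum (l u : ℤ) (k : ℕ) :
    (k = 0 → PowerSeries.coeff k (notchSum l u) = 0) ∧
    Den (k - 1) (eE (u - l) k) (PowerSeries.coeff k (notchSum l u)) := by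
  unfold notchSum
  split_ifs with h
  · obtain ⟨h1, h2⟩ := h
    simp only [map_sum, coeff_bimon_mul']
    constructor
    · rintro rfl
      simp
    · refine Den.sum ?_
      rintro ⟨a, b⟩ -
      dsimp only
      split_ifs with hk
      · refine Den.X_pow_mul 2 ?_
        have ha := bz_le_one a
        have hb := bz_le_one b
        have ha' := bz_nonneg a
        have hb' := bz_nonneg b
        rcases den_coeff_V4 (l := l - bz a) (i := -1) (j := 0) (u := u - bz b) (by omega)
          (by omega) (by omega) (k - (a.toNat + b.toNat + 1)) with ⟨h3, h4, hd⟩ | hd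
        · refine hd.mono (by omega) ?_
          simp only [bz_eq_toNat] at *
          unfold e4 eE
          split_ifs <;> omega
        · exact hd.mono (by omega) (Nat.zero_le _)
      · exact Den.zero
  · simp only [map_zero]
    exact ⟨fun _ => trivial, Den.zero⟩

theorem coeff_VE_rec {l u : ℤ} (h : l < u) (k : ℕ) :
    (1 - PowerSeries.X ^ 1) * PowerSeries.coeff k (VE l u) =
      (∑ b : Bool × Bool, if b ≠ (false, false) ∧ b.1.toNat + b.2.toNat ≤ k then
        PowerSeries.X ^ 1 * PowerSeries.coeff (k - (b.1.toNat + b.2.toNat))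
          (VE (l - bz b.1) (u - bz b.2)) else 0) + PowerSeries.coeff k (notchSum l u) := by
  have := congrArg (PowerSeries.coeff k) (VE_rec h)
  simp only [sum_bool_prod, map_add, coeff_bimon_mul'] at this
  simp only [sum_bool_prod]
  simp [bz] at this ⊢
  linear_combination this

theorem den_coeff_VE (k : ℕ) : ∀ l u : ℤ,
    Den k (eE (u - l) k) (PowerSeries.coeff k (VE l u)) := by
  induction k using Nat.strong_induction_on with
  | _ k ih =>
    intro l u
    rcases le_or_gt u l with h | h
    · rw [VE_of_le h, map_zero]
      exact Den.zero
    have hrec := coeff_VE_rec h k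
    obtain ⟨hn0, hn⟩ := den_coeff_notchSum l u k
    rcases Nat.eq_zero_or_pos k with rfl | hk
    · have : PowerSeries.coeff 0 (VE l u) = 0 := by
        refine one_sub_X_pow_mul_eq_zero one_ne_zero ?_
        rw [hrec, hn0 rfl, add_zero]
        refine Finset.sum_eq_zero ?_
        rintro ⟨_ | _, _ | _⟩ - <;> simp
      rw [this]
      exact Den.zero
    · obtain ⟨k, rfl⟩ := Nat.exists_eq_add_of_le' hk
      refine Den.of_mul ?_
      rw [hrec]
      refine Den.add (Den.sum ?_) (by simpa using hn)
      rintro ⟨a, b⟩ -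
      dsimp only
      split_ifs with hb
      · have hne : a.toNat + b.toNat ≠ 0 := by
          revert hb; cases a <;> cases b <;> simp
        refine Den.X_pow_mul 1 ((ih _ (by omega) _ _).mono (by omega) ?_)
        have := Bool.toNat_le a
        have := Bool.toNat_le b
        simp only [bz_eq_toNat]
        unfold eE
        split_ifs <;> omega
      · exact Den.zero

/-- A closed self-avoiding lattice loop of length `M`, extended periodically, in the coordinates
`t = abscissa + ordinate` and `y = ordinate`. -/
structure Loop (M : ℤ) (t y : ℤ → ℤ) : Prop where
  big : 2 < M
  per_t : ∀ i, t (i + M) = t i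
  per_y : ∀ i, y (i + M) = y i
  inj : ∀ i j, t i = t j → y i = y j → M ∣ i - j
  step : ∀ i, (t (i + 1) = t i + 1 ∧ (y (i + 1) = y i ∨ y (i + 1) = y i + 1)) ∨
    (t (i + 1) = t i - 1 ∧ (y (i + 1) = y i ∨ y (i + 1) = y i - 1))

/-- The turning condition of three-choice walks at the index `i`. -/
def GoodAt (t y : ℤ → ℤ) (i : ℤ) : Prop :=
  (t (i - 1) < t i → t (i + 1) < t i → y (i - 1) = y i - 1 ∧ y (i + 1) = y i) ∧
  (t i < t (i - 1) → t i < t (i + 1) → y (i - 1) = y i + 1 ∧ y (i + 1) = y i)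

/-- `t` increases along `[p, c]`. -/
def UpRun (t : ℤ → ℤ) (p c : ℤ) : Prop := ∀ i, p ≤ i → i ≤ c → t i = t p + (i - p)

/-- `t` decreases along `[p, c]`. -/
def DownRun (t : ℤ → ℤ) (p c : ℤ) : Prop := ∀ i, p ≤ i → i ≤ c → t i = t p - (i - p)

theorem not_dvd_of_lt {M d : ℤ} (h : 0 < d ∧ d < M ∨ 0 < -d ∧ -d < M) : ¬ M ∣ d := by
  rintro hd
  rcases h with ⟨h1, h2⟩ | ⟨h1, h2⟩
  · have := Int.le_of_dvd h1 hd; omega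
  · have := Int.le_of_dvd h1 ((Int.dvd_neg).2 hd); omega

/-- Two functions with increments in `{0, 1}` that never meet keep their order. -/
theorem lt_of_lt_of_ne {f g : ℤ → ℤ} {α β : ℤ}
    (hf : ∀ s, α ≤ s → s < β → f (s + 1) = f s ∨ f (s + 1) = f s + 1)
    (hg : ∀ s, α ≤ s → s < β → g (s + 1) = g s ∨ g (s + 1) = g s + 1)
    (hne : ∀ s, α ≤ s → s ≤ β → f s ≠ g s) {s₀ s₁ : ℤ} (h0 : α ≤ s₀ ∧ s₀ ≤ β)
    (h1 : α ≤ s₁ ∧ s₁ ≤ β) (h : f s₀ < g s₀) : f s₁ < g s₁ := by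
  have hup : ∀ n : ℕ, s₀ + n ≤ β → f (s₀ + n) < g (s₀ + n) := by
    intro n
    induction n with
    | zero => intro _; simpa using h
    | succ n ih =>
      intro hn
      push_cast at hn ⊢
      have a1 := ih (by omega)
      have a2 := hf (s₀ + n) (by omega) (by omega)
      have a3 := hg (s₀ + n) (by omega) (by omega)
      have a4 := hne (s₀ + n + 1) (by omega) (by omega)
      rw [← add_assoc]
      omega
  have hdn : ∀ n : ℕ, α ≤ s₀ - n → f (s₀ - n) < g (s₀ - n) := by
    intro n
    induction n with
    | zero => intro _; simpa using h
    | succ n ih =>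
      intro hn
      push_cast at hn ⊢
      have a1 := ih (by omega)
      have a2 := hf (s₀ - (n + 1)) (by omega) (by omega)
      have a3 := hg (s₀ - (n + 1)) (by omega) (by omega)
      have a4 := hne (s₀ - (n + 1)) (by omega) (by omega)
      rw [show s₀ - ((n : ℤ) + 1) + 1 = s₀ - n by ring] at a2 a3
      omega
  rcases le_total s₀ s₁ with h2 | h2
  · obtain ⟨n, hn⟩ := Int.eq_ofNat_of_zero_le (sub_nonneg.2 h2)
    have := hup n (by omega)
    rwa [show s₀ + (n : ℤ) = s₁ by omega] at this
  · obtain ⟨n, hn⟩ := Int.eq_ofNat_of_zero_le (sub_nonneg.2 h2)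
    have := hdn n (by omega)
    rwa [show s₀ - (n : ℤ) = s₁ by omega] at this

namespace Loop

variable {M : ℤ} {t y : ℤ → ℤ}

theorem rot (L : Loop M t y) : Loop M (fun i => - t i) (fun i => - y i) where
  big := L.big
  per_t i := by rw [L.per_t]
  per_y i := by rw [L.per_y]
  inj i j h1 h2 := L.inj i j (by simpa using h1) (by simpa using h2)
  step i := by
    have := L.step i
    omega

theorem rev (L : Loop M t y) : Loop M (fun i => t (-i)) (fun i => t (-i) - y (-i)) where
  big := L.big
  per_t i := by
    rw [← L.per_t (-(i + M))]; congr 1; ring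
  per_y i := by
    rw [← L.per_t (-(i + M)), ← L.per_y (-(i + M))]
    simp
  inj i j h1 h2 := by
    have := L.inj (-i) (-j) h1 (by omega)
    rw [← Int.dvd_neg] at this
    convert this using 1
    ring
  step i := by
    have := L.step (-(i + 1))
    rw [show -(i + 1) + 1 = -i by ring] at this
    omega

theorem goodAt_rot {i : ℤ} (h : GoodAt t y i) : GoodAt (fun i => - t i) (fun i => - y i) i := by
  unfold GoodAt at *
  beta_reduce
  omega

theorem goodAt_rev (L : Loop M t y) {i : ℤ} (h : GoodAt t y (-i)) :
    GoodAt (fun i => t (-i)) (fun i => t (-i) - y (-i)) i := by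
  have h1 := L.step (-i)
  have h2 := L.step (-i - 1)
  unfold GoodAt at *
  rw [show -i - 1 + 1 = -i by ring] at h2
  beta_reduce
  rw [show -(i - 1) = -i + 1 by ring, show -(i + 1) = -i - 1 by ring]
  omega

/-- Two monotone pieces of a loop do not cross. -/
theorem cross (L : Loop M t y) {f g : ℤ → ℤ} {α β : ℤ}
    (hf : ∀ s, α ≤ s → s ≤ β → t (f s) = s)
    (hf' : ∀ s, f (s + 1) = f s + 1 ∨ f (s + 1) = f s - 1)
    (hg : ∀ s, α ≤ s → s ≤ β → t (g s) = s)
    (hg' : ∀ s, g (s + 1) = g s + 1 ∨ g (s + 1) = g s - 1)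
    (hd : ∀ s, α ≤ s → s ≤ β → 0 < f s - g s ∧ f s - g s < M ∨ 0 < g s - f s ∧ g s - f s < M)
    {s₀ s₁ : ℤ} (h0 : α ≤ s₀ ∧ s₀ ≤ β) (h1 : α ≤ s₁ ∧ s₁ ≤ β) (h : y (f s₀) < y (g s₀)) :
    y (f s₁) < y (g s₁) := by
  have key : ∀ k : ℤ → ℤ, (∀ s, α ≤ s → s ≤ β → t (k s) = s) →
      (∀ s, k (s + 1) = k s + 1 ∨ k (s + 1) = k s - 1) →
      ∀ s, α ≤ s → s < β → y (k (s + 1)) = y (k s) ∨ y (k (s + 1)) = y (k s) + 1 := by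
    intro k hk hk' s hs1 hs2
    have e1 := hk s hs1 hs2.le
    have e2 := hk (s + 1) (by omega) (by omega)
    rcases hk' s with h | h
    · have := L.step (k s)
      rw [← h] at this
      omega
    · have := L.step (k s - 1)
      rw [sub_add_cancel, ← h] at this
      omega
  refine lt_of_lt_of_ne (f := fun s => y (f s)) (g := fun s => y (g s)) (key f hf hf')
    (key g hg hg') ?_ h0 h1 h
  intro s hs1 hs2 he
  refine not_dvd_of_lt ?_ (L.inj _ _ ((hf s hs1 hs2).trans (hg s hs1 hs2).symm) he)
  have := hd s hs1 hs2
  omega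

end Loop

/-- A run, parametrised by time. -/
theorem exists_param_of_run {t : ℤ → ℤ} {p q : ℤ} (h : UpRun t p q ∨ DownRun t p q) :
    ∃ f : ℤ → ℤ, (∀ s, f (s + 1) = f s + 1 ∨ f (s + 1) = f s - 1) ∧
      (∀ i, p ≤ i → i ≤ q → f (t i) = i) ∧
      (∀ i j s, p ≤ i → i ≤ q → p ≤ j → j ≤ q → t i ≤ s → s ≤ t j →
        t (f s) = s ∧ p ≤ f s ∧ f s ≤ q) := by
  rcases h with h | h
  · refine ⟨fun s => p + (s - t p), fun s => by beta_reduce; omega, fun i h1 h2 => ?_,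
      fun i j s h1 h2 h3 h4 h5 h6 => ?_⟩
    · have := h i h1 h2; beta_reduce; omega
    · have a1 := h i h1 h2
      have a2 := h j h3 h4
      have a3 := h (p + (s - t p)) (by omega) (by omega)
      beta_reduce
      omega
  · refine ⟨fun s => p - (s - t p), fun s => by beta_reduce; omega, fun i h1 h2 => ?_,
      fun i j s h1 h2 h3 h4 h5 h6 => ?_⟩
    · have := h i h1 h2; beta_reduce; omega
    · have a1 := h i h1 h2
      have a2 := h j h3 h4
      have a3 := h (p - (s - t p)) (by omega) (by omega)
      beta_reduce
      omega

theorem UpRun.mono {t : ℤ → ℤ} {p q p' q' : ℤ} (h : UpRun t p q) (h1 : p ≤ p') (h2 : q' ≤ q) :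
    UpRun t p' q' := by
  intro i h3 h4
  have a1 := h i (by omega) (by omega)
  have a2 := h p' (by omega) (by omega)
  omega

theorem DownRun.mono {t : ℤ → ℤ} {p q p' q' : ℤ} (h : DownRun t p q) (h1 : p ≤ p')
    (h2 : q' ≤ q) : DownRun t p' q' := by
  intro i h3 h4
  have a1 := h i (by omega) (by omega)
  have a2 := h p' (by omega) (by omega)
  omega

theorem UpRun.neg {t : ℤ → ℤ} {p q : ℤ} (h : UpRun t p q) : DownRun (fun i => - t i) p q := by
  intro i h1 h2
  have := h i h1 h2
  beta_reduce
  omega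

theorem DownRun.neg {t : ℤ → ℤ} {p q : ℤ} (h : DownRun t p q) : UpRun (fun i => - t i) p q := by
  intro i h1 h2
  have := h i h1 h2
  beta_reduce
  omega

theorem UpRun.rev {t : ℤ → ℤ} {p q : ℤ} (h : UpRun t p q) :
    DownRun (fun i => t (-i)) (-q) (-p) := by
  intro i h1 h2
  have a1 := h (-i) (by omega) (by omega)
  beta_reduce
  by_cases hpq : p ≤ q
  · have a2 := h q hpq le_rfl
    rw [neg_neg]
    omega
  · omega

theorem DownRun.rev {t : ℤ → ℤ} {p q : ℤ} (h : DownRun t p q) :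
    UpRun (fun i => t (-i)) (-q) (-p) := by
  intro i h1 h2
  have a1 := h (-i) (by omega) (by omega)
  beta_reduce
  by_cases hpq : p ≤ q
  · have a2 := h q hpq le_rfl
    rw [neg_neg]
    omega
  · omega

namespace Loop

variable {M : ℤ} {t y : ℤ → ℤ}

theorem cross_runs (L : Loop M t y) {p q r w : ℤ} (h1 : UpRun t p q ∨ DownRun t p q)
    (h2 : UpRun t r w ∨ DownRun t r w) (hqr : q < r) (hwp : w - p < M) {i₀ i₁ j₀ j₁ : ℤ}
    (hi₀ : p ≤ i₀ ∧ i₀ ≤ q) (hi₁ : p ≤ i₁ ∧ i₁ ≤ q) (hj₀ : r ≤ j₀ ∧ j₀ ≤ w)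
    (hj₁ : r ≤ j₁ ∧ j₁ ≤ w) (ht₀ : t i₀ = t j₀) (ht₁ : t i₁ = t j₁) :
    (y i₀ < y j₀ → y i₁ < y j₁) ∧ (y j₀ < y i₀ → y j₁ < y i₁) := by
  obtain ⟨f, f1, f2, f3⟩ := exists_param_of_run h1
  obtain ⟨g, g1, g2, g3⟩ := exists_param_of_run h2
  have ef₀ := f2 i₀ hi₀.1 hi₀.2
  have ef₁ := f2 i₁ hi₁.1 hi₁.2
  have eg₀ := g2 j₀ hj₀.1 hj₀.2
  have eg₁ := g2 j₁ hj₁.1 hj₁.2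
  have hF : ∀ s, min (t i₀) (t i₁) ≤ s → s ≤ max (t i₀) (t i₁) →
      (t (f s) = s ∧ p ≤ f s ∧ f s ≤ q) ∧ (t (g s) = s ∧ r ≤ g s ∧ g s ≤ w) := by
    intro s hs1 hs2
    rcases le_total (t i₀) (t i₁) with h | h
    · rw [min_eq_left h] at hs1
      rw [max_eq_right h] at hs2
      exact ⟨f3 i₀ i₁ s hi₀.1 hi₀.2 hi₁.1 hi₁.2 hs1 hs2,
        g3 j₀ j₁ s hj₀.1 hj₀.2 hj₁.1 hj₁.2 (by omega) (by omega)⟩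
    · rw [min_eq_right h] at hs1
      rw [max_eq_left h] at hs2
      exact ⟨f3 i₁ i₀ s hi₁.1 hi₁.2 hi₀.1 hi₀.2 hs1 hs2,
        g3 j₁ j₀ s hj₁.1 hj₁.2 hj₀.1 hj₀.2 (by omega) (by omega)⟩
  have k1 := L.cross (f := f) (g := g) (α := min (t i₀) (t i₁)) (β := max (t i₀) (t i₁))
    (fun s a b => (hF s a b).1.1) f1 (fun s a b => (hF s a b).2.1) g1
    (fun s a b => by have := hF s a b; omega) (s₀ := t i₀) (s₁ := t i₁) (by omega) (by omega)
  have k2 := L.cross (f := g) (g := f) (α := min (t i₀) (t i₁)) (β := max (t i₀) (t i₁))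
    (fun s a b => (hF s a b).2.1) g1 (fun s a b => (hF s a b).1.1) f1
    (fun s a b => by have := hF s a b; omega) (s₀ := t i₀) (s₁ := t i₁) (by omega) (by omega)
  rw [ef₀, ef₁, ht₀, ht₁, eg₀, eg₁] at k1 k2
  exact ⟨k1, k2⟩

/-- A zigzag whose middle leg is the shortest is impossible when both turns are good. -/
theorem not_zigzag (L : Loop M t y) {p c d e : ℤ} (h1 : DownRun t p c) (h2 : UpRun t c d)
    (h3 : DownRun t d e) (hcd : c < d) (hpc : d - c ≤ c - p) (hde : d - c ≤ e - d)
    (hM : e - p < M) (hc : GoodAt t y c) (hd : GoodAt t y d) : False := by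
  have a1 := h1 (c - 1) (by omega) (by omega)
  have a2 := h1 c (by omega) (by omega)
  have a3 := h1 (c - (d - c)) (by omega) (by omega)
  have b1 := h2 (c + 1) (by omega) (by omega)
  have b2 := h2 d (by omega) (by omega)
  have b3 := h2 (d - 1) (by omega) (by omega)
  have c1 := h3 (d + 1) (by omega) (by omega)
  have c2 := h3 (d + (d - c)) (by omega) (by omega)
  have gc := hc.2 (by omega) (by omega)
  have gd := hd.1 (by omega) (by omega)
  have x1 := (L.cross_runs (Or.inr (h1.mono le_rfl (sub_le_self c zero_le_one)))
    (Or.inl (h2.mono (le_add_of_nonneg_right zero_le_one) le_rfl)) (by omega) (by omega)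
    (i₀ := c - 1) (i₁ := c - (d - c)) (j₀ := c + 1) (j₁ := d) (by omega) (by omega) (by omega)
    (by omega) (by omega) (by omega)).2 (by omega)
  have x2 := (L.cross_runs (Or.inl (h2.mono le_rfl (sub_le_self d zero_le_one)))
    (Or.inr (h3.mono (le_add_of_nonneg_right zero_le_one) le_rfl)) (by omega) (by omega)
    (i₀ := d - 1) (i₁ := c) (j₀ := d + 1) (j₁ := d + (d - c)) (by omega) (by omega) (by omega)
    (by omega) (by omega) (by omega)).1 (by omega)
  have x3 := (L.cross_runs (Or.inr h1) (Or.inr h3) (by omega) (by omega)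
    (i₀ := c - (d - c)) (i₁ := c) (j₀ := d) (j₁ := d + (d - c)) (by omega) (by omega) (by omega)
    (by omega) (by omega) (by omega)).2 x1
  omega

/-- Existence of maximal descending runs. -/
theorem exists_downRun (L : Loop M t y) {d E : ℤ} (hdE : d < E) (hd : t (d + 1) = t d - 1) :
    ∃ e, d < e ∧ e ≤ E ∧ DownRun t d e ∧ (e = E ∨ t (e + 1) = t e + 1) := by
  have key : ∀ n : ℕ, d + 1 + n ≤ E → ∃ e, d < e ∧ e ≤ E ∧ DownRun t d e ∧
      (e = d + 1 + n ∨ t (e + 1) = t e + 1) := by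
    intro n
    induction n with
    | zero =>
      intro _
      refine ⟨d + 1, by omega, by omega, ?_, by simp⟩
      intro i h1 h2
      obtain rfl | rfl : i = d ∨ i = d + 1 := by omega
      · ring
      · rw [hd]; ring
    | succ n ih =>
      intro hn
      push_cast at hn ⊢
      obtain ⟨e, h1, h2, h3, h4⟩ := ih (by omega)
      rcases h4 with rfl | h4
      swap
      · exact ⟨e, h1, h2, h3, Or.inr h4⟩
      rcases L.step (d + 1 + n) with h | h
      · exact ⟨_, h1, h2, h3, Or.inr h.1⟩
      · refine ⟨d + 1 + n + 1, by omega, by omega, ?_, Or.inl (by ring)⟩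
        intro i h5 h6
        rcases eq_or_lt_of_le h6 with rfl | h6
        · have := h3 (d + 1 + n) (by omega) le_rfl
          omega
        · exact h3 i h5 (by omega)
  obtain ⟨n, hn⟩ := Int.eq_ofNat_of_zero_le (show 0 ≤ E - d - 1 by omega)
  obtain ⟨e, h1, h2, h3, h4⟩ := key n (by omega)
  exact ⟨e, h1, h2, h3, by omega⟩

theorem exists_upRun (L : Loop M t y) {d E : ℤ} (hdE : d < E) (hd : t (d + 1) = t d + 1) :
    ∃ e, d < e ∧ e ≤ E ∧ UpRun t d e ∧ (e = E ∨ t (e + 1) = t e - 1) := by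
  obtain ⟨e, h1, h2, h3, h4⟩ := L.rot.exists_downRun hdE (by omega)
  refine ⟨e, h1, h2, ?_, by omega⟩
  simpa using h3.neg

/-- A loop entering the corridor between two legs of a good turn stays inside. -/
theorem trap_aux (n : ℕ) : ∀ {t y : ℤ → ℤ} (_ : Loop M t y) {p c d E : ℤ}
    (_ : DownRun t p c) (_ : UpRun t c d) (_ : c < d) (_ : d - c ≤ c - p)
    (_ : GoodAt t y c) (_ : d < E) (_ : E = d + n) (_ : ∀ i, d ≤ i → i < E → GoodAt t y i)
    (_ : t (d + 1) = t d - 1) (_ : E - p < M),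
    ∀ i, d < i → i ≤ E → t c < t i ∧ t i < t d ∧ y (c + (t i - t c)) < y i ∧
      y i < y (c - (t i - t c)) := by
  induction n using Nat.strong_induction_on with
  | _ n ih =>
    intro t y L p c d E h1 h2 hcd hpc hc hdE hn hg hd hM i hi1 hi2
    obtain ⟨e, hde, heE, h3, he⟩ := L.exists_downRun hdE hd
    have hlen : e - d < d - c := by
      by_contra hlen
      exact L.not_zigzag h1 h2 h3 hcd hpc
        (by omega : d - c ≤ e - d) (by omega) hc (hg d le_rfl hdE)
    have a1 := h1 (c - 1) (by omega) (by omega)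
    have a2 := h1 c (by omega) (by omega)
    have a3 := h1 (c - (d - c)) (by omega) (by omega)
    have b1 := h2 (c + 1) (by omega) (by omega)
    have b2 := h2 d (by omega) (by omega)
    have b3 := h2 (d - 1) (by omega) (by omega)
    have c1 := h3 (d + 1) (by omega) (by omega)
    have gc := hc.2 (by omega) (by omega)
    have gd := (hg d le_rfl hdE).1 (by omega) (by omega)
    -- the upper leg lies above the lower leg
    have G21 : ∀ x, 0 < x → x ≤ d - c → y (c + x) < y (c - x) := by
      intro x hx1 hx2
      have a3 := h1 (c - x) (by omega) (by omega)
      have b3 := h2 (c + x) (by omega) (by omega)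
      exact (L.cross_runs (Or.inr (h1.mono le_rfl (sub_le_self c zero_le_one)))
        (Or.inl (h2.mono (le_add_of_nonneg_right zero_le_one) le_rfl)) (by omega) (by omega)
        (i₀ := c - 1) (i₁ := c - x) (j₀ := c + 1) (j₁ := c + x) (by omega) (by omega) (by omega)
        (by omega) (by omega) (by omega)).2 (by omega)
    have G23 : ∀ x, 0 < x → x ≤ e - d → y (d - x) < y (d + x) := by
      intro x hx1 hx2
      have a3 := h2 (d - x) (by omega) (by omega)
      have b3 := h3 (d + x) (by omega) (by omega)
      exact (L.cross_runs (Or.inl (h2.mono le_rfl (sub_le_self d zero_le_one)))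
        (Or.inr (h3.mono (le_add_of_nonneg_right zero_le_one) le_rfl)) (by omega) (by omega)
        (i₀ := d - 1) (i₁ := d - x) (j₀ := d + 1) (j₁ := d + x) (by omega) (by omega) (by omega)
        (by omega) (by omega) (by omega)).1 (by omega)
    have G31 : ∀ x, 0 ≤ x → x ≤ e - d → y (d + x) < y (c - (d - c) + x) := by
      intro x hx1 hx2
      have a3 := h1 (c - (d - c) + x) (by omega) (by omega)
      have b3 := h3 (d + x) (by omega) (by omega)
      have := G21 (d - c) (by omega) le_rfl
      rw [add_sub_cancel] at this
      exact (L.cross_runs (Or.inr h1) (Or.inr h3) (by omega) (by omega)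
        (i₀ := c - (d - c)) (i₁ := c - (d - c) + x) (j₀ := d) (j₁ := d + x) (by omega) (by omega)
        (by omega) (by omega) (by omega) (by omega)).2 this
    rcases le_or_gt i e with hie | hie
    · have c2 := h3 i (by omega) hie
      have k1 := G23 (i - d) (by omega) (by omega)
      have k2 := G31 (i - d) (by omega) (by omega)
      rw [show c + (t i - t c) = d - (i - d) by omega,
        show c - (t i - t c) = c - (d - c) + (i - d) by omega]
      rw [add_sub_cancel] at k1 k2
      exact ⟨by omega, by omega, k1, k2⟩
    · have he' : t (e + 1) = t e + 1 := by omega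
      have he2 := h3 e (by omega) le_rfl
      have := ih (E - e).toNat (by omega) L.rot h2.neg h3.neg hde (by omega)
        (goodAt_rot (hg d le_rfl hdE)) (by omega) (by omega)
        (fun j hj1 hj2 => goodAt_rot (hg j (by omega) hj2)) (by omega) (by omega)
        i (by omega) hi2
      beta_reduce at this
      obtain ⟨k1, k2, k3, k4⟩ := this
      have k5 := G31 (t d - t i) (by omega) (by omega)
      rw [show d + (-t i - -t d) = d + (t d - t i) by omega] at k3
      rw [show d - (-t i - -t d) = c + (t i - t c) by omega] at k4
      rw [show c - (d - c) + (t d - t i) = c - (t i - t c) by omega] at k5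
      exact ⟨by omega, by omega, by omega, by omega⟩

theorem trap (L : Loop M t y) {p c d E : ℤ} (h1 : DownRun t p c) (h2 : UpRun t c d) (hcd : c < d)
    (hpc : d - c ≤ c - p) (hc : GoodAt t y c) (hdE : d < E)
    (hg : ∀ i, d ≤ i → i < E → GoodAt t y i) (hd : t (d + 1) = t d - 1) (hM : E - p < M) :
    ∀ i, d < i → i ≤ E → t c < t i ∧ t i < t d ∧ y (c + (t i - t c)) < y i ∧
      y i < y (c - (t i - t c)) :=
  trap_aux (E - d).toNat L h1 h2 hcd hpc hc hdE (by omega) hg hd hM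

/-- An arc from a minimum to a maximum of `t` without bad turns is monotone. -/
theorem upRun_of_good (L : Loop M t y) {b a : ℤ} (hba : b < a) (hM : a - b < M)
    (hmin : ∀ i, b ≤ i → i ≤ a → t b ≤ t i) (hmax : ∀ i, b ≤ i → i ≤ a → t i ≤ t a)
    (hg : ∀ i, b < i → i < a → GoodAt t y i) : UpRun t b a := by
  have hb : t (b + 1) = t b + 1 := by
    have := hmin (b + 1) (by omega) (by omega)
    have := L.step b
    omega
  obtain ⟨c, hbc, hca, h1, hc⟩ := L.exists_upRun hba hb
  rcases eq_or_lt_of_le hca with rfl | hca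
  · exact h1
  exfalso
  obtain ⟨d, hcd, hda, h2, hd⟩ := L.exists_downRun hca (by omega)
  have e1 := h1 c (by omega) le_rfl
  have e2 := h2 d (by omega) le_rfl
  have := hmax c (by omega) (by omega)
  rcases eq_or_lt_of_le hda with rfl | hda
  · omega
  have := hmin d (by omega) (by omega)
  have := L.rot.trap h1.neg h2.neg hcd (by omega) (goodAt_rot (hg c hbc hca)) hda
    (fun i hi1 hi2 => goodAt_rot (hg i (by omega) hi2)) (by omega) hM a hda le_rfl
  beta_reduce at this
  omega

theorem downRun_of_good (L : Loop M t y) {a b : ℤ} (hab : a < b) (hM : b - a < M)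
    (hmin : ∀ i, a ≤ i → i ≤ b → t b ≤ t i) (hmax : ∀ i, a ≤ i → i ≤ b → t i ≤ t a)
    (hg : ∀ i, a < i → i < b → GoodAt t y i) : DownRun t a b := by
  have := L.rot.upRun_of_good hab hM (fun i h1 h2 => neg_le_neg (hmax i h1 h2))
    (fun i h1 h2 => neg_le_neg (hmin i h1 h2)) (fun i h1 h2 => goodAt_rot (hg i h1 h2))
  simpa using this.neg

end Loop

/-- An exceptional turn (east step followed by a south step) at the index `0`. -/
def ExcAt (t y : ℤ → ℤ) : Prop :=
  t (-1) = t 0 - 1 ∧ t 1 = t 0 - 1 ∧ y (-1) = y 0 ∧ y 1 = y 0 - 1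

/-- The loop consists of four runs. -/
def FourRuns (M : ℤ) (t : ℤ → ℤ) (A T B : ℤ) : Prop :=
  0 < A ∧ A < T ∧ T < B ∧ B < M ∧ DownRun t 0 A ∧ UpRun t A T ∧ DownRun t T B ∧ UpRun t B M ∧
    t 0 < t T

namespace Loop

variable {M : ℤ} {t y : ℤ → ℤ}

theorem exists_max (L : Loop M t y) : ∃ a, 0 ≤ a ∧ a < M ∧ ∀ i, t i ≤ t a := by
  have hM := L.big
  obtain ⟨a, ha, h⟩ := Finset.exists_max_image (Finset.Ico 0 M) t
    ⟨0, Finset.mem_Ico.2 ⟨le_rfl, by omega⟩⟩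
  rw [Finset.mem_Ico] at ha
  refine ⟨a, ha.1, ha.2, fun i => ?_⟩
  have h1 : t (i % M) = t i := by
    have := (Function.Periodic.int_mul (f := t) (c := M) L.per_t (i / M)) (i % M)
    rw [← this]
    congr 1
    rw [mul_comm]
    exact Int.emod_add_mul_ediv i M
  rw [← h1]
  exact h _ (Finset.mem_Ico.2 ⟨Int.emod_nonneg _ (by omega), Int.emod_lt_of_pos _ (by omega)⟩)

theorem exists_min (L : Loop M t y) : ∃ b, 0 ≤ b ∧ b < M ∧ ∀ i, t b ≤ t i := by
  obtain ⟨b, h1, h2, h3⟩ := L.rot.exists_max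
  exact ⟨b, h1, h2, fun i => by have := h3 i; omega⟩

theorem not_max_of_excAt (L : Loop M t y) (hE : ExcAt t y)
    (hg : ∀ i, 0 < i → i < M → GoodAt t y i) : ∃ i, t 0 < t i := by
  by_contra! hmax
  have hM := L.big
  obtain ⟨e1, e2, e3, e4⟩ := hE
  obtain ⟨b, hb0, hbM, hmin⟩ := L.exists_min
  have h0M : t M = t 0 := by simpa using L.per_t 0
  have hM1 : t (M - 1) = t (-1) := by rw [← L.per_t (-1)]; congr 1; ring
  have hyM1 : y (M - 1) = y (-1) := by rw [← L.per_y (-1)]; congr 1; ring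
  have hb : 0 < b := by
    rcases eq_or_lt_of_le hb0 with rfl | h
    · have := hmin 1; omega
    · exact h
  have D := L.downRun_of_good hb (by omega) (fun i _ _ => hmin i) (fun i _ _ => hmax i)
    (fun i h1 h2 => hg i h1 (by omega))
  have U := L.upRun_of_good hbM (by omega) (fun i _ _ => hmin i) (fun i _ _ => h0M ▸ hmax i)
    (fun i h1 h2 => hg i (by omega) h2)
  have d1 := D b (by omega) le_rfl
  have u1 := U M (by omega) le_rfl
  have d2 := D (b - 1) (by omega) (by omega)
  have u2 := U (b + 1) (by omega) (by omega)
  have u3 := U (M - 1) (by omega) (by omega)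
  have gb := (hg b hb hbM).2 (by omega) (by omega)
  have := (L.cross_runs (Or.inr (D.mono zero_le_one (sub_le_self b zero_le_one)))
    (Or.inl (U.mono (le_add_of_nonneg_right zero_le_one) (sub_le_self M zero_le_one)))
    (by omega) (by omega) (i₀ := b - 1) (i₁ := 1) (j₀ := b + 1) (j₁ := M - 1) (by omega) (by omega)
    (by omega) (by omega) (by omega) (by omega)).2 (by omega)
  omega

set_option maxHeartbeats 1000000 in
theorem fourRuns_aux (L : Loop M t y) (hE : ExcAt t y)
    (hg : ∀ i, 0 < i → i < M → GoodAt t y i) {a b : ℤ} (hb : 0 < b) (hba : b < a) (ha : a < M)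
    (hmax : ∀ i, t i ≤ t a) (hmin : ∀ i, t b ≤ t i) (h0 : t 0 < t a) :
    ∃ A T B, FourRuns M t A T B := by
  have hM := L.big
  obtain ⟨e1, e2, e3, e4⟩ := hE
  have h0M : t M = t 0 := by simpa using L.per_t 0
  have hy0M : y M = y 0 := by simpa using L.per_y 0
  have hM1 : t (M - 1) = t (-1) := by rw [← L.per_t (-1)]; congr 1; ring
  have U := L.upRun_of_good hba (by omega) (fun i _ _ => hmin i) (fun i _ _ => hmax i)
    (fun i h1 h2 => hg i (by omega) (by omega))
  have hda : t (a + 1) = t a - 1 := by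
    have := hmax (a + 1)
    have := L.step a
    omega
  obtain ⟨c, hac, hcM, G1, hc⟩ := L.exists_downRun ha hda
  have hc' : c < M := by
    rcases eq_or_lt_of_le hcM with h | h
    · have g1 := G1 (c - 1) (by omega) (by omega)
      have g2 := G1 c (by omega) (by omega)
      rw [h] at g1 g2
      omega
    · exact h
  have hc1 : t (c + 1) = t c + 1 := by omega
  obtain ⟨d, hcd, hdM, G2, hd⟩ := L.exists_upRun hc' hc1
  have gc := (hg c (by omega) hc').2
  have q1 := G1 (c - 1) (by omega) (by omega)
  have q2 := G2 (c + 1) (by omega) (by omega)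
  have q3 := G1 c (by omega) le_rfl
  have gc := gc (by omega) (by omega)
  have q4 := G2 d (by omega) le_rfl
  have q5 := hmax d
  -- the end point lies in the corridor
  have key : t c < t 0 ∧ t 0 ≤ t d ∧ (t 0 = t d → d = M) ∧ y (c + (t 0 - t c)) ≤ y 0 ∧
      y 0 < y (c - (t 0 - t c)) ∧ (d < M → y (c + (t 0 - t c)) < y 0) := by
    rcases eq_or_lt_of_le hdM with rfl | hdM
    · have q6 := G1 (c - (d - c)) (by omega) (by omega)
      have := (L.cross_runs (Or.inr (G1.mono le_rfl (sub_le_self c zero_le_one)))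
        (Or.inl (G2.mono (le_add_of_nonneg_right zero_le_one) le_rfl)) (by omega) (by omega)
        (i₀ := c - 1) (i₁ := c - (d - c)) (j₀ := c + 1) (j₁ := d) (by omega) (by omega) (by omega)
        (by omega) (by omega) (by omega)).2 (by omega)
      rw [show c + (t 0 - t c) = d by omega, show c - (t 0 - t c) = c - (d - c) by omega]
      omega
    · have := L.trap G1 G2 hcd (by omega) (hg c (by omega) hc') hdM
        (fun i h1 h2 => hg i (by omega) h2) (by omega) (by omega) M hdM le_rfl
      rw [h0M, hy0M] at this
      omega
  obtain ⟨k1, k2, k3, k4, k5, k6⟩ := key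
  have u1 := U a hba.le le_rfl
  -- the maximal descending run ending at `b`
  have hb1 : t (b - 1) = t b + 1 := by
    have := hmin (b - 1)
    have := L.step (b - 1)
    rw [sub_add_cancel] at this
    omega
  have Lr := L.rev
  obtain ⟨e', he1, he2, K1', he3⟩ := Lr.exists_upRun (d := -b) (E := 0) (by omega)
    (by rw [neg_neg, show -(-b + 1) = b - 1 by ring]; exact hb1)
  obtain ⟨e, rfl⟩ : ∃ e, e' = -e := ⟨-e', by ring⟩
  have K1 : DownRun t e b := by simpa using K1'.rev
  have m1 := K1 b (by omega) le_rfl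
  have m2 := hmin c
  have m3 := hmax e
  have s1 := G1 (c - (t 0 - t c)) (by omega) (by omega)
  have s2 := G2 (c + (t 0 - t c)) (by omega) (by omega)
  have s3 := K1 (b - (t c - t b))
  have s4 := K1 (b - (t 0 - t b))
  rcases eq_or_lt_of_le he2 with he0 | he0
  · obtain rfl : e = 0 := by omega
    have s3 := s3 (by omega) (by omega)
    have hdM' : d = M := by
      by_contra hne
      have hlt : d < M := by omega
      have k6 := k6 hlt
      have x1 := (L.cross_runs (Or.inr K1) (Or.inr G1) (by omega) (by omega)
        (i₀ := 0) (i₁ := b - (t c - t b)) (j₀ := c - (t 0 - t c)) (j₁ := c) (by omega) (by omega)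
        (by omega) (by omega) (by omega) (by omega)).1 (by omega)
      have x2 := (L.cross_runs (Or.inr K1) (Or.inl G2) (by omega) (by omega)
        (i₀ := 0) (i₁ := b - (t c - t b)) (j₀ := c + (t 0 - t c)) (j₁ := c) (by omega) (by omega)
        (by omega) (by omega) (by omega) (by omega)).2 (by omega)
      omega
    subst hdM'
    exact ⟨b, a, c, hb, hba, hac, hc', K1, U, G1, G2, h0⟩
  · exfalso
    have he1' : t (e - 1) = t e - 1 := by
      have := he3.resolve_left (by omega)
      beta_reduce at this
      rw [neg_neg, show -(-e + 1) = e - 1 by ring] at this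
      exact this
    obtain ⟨f', hf1, hf2, K2', hf3⟩ := Lr.exists_downRun (d := -e) (E := 0) he0
      (by rw [neg_neg, show -(-e + 1) = e - 1 by ring]; exact he1')
    obtain ⟨f, rfl⟩ : ∃ f, f' = -f := ⟨-f', by ring⟩
    have K2 : UpRun t f e := by simpa using K2'.rev
    have n1 := K2 e (by omega) le_rfl
    have n2 := hmin f
    have hf0 : 0 < f := by
      rcases eq_or_lt_of_le hf2 with h | h
      · obtain rfl : f = 0 := by omega
        have := K2 1 (by omega) (by omega)
        omega
      · omega
    have hf3' : t (f - 1) = t f + 1 := by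
      have := hf3.resolve_left (by omega)
      beta_reduce at this
      rw [neg_neg, show -(-f + 1) = f - 1 by ring] at this
      exact this
    have hgr : ∀ i, 0 < -i → -i < M →
        GoodAt (fun i => - t (-i)) (fun i => -(t (-i) - y (-i))) i :=
      fun i h1 h2 => goodAt_rot (L.goodAt_rev (hg (-i) h1 h2))
    have tr := Lr.rot.trap (p := -b) (c := -e) (d := -f) (E := 0) K1'.neg K2'.neg hf1 (by omega)
      (hgr _ (by omega) (by omega)) (by omega) (fun i h1 h2 => hgr i (by omega) (by omega))
      (by rw [neg_neg, show -(-f + 1) = f - 1 by ring]; omega) (by omega) 0 (by omega) le_rfl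
    beta_reduce at tr
    rw [neg_neg, neg_neg, neg_zero] at tr
    obtain ⟨r1, r2, r3, r4⟩ := tr
    have r5 := K2 (e - (t e - t 0)) (by omega) (by omega)
    have r6 := K1 (e + (t e - t 0)) (by omega) (by omega)
    rw [show -(-e + (-t 0 - -t e)) = e - (t e - t 0) by ring] at r3
    rw [show -(-e - (-t 0 - -t e)) = e + (t e - t 0) by ring] at r4
    have r7 : y (e - (t e - t 0)) < y 0 := by omega
    have r8 : y 0 < y (e + (t e - t 0)) := by omega
    have r9 := K1 (e + (t e - t c)) (by omega) (by omega)
    have r10 := G1 (a + (t a - t e)) (by omega) (by omega)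
    have x1 := L.cross_runs (Or.inr K1) (Or.inr G1) (by omega) (by omega)
      (i₀ := e + (t e - t 0)) (j₀ := c - (t 0 - t c)) (i₁ := e) (j₁ := a + (t a - t e))
      (by omega) (by omega) (by omega) (by omega) (by omega) (by omega)
    have x2 := L.cross_runs (Or.inr K1) (Or.inr G1) (by omega) (by omega)
      (i₀ := e + (t e - t 0)) (j₀ := c - (t 0 - t c)) (i₁ := e + (t e - t c)) (j₁ := c)
      (by omega) (by omega) (by omega) (by omega) (by omega) (by omega)
    have x3 := L.cross_runs (Or.inl K2) (Or.inr G1) (by omega) (by omega)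
      (i₀ := e) (j₀ := a + (t a - t e)) (i₁ := e - (t e - t 0)) (j₁ := c - (t 0 - t c))
      (by omega) (by omega) (by omega) (by omega) (by omega) (by omega)
    have x4 := L.cross_runs (Or.inr K1) (Or.inl G2) (by omega) (by omega)
      (i₀ := e + (t e - t c)) (j₀ := c) (i₁ := e + (t e - t 0)) (j₁ := c + (t 0 - t c))
      (by omega) (by omega) (by omega) (by omega) (by omega) (by omega)
    have hne : y (e + (t e - t 0)) ≠ y (c - (t 0 - t c)) := by
      intro h
      refine not_dvd_of_lt ?_ (L.inj _ _ (r6.trans ?_) h)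
      · omega
      · omega
    omega

/-- A loop whose only bad turn is an exceptional turn at `0` consists of four runs. -/
theorem exists_fourRuns (L : Loop M t y) (hE : ExcAt t y)
    (hg : ∀ i, 0 < i → i < M → GoodAt t y i) : ∃ A T B, FourRuns M t A T B := by
  obtain ⟨i, hi⟩ := L.not_max_of_excAt hE hg
  obtain ⟨a, ha0, haM, hmax⟩ := L.exists_max
  obtain ⟨b, hb0, hbM, hmin⟩ := L.exists_min
  have hE' := hE
  obtain ⟨e1, e2, e3, e4⟩ := hE'
  have h0a := hmax i
  have ha : 0 < a := by
    rcases eq_or_lt_of_le ha0 with rfl | h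
    · omega
    · exact h
  have hb : 0 < b := by
    rcases eq_or_lt_of_le hb0 with rfl | h
    · have := hmin 1; omega
    · exact h
  rcases lt_trichotomy b a with hab | rfl | hab
  · exact L.fourRuns_aux hE hg hb hab haM hmax hmin (by omega)
  · have := hmin 0
    omega
  · have hper : ∀ i, t (-(M - i)) = t i := by
      intro i
      rw [← L.per_t (-(M - i))]; congr 1; ring
    have hgM : ∀ i, 0 < i → i < M → GoodAt t y (-i) := by
      intro i h1 h2
      have := hg (M - i) (by omega) (by omega)
      have p1 := L.per_t (-i)
      have p2 := L.per_t (-i - 1)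
      have p3 := L.per_t (-i + 1)
      have p4 := L.per_y (-i)
      have p5 := L.per_y (-i - 1)
      have p6 := L.per_y (-i + 1)
      rw [show -i - 1 + M = M - i - 1 by ring] at p2 p5
      rw [show -i + 1 + M = M - i + 1 by ring] at p3 p6
      rw [show -i + M = M - i by ring] at p1 p4
      unfold GoodAt at this ⊢
      rw [p1, p2, p3, p4, p5, p6] at this
      exact this
    obtain ⟨A, T, B, h1, h2, h3, h4, h5, h6, h7, h8, h9⟩ := L.rev.fourRuns_aux
      (by unfold ExcAt; beta_reduce; rw [neg_neg, neg_zero]; omega)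
      (fun i h1 h2 => L.goodAt_rev (hgM i h1 h2)) (a := M - a) (b := M - b) (by omega) (by omega)
      (by omega) (fun i => by rw [hper]; exact hmax _)
      (fun i => by rw [hper]; exact hmin _)
      (by rw [hper, neg_zero]; omega)
    have sh : ∀ i, t (i - M) = t i := fun i => by rw [← L.per_t (i - M), sub_add_cancel]
    refine ⟨M - B, M - T, M - A, by omega, by omega, by omega, by omega, ?_, ?_, ?_, ?_, ?_⟩
    · have := h8.rev
      simp only [neg_neg] at this
      intro i k1 k2
      have := this (i - M) (by omega) (by omega)
      beta_reduce at this
      rw [sh, show -M = 0 - M by ring, sh] at this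
      omega
    · have := h7.rev
      simp only [neg_neg] at this
      intro i k1 k2
      have := this (i - M) (by omega) (by omega)
      beta_reduce at this
      rw [sh, show -B = M - B - M by ring, sh] at this
      omega
    · have := h6.rev
      simp only [neg_neg] at this
      intro i k1 k2
      have := this (i - M) (by omega) (by omega)
      beta_reduce at this
      rw [sh, show -T = M - T - M by ring, sh] at this
      omega
    · have := h5.rev
      simp only [neg_neg] at this
      intro i k1 k2
      have := this (i - M) (by omega) (by omega)
      beta_reduce at this
      rw [sh, show -A = M - A - M by ring, sh] at this
      omega
    · beta_reduce at h9
      rw [neg_zero, show -T = M - T - M by ring, sh] at h9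
      exact h9

end Loop

namespace Loop

variable {M : ℤ} {t y : ℤ → ℤ}

/-- A loop without bad turns consists of two runs. -/
theorem exists_twoRuns (L : Loop M t y) (hg : ∀ i, GoodAt t y i) :
    ∃ b a, b < a ∧ a < b + M ∧ UpRun t b a ∧ DownRun t a (b + M) := by
  obtain ⟨a, ha0, haM, hmax⟩ := L.exists_max
  obtain ⟨b, hb0, hbM, hmin⟩ := L.exists_min
  have hba : b ≠ a := by
    rintro rfl
    have := hmax (b + 1)
    have := hmin (b + 1)
    have := L.step b
    omega
  obtain ⟨c, h1, h2, hmax⟩ : ∃ c, b < c ∧ c < b + M ∧ ∀ i, t i ≤ t c := by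
    rcases lt_or_gt_of_ne hba with h | h
    · exact ⟨a, h, by omega, hmax⟩
    · exact ⟨a + M, by omega, by omega, fun i => by rw [L.per_t]; exact hmax i⟩
  refine ⟨b, c, h1, h2, ?_, ?_⟩
  · exact L.upRun_of_good h1 (by omega) (fun i _ _ => hmin i) (fun i _ _ => hmax i)
      (fun i _ _ => hg i)
  · exact L.downRun_of_good h2 (by omega) (fun i _ _ => by rw [L.per_t]; exact hmin i)
      (fun i _ _ => hmax i) (fun i _ _ => hg i)

end Loop

/-- Two periodic injective sequences with the same edges agree up to a shift or a reversal. -/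
theorem exists_shift_of_edges {α : Type*} {P P' : ℤ → α} {M : ℤ} (hM : 2 < M)
    (per : ∀ i, P (i + M) = P i) (inj : ∀ i j, P i = P j → M ∣ i - j)
    (per' : ∀ i, P' (i + M) = P' i) (inj' : ∀ i j, P' i = P' j → M ∣ i - j)
    (h : ∀ i, ∃ k, s(P' i, P' (i + 1)) = s(P k, P (k + 1))) :
    ∃ j, (∀ i, P' i = P (j + i)) ∨ ∀ i, P' i = P (j - i) := by
  have hP : ∀ {i j}, P i = P j → ∀ c, P (i + c) = P (j + c) := by
    intro i j hij c
    obtain ⟨k, hk⟩ := inj i j hij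
    have := (Function.Periodic.int_mul (f := P) (c := M) per k) (j + c)
    rw [← this]
    congr 1
    rw [Int.cast_id]
    linarith
  have h2 : ∀ i, P' (i + 2) ≠ P' i := by
    intro i hi
    have := inj' _ _ hi
    rw [show i + 2 - i = 2 by ring] at this
    exact not_dvd_of_lt (Or.inl ⟨two_pos, hM⟩) this
  have ext : ∀ Q : ℤ → α, (∀ i, Q (i + M) = Q i) → (∀ n : ℕ, P' n = Q n) → ∀ i, P' i = Q i := by
    intro Q hQ hn i
    have e1 := (Function.Periodic.int_mul (f := P') (c := M) per' (|i|)) i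
    have e2 := (Function.Periodic.int_mul (f := Q) (c := M) hQ (|i|)) i
    have h0 : 0 ≤ i + ((|i| : ℤ) : ℤ) * M := by
      have := neg_abs_le i
      have := abs_nonneg i
      nlinarith
    rw [← e1, ← e2]
    obtain ⟨n, hn'⟩ := Int.eq_ofNat_of_zero_le h0
    have := hn n
    rw [← hn'] at this
    exact this
  obtain ⟨j, hj⟩ := h 0
  rw [Sym2.eq_iff] at hj
  rcases hj with ⟨ha, hb⟩ | ⟨ha, hb⟩
  · refine ⟨j, Or.inl (ext _ (fun i => by rw [← add_assoc, per]) ?_)⟩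
    have key : ∀ n : ℕ, P' n = P (j + n) ∧ P' (n + 1) = P (j + n + 1) := by
      intro n
      induction n with
      | zero => simpa using ⟨ha, hb⟩
      | succ n ih =>
        push_cast
        refine ⟨by rw [ih.2, add_assoc], ?_⟩
        obtain ⟨k, hk⟩ := h (n + 1)
        rw [Sym2.eq_iff] at hk
        rcases hk with ⟨h3, h4⟩ | ⟨h3, h4⟩
        · rw [h4, hP (h3.symm.trans ih.2) 1, ← add_assoc]
        · refine absurd ?_ (h2 n)
          have := hP (h3.symm.trans ih.2) (-1)
          rw [add_neg_cancel_right, add_neg_cancel_right] at this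
          rw [ih.1, ← this, ← h4, add_assoc, one_add_one_eq_two]
    exact fun n => (key n).1
  · refine ⟨j + 1, Or.inr (ext _ (fun i => ?_) ?_)⟩
    · rw [← per, sub_add, add_sub_cancel_right]
    have key : ∀ n : ℕ, P' n = P (j + 1 - n) ∧ P' (n + 1) = P (j + 1 - n - 1) := by
      intro n
      induction n with
      | zero => simpa using ⟨ha, hb⟩
      | succ n ih =>
        push_cast
        refine ⟨by rw [ih.2, sub_sub], ?_⟩
        obtain ⟨k, hk⟩ := h (n + 1)
        rw [Sym2.eq_iff] at hk
        rcases hk with ⟨h3, h4⟩ | ⟨h3, h4⟩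
        · refine absurd ?_ (h2 n)
          have := hP (h3.symm.trans ih.2) 1
          rw [sub_add_cancel] at this
          rw [ih.1, ← this, ← h4, add_assoc, one_add_one_eq_two]
        · have := hP (h3.symm.trans ih.2) (-1)
          rw [add_neg_cancel_right] at this
          rw [h4, this]
          congr 1
          ring
    exact fun n => (key n).1

/-- A loop through the origin whose only bad turn is at the index `0`. -/
structure Imperfect (M : ℤ) (t y : ℤ → ℤ) : Prop extends Loop M t y where
  t_zero : t 0 = 0
  y_zero : y 0 = 0
  good : ∀ i, 0 < i → i < M → GoodAt t y i
  bad : ¬ GoodAt t y 0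

namespace Loop

variable {M : ℤ} {t y : ℤ → ℤ}

theorem t_add_mul (L : Loop M t y) (i k : ℤ) : t (i + k * M) = t i :=
  (Function.Periodic.int_mul (f := t) (c := M) L.per_t k) i

theorem y_add_mul (L : Loop M t y) (i k : ℤ) : y (i + k * M) = y i :=
  (Function.Periodic.int_mul (f := y) (c := M) L.per_y k) i

theorem goodAt_add_mul (L : Loop M t y) (i k : ℤ) : GoodAt t y (i + k * M) ↔ GoodAt t y i := by
  unfold GoodAt
  rw [show i + k * M - 1 = i - 1 + k * M by ring, show i + k * M + 1 = i + 1 + k * M by ring]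
  simp only [L.t_add_mul, L.y_add_mul]

theorem goodAt_zero_iff (L : Loop M t y) :
    GoodAt t y 0 ↔ ¬ (ExcAt t y ∨ ExcAt (fun i => - t i) (fun i => - y i)) := by
  have h1 := L.step 0
  have h2 := L.step (-1)
  have h3 : ¬ (t (-1) = t 1 ∧ y (-1) = y 1) := by
    rintro ⟨h, h'⟩
    refine not_dvd_of_lt (Or.inr ⟨?_, ?_⟩) (L.inj _ _ h h')
    · norm_num
    · have := L.big
      omega
  unfold GoodAt ExcAt
  rw [neg_add_cancel] at h2
  rw [zero_add] at h1 ⊢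
  rw [zero_sub]
  beta_reduce
  omega

end Loop

namespace Imperfect

variable {M : ℤ} {t y : ℤ → ℤ}

theorem rot (h : Imperfect M t y) : Imperfect M (fun i => - t i) (fun i => - y i) where
  toLoop := h.toLoop.rot
  t_zero := by rw [h.t_zero, neg_zero]
  y_zero := by rw [h.y_zero, neg_zero]
  good i h1 h2 := Loop.goodAt_rot (h.good i h1 h2)
  bad h' := h.bad (by simpa using Loop.goodAt_rot h')

theorem excAt (h : Imperfect M t y) :
    ExcAt t y ∨ ExcAt (fun i => - t i) (fun i => - y i) := by
  by_contra h'
  exact h.bad (h.toLoop.goodAt_zero_iff.2 h')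

theorem dvd_of_bad (h : Imperfect M t y) {i : ℤ} (hi : ¬ GoodAt t y i) : M ∣ i := by
  by_contra hd
  have hM := h.big
  apply hi
  have h1 := Int.emod_add_mul_ediv i M
  rw [← h1, mul_comm, h.toLoop.goodAt_add_mul]
  refine h.good _ ?_ (Int.emod_lt_of_pos _ (by omega))
  exact lt_of_le_of_ne (Int.emod_nonneg _ (by omega))
    fun h0 => hd (Int.dvd_of_emod_eq_zero h0.symm)

theorem exists_two_turns (h : Imperfect M t y) (hE : ExcAt t y) : ∃ A B, 0 < A ∧ A < B ∧ B < M ∧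
    (t (A - 1) = t A + 1 ∧ t (A + 1) = t A + 1) ∧ t (B - 1) = t B + 1 ∧ t (B + 1) = t B + 1 := by
  obtain ⟨A, T, B, h1, h2, h3, h4, h5, h6, h7, h8, h9⟩ := h.toLoop.exists_fourRuns hE h.good
  have a1 := h5 A (by omega) le_rfl
  have a2 := h5 (A - 1) (by omega) (by omega)
  have a3 := h6 (A + 1) (by omega) (by omega)
  have b1 := h7 B (by omega) le_rfl
  have b2 := h7 (B - 1) (by omega) (by omega)
  have b3 := h8 (B + 1) (by omega) (by omega)
  exact ⟨A, B, h1, by omega, h4, by omega, by omega⟩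

/-- An imperfect loop traversed backwards is not imperfect. -/
theorem not_reverse {t' y' : ℤ → ℤ} {j u v : ℤ} (h : Imperfect M t y) (h' : Imperfect M t' y')
    (ht : ∀ i, t' i = t (j - i) + u) (hy : ∀ i, y' i = y (j - i) + v) : False := by
  wlog hE : ExcAt t y generalizing t y t' y' u v
  · refine this (u := -u) (v := -v) h.rot h'.rot (fun i => ?_) (fun i => ?_)
      (h.excAt.resolve_left hE)
    · rw [ht]; ring
    · rw [hy]; ring
  obtain ⟨A, B, h1, h2, h3, h4, h5⟩ := h.exists_two_turns hE
  have key : ∀ C, 0 < C → C < M → t (C - 1) = t C + 1 ∧ t (C + 1) = t C + 1 → M ∣ j - C := by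
    intro C c1 c2 c3
    refine h'.dvd_of_bad fun hg => ?_
    have g := (h.good C c1 c2).2
    have g' := hg.2
    rw [ht, ht, ht, hy, hy, hy, show j - (j - C) = C by ring,
      show j - (j - C - 1) = C + 1 by ring, show j - (j - C + 1) = C - 1 by ring] at g'
    omega
  have := dvd_sub (key A h1 (by omega) h4) (key B (by omega) h3 h5)
  rw [show j - A - (j - B) = B - A by ring] at this
  exact not_dvd_of_lt (by omega) this

/-- An imperfect loop is determined by its edges up to translation. -/
theorem eq_of_shift {t' y' : ℤ → ℤ} {j u v : ℤ} (h : Imperfect M t y) (h' : Imperfect M t' y')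
    (ht : ∀ i, t' i = t (j + i) + u) (hy : ∀ i, y' i = y (j + i) + v) : t' = t ∧ y' = y := by
  have hj : M ∣ j := by
    refine h.dvd_of_bad fun hg => h'.bad ?_
    unfold GoodAt at hg ⊢
    simp only [ht, hy]
    rw [zero_sub, zero_add, add_zero, ← sub_eq_add_neg]
    omega
  obtain ⟨k, rfl⟩ := hj
  have e1 : ∀ i, t (M * k + i) = t i := fun i => by
    rw [add_comm, mul_comm, h.toLoop.t_add_mul]
  have e2 : ∀ i, y (M * k + i) = y i := fun i => by
    rw [add_comm, mul_comm, h.toLoop.y_add_mul]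
  simp only [e1] at ht
  simp only [e2] at hy
  have z1 := ht 0
  have z2 := hy 0
  rw [h.t_zero, h'.t_zero] at z1
  rw [h.y_zero, h'.y_zero] at z2
  constructor <;> funext i
  · rw [ht]; omega
  · rw [hy]; omega

end Imperfect

/-- The lattice point with coordinates `t = abscissa + ordinate` and `y = ordinate`. -/
def loopPt (t y : ℤ → ℤ) (i : ℤ) : ℤ × ℤ := (t i - y i, y i)

/-- The edge set of a loop. -/
def loopEdges (t y : ℤ → ℤ) : Set (Sym2 (ℤ × ℤ)) :=
  {e | ∃ i, e = s(loopPt t y i, loopPt t y (i + 1))}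

theorem loopPt_inj {t y t' y' : ℤ → ℤ} {i j : ℤ} :
    loopPt t y i = loopPt t' y' j ↔ t i = t' j ∧ y i = y' j := by
  unfold loopPt
  rw [Prod.mk.injEq]
  omega

/-- The translation class of the edge set of a loop. -/
def loopClass (p : (ℤ → ℤ) × (ℤ → ℤ)) : Set (Set (Sym2 (ℤ × ℤ))) :=
  {F | TransEquiv (loopEdges p.1 p.2) F}

theorem mem_translateEdges {v : ℤ × ℤ} {E : Set (Sym2 (ℤ × ℤ))} {a b : ℤ × ℤ} :
    s(a, b) ∈ translateEdges v E ↔ s(a - v, b - v) ∈ E := by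
  unfold translateEdges
  constructor
  · rintro ⟨e, he, h⟩
    induction e using Sym2.ind with
    | _ c d =>
      rw [Sym2.map_mk] at h
      have : s(a - v, b - v) = s(c, d) := by
        rw [Sym2.eq_iff] at h ⊢
        rcases h with ⟨rfl, rfl⟩ | ⟨rfl, rfl⟩
        · exact Or.inl ⟨add_sub_cancel_right _ _, add_sub_cancel_right _ _⟩
        · exact Or.inr ⟨add_sub_cancel_right _ _, add_sub_cancel_right _ _⟩
      rwa [this]
  · intro h
    exact ⟨_, h, by simp⟩

theorem translateEdges_zero (E : Set (Sym2 (ℤ × ℤ))) : translateEdges 0 E = E := by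
  ext e
  induction e using Sym2.ind with
  | _ a b => rw [mem_translateEdges, sub_zero, sub_zero]

/-- Imperfect loops with the same translation class coincide. -/
theorem loopClass_injOn (M : ℤ) :
    Set.InjOn loopClass {p | Imperfect M p.1 p.2} := by
  rintro ⟨t, y⟩ h ⟨t', y'⟩ h' he
  rw [Set.mem_ofPred_eq] at h h'
  have hm : loopEdges t' y' ∈ loopClass (t, y) := by
    rw [he]
    exact ⟨0, (translateEdges_zero _).symm⟩
  obtain ⟨v, hv⟩ := hm
  have per : ∀ {t y : ℤ → ℤ}, Imperfect M t y → ∀ i, loopPt t y (i + M) = loopPt t y i := by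
    intro t y h i
    rw [loopPt_inj, h.per_t, h.per_y]
    exact ⟨rfl, rfl⟩
  have inj : ∀ {t y : ℤ → ℤ}, Imperfect M t y → ∀ i j, loopPt t y i = loopPt t y j →
      M ∣ i - j := by
    intro t y h i j hij
    rw [loopPt_inj] at hij
    exact h.inj i j hij.1 hij.2
  obtain ⟨j, hj⟩ := exists_shift_of_edges (P := loopPt t y) (P' := fun i => loopPt t' y' i - v)
    h.big (per h) (inj h) (fun i => by rw [per h']) (fun i j hij => inj h' i j (by simpa using hij))
    (fun i => by
      have : s(loopPt t' y' i, loopPt t' y' (i + 1)) ∈ loopEdges t' y' := ⟨i, rfl⟩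
      rw [hv, mem_translateEdges] at this
      exact this)
  have hcoord : ∀ i k, loopPt t' y' i - v = loopPt t y k →
      t' i = t k + (v.1 + v.2) ∧ y' i = y k + v.2 := by
    intro i k hik
    unfold loopPt at hik
    rw [Prod.ext_iff] at hik
    simp only [Prod.fst_sub, Prod.snd_sub] at hik
    omega
  rcases hj with hj | hj
  · obtain ⟨e1, e2⟩ := h.eq_of_shift h' (fun i => (hcoord i _ (hj i)).1)
      (fun i => (hcoord i _ (hj i)).2)
    exact Prod.ext e1.symm e2.symm
  · exact (h.not_reverse h' (fun i => (hcoord i _ (hj i)).1)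
      (fun i => (hcoord i _ (hj i)).2)).elim

section Staircase

variable {n : ℕ} {p q : Fin (n + 1) → ℤ × ℤ}

theorem IsDirectedPath.level (hp : IsDirectedPath n p) (h0 : p 0 = (0, 0)) (i : Fin (n + 1)) :
    (p i).1 + (p i).2 = (i : ℕ) := by
  induction i using Fin.induction with
  | zero => rw [h0]; rfl
  | succ i ih =>
    have := hp i
    simp only [Prod.ext_iff, Prod.fst_sub, Prod.snd_sub] at this
    rw [Fin.val_succ]
    rw [Fin.val_castSucc] at ih
    push_cast
    omega

theorem IsDirectedPath.mem_edges (hp : IsDirectedPath n p) (h0 : p 0 = (0, 0)) {a b : ℤ × ℤ}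
    (hab : a.1 + a.2 < b.1 + b.2) (he : s(a, b) ∈ pathEdges n p) :
    ∃ i : Fin n, a = p i.castSucc ∧ b = p i.succ := by
  obtain ⟨i, hi⟩ := he
  refine ⟨i, ?_⟩
  rw [Sym2.eq_iff] at hi
  refine hi.resolve_right ?_
  rintro ⟨rfl, rfl⟩
  have h1 := hp.level h0 i.castSucc
  have h2 := hp.level h0 i.succ
  rw [Fin.val_castSucc] at h1
  rw [Fin.val_succ] at h2
  push_cast at h2
  omega

theorem IsStaircasePair.symm (h : IsStaircasePair n p q) : IsStaircasePair n q p := by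
  obtain ⟨h1, h2, h3, h4, h5, h6, h7⟩ := h
  exact ⟨h2, h1, h4, h3, h5.symm, h6.symm, fun i j hij => by
    rcases h7 j i hij.symm with h | h
    · exact Or.inl h.symm
    · exact Or.inr h.symm⟩

/-- The level of an edge of a staircase polygon lies between those of its two corners. -/
theorem IsStaircasePair.level_bounds (h : IsStaircasePair n p q) {a b : ℤ × ℤ}
    (he : s(a, b) ∈ pathEdges n p ∪ pathEdges n q) : 0 ≤ a.1 + a.2 ∧ a.1 + a.2 ≤ n := by
  obtain ⟨h1, h2, h3, h4, -⟩ := h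
  have key : ∀ r : Fin (n + 1) → ℤ × ℤ, IsDirectedPath n r → r 0 = (0, 0) →
      s(a, b) ∈ pathEdges n r → 0 ≤ a.1 + a.2 ∧ a.1 + a.2 ≤ n := by
    rintro r hr h0 ⟨i, hi⟩
    obtain ⟨k, hk⟩ : ∃ k, a = r k := by
      rw [Sym2.eq_iff] at hi
      rcases hi with hi | hi
      · exact ⟨_, hi.1⟩
      · exact ⟨_, hi.1⟩
    rw [hk, hr.level h0]
    have := k.is_lt
    omega
  rcases he with he | he
  · exact key p h1 h3 he
  · exact key q h2 h4 he

/-- A vertex with two edges to lower vertices is the final corner of a staircase polygon. -/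
theorem IsStaircasePair.level_eq_of_lower (h : IsStaircasePair n p q) {a b c : ℤ × ℤ}
    (hab : a ≠ b) (ha : a.1 + a.2 < c.1 + c.2) (hb : b.1 + b.2 < c.1 + c.2)
    (h1 : s(a, c) ∈ pathEdges n p ∪ pathEdges n q)
    (h2 : s(b, c) ∈ pathEdges n p ∪ pathEdges n q) : c.1 + c.2 = n := by
  have key : ∀ (r r' : Fin (n + 1) → ℤ × ℤ) (a b : ℤ × ℤ), IsStaircasePair n r r' →
      a.1 + a.2 < c.1 + c.2 → b.1 + b.2 < c.1 + c.2 → a ≠ b → s(a, c) ∈ pathEdges n r →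
      s(b, c) ∈ pathEdges n r ∪ pathEdges n r' → c.1 + c.2 = n := by
    rintro r r' a b ⟨hr, hr', h0, h0', -, -, hd⟩ ha hb hab ea eb
    obtain ⟨i, hi1, hi2⟩ := hr.mem_edges h0 ha ea
    rcases eb with eb | eb
    · obtain ⟨j, hj1, hj2⟩ := hr.mem_edges h0 hb eb
      have l1 := hr.level h0 i.succ
      have l2 := hr.level h0 j.succ
      rw [← hi2] at l1
      rw [← hj2, l1, Fin.val_succ, Fin.val_succ] at l2
      obtain rfl : i = j := Fin.ext (by omega)
      exact absurd (hi1.trans hj1.symm) hab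
    · obtain ⟨j, hj1, hj2⟩ := hr'.mem_edges h0' hb eb
      rcases hd _ _ (hi2.symm.trans hj2) with ⟨h, -⟩ | ⟨h, -⟩
      · exact absurd h (Fin.succ_ne_zero i)
      · rw [hi2, hr.level h0, h, Fin.val_last]
  rcases h1 with h1 | h1
  · exact key p q a b h ha hb hab h1 h2
  · exact key q p a b h.symm ha hb hab h1 h2.symm

/-- A vertex with two edges to higher vertices is the initial corner of a staircase polygon. -/
theorem IsStaircasePair.level_eq_of_upper (h : IsStaircasePair n p q) {a b c : ℤ × ℤ}
    (hab : a ≠ b) (ha : c.1 + c.2 < a.1 + a.2) (hb : c.1 + c.2 < b.1 + b.2)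
    (h1 : s(c, a) ∈ pathEdges n p ∪ pathEdges n q)
    (h2 : s(c, b) ∈ pathEdges n p ∪ pathEdges n q) : c.1 + c.2 = 0 := by
  have key : ∀ (r r' : Fin (n + 1) → ℤ × ℤ) (a b : ℤ × ℤ), IsStaircasePair n r r' →
      c.1 + c.2 < a.1 + a.2 → c.1 + c.2 < b.1 + b.2 → a ≠ b → s(c, a) ∈ pathEdges n r →
      s(c, b) ∈ pathEdges n r ∪ pathEdges n r' → c.1 + c.2 = 0 := by
    rintro r r' a b ⟨hr, hr', h0, h0', -, -, hd⟩ ha hb hab ea eb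
    obtain ⟨i, hi1, hi2⟩ := hr.mem_edges h0 ha ea
    rcases eb with eb | eb
    · obtain ⟨j, hj1, hj2⟩ := hr.mem_edges h0 hb eb
      have l1 := hr.level h0 i.castSucc
      have l2 := hr.level h0 j.castSucc
      rw [← hi1] at l1
      rw [← hj1, l1, Fin.val_castSucc, Fin.val_castSucc] at l2
      obtain rfl : i = j := Fin.ext (by omega)
      exact absurd (hi2.trans hj2.symm) hab
    · obtain ⟨j, hj1, hj2⟩ := hr'.mem_edges h0' hb eb
      rcases hd _ _ (hi1.symm.trans hj1) with ⟨h, -⟩ | ⟨h, -⟩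
      · rw [hi1, hr.level h0, h]
        rfl
      · exact absurd h (Fin.castSucc_lt_last i).ne
  rcases h1 with h1 | h1
  · exact key p q a b h ha hb hab h1 h2
  · exact key q p a b h.symm ha hb hab h1 h2.symm

end Staircase

/-- An imperfect loop is not a staircase polygon. -/
theorem Imperfect.not_staircase {M : ℤ} {t y : ℤ → ℤ} (h : Imperfect M t y) :
    ¬ IsStaircaseTranslate (loopEdges t y) := by
  rintro ⟨v, F, ⟨n, p, q, hpq, rfl⟩, hE⟩
  have hM := h.big
  have mem : ∀ i, s(loopPt t y i - v, loopPt t y (i + 1) - v) ∈ pathEdges n p ∪ pathEdges n q := by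
    intro i
    rw [← mem_translateEdges, ← hE]
    exact ⟨i, rfl⟩
  have lev : ∀ i, (loopPt t y i - v).1 + (loopPt t y i - v).2 = t i - (v.1 + v.2) := by
    intro i
    simp only [loopPt, Prod.fst_sub, Prod.snd_sub]
    ring
  have bd : ∀ i, 0 ≤ t i - (v.1 + v.2) ∧ t i - (v.1 + v.2) ≤ n := by
    intro i
    have := hpq.level_bounds (mem i)
    rwa [lev] at this
  have m0 := mem 0
  have m1 := mem (-1)
  rw [neg_add_cancel] at m1
  rw [zero_add] at m0
  have hne : loopPt t y (-1) - v ≠ loopPt t y 1 - v := by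
    intro he
    rw [sub_left_inj, loopPt_inj] at he
    have := h.inj _ _ he.1 he.2
    exact not_dvd_of_lt (Or.inr (by omega)) this
  rcases h.excAt with hE | hE
  · obtain ⟨i, hi⟩ := h.toLoop.not_max_of_excAt hE h.good
    obtain ⟨e1, e2, -, -⟩ := hE
    have := hpq.level_eq_of_lower hne (by rw [lev, lev]; omega) (by rw [lev, lev]; omega) m1
      (by rw [Sym2.eq_swap]; exact m0)
    rw [lev] at this
    have := bd i
    omega
  · obtain ⟨i, hi⟩ := h.rot.toLoop.not_max_of_excAt hE h.rot.good
    obtain ⟨e1, e2, -, -⟩ := hE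
    beta_reduce at e1 e2
    have := hpq.level_eq_of_upper hne (by rw [lev, lev]; omega) (by rw [lev, lev]; omega)
      (by rw [Sym2.eq_swap]; exact m1) m0
    rw [lev] at this
    have := bd i
    omega

/-- A loop without bad turns is a staircase polygon. -/
theorem Loop.staircase {N : ℕ} {t y : ℤ → ℤ} (L : Loop (2 * N) t y) (hg : ∀ i, GoodAt t y i) :
    IsStaircaseTranslate (loopEdges t y) := by
  obtain ⟨b, a, h1, h2, U, D⟩ := L.exists_twoRuns hg
  have hM := L.big
  have u1 := U a h1.le le_rfl
  have d1 := D (b + 2 * N) h2.le le_rfl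
  rw [L.per_t] at d1
  obtain rfl : a = b + N := by omega
  have hst : ∀ i, loopPt t y (i + 1) - loopPt t y i =
      (t (i + 1) - t i - (y (i + 1) - y i), y (i + 1) - y i) := by
    intro i
    simp only [loopPt, Prod.mk_sub_mk, Prod.mk.injEq, and_true]
    ring
  have hper : loopPt t y (b + 2 * N) = loopPt t y b := by
    rw [loopPt_inj, L.per_t, L.per_y]; exact ⟨rfl, rfl⟩
  have hinj : ∀ i j, loopPt t y i = loopPt t y j → (2 * N : ℤ) ∣ i - j := by
    intro i j h
    rw [loopPt_inj] at h
    exact L.inj i j h.1 h.2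
  refine ⟨loopPt t y b, _, ⟨N, fun i => loopPt t y (b + (i : ℕ)) - loopPt t y b,
    fun i => loopPt t y (b + 2 * N - (i : ℕ)) - loopPt t y b,
    ⟨fun i => ?_, fun i => ?_, ?_, ?_, ?_, ?_, ?_⟩, rfl⟩, ?_⟩
  · have hi := i.is_lt
    have e1 := U (b + (i : ℕ)) (by omega) (by omega)
    have e2 := U (b + (i : ℕ) + 1) (by omega) (by omega)
    have e3 := L.step (b + (i : ℕ))
    beta_reduce
    rw [Fin.val_succ, Fin.val_castSucc, sub_sub_sub_cancel_right, Nat.cast_succ, ← add_assoc, hst,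
      Prod.mk.injEq, Prod.mk.injEq]
    omega
  · have hi := i.is_lt
    have e1 := D (b + 2 * N - (i : ℕ)) (by omega) (by omega)
    have e2 := D (b + 2 * N - (i : ℕ) - 1) (by omega) (by omega)
    have e3 := L.step (b + 2 * N - (i : ℕ) - 1)
    have e4 := hst (b + 2 * N - (i : ℕ) - 1)
    rw [sub_add_cancel] at e3 e4
    beta_reduce
    rw [Fin.val_succ, Fin.val_castSucc, sub_sub_sub_cancel_right, Nat.cast_succ, ← sub_sub,
      ← neg_sub, e4, Prod.neg_mk, Prod.mk.injEq, Prod.mk.injEq]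
    omega
  · simp [Prod.ext_iff]
  · simp [hper, Prod.ext_iff]
  · intro he
    have := congrFun he ⟨1, by omega⟩
    simp only [sub_left_inj] at this
    have := hinj _ _ this
    push_cast at this
    exact not_dvd_of_lt (Or.inr (by omega)) this
  · simp only [Fin.val_last, sub_left_inj]
    rw [show b + 2 * (N : ℤ) - N = b + N by ring]
  · intro i j he
    simp only [sub_left_inj] at he
    have hd := hinj _ _ he
    have hi := i.is_lt
    have hj := j.is_lt
    by_contra hne
    have h3 : ((i : ℕ) + (j : ℕ) : ℤ) ≠ 0 := fun h0 => hne (Or.inl ⟨Fin.ext (by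
      rw [Fin.val_zero]; omega), Fin.ext (by rw [Fin.val_zero]; omega)⟩)
    have h4 : ((i : ℕ) + (j : ℕ) : ℤ) ≠ 2 * N := fun h0 => hne (Or.inr ⟨Fin.ext (by
      rw [Fin.val_last]; omega), Fin.ext (by rw [Fin.val_last]; omega)⟩)
    refine not_dvd_of_lt (M := 2 * N) (d := (i : ℕ) + (j : ℕ)) (by omega) ?_
    have := dvd_add hd (dvd_refl _)
    rw [show b + ((i : ℕ) : ℤ) - (b + 2 * N - (j : ℕ)) + 2 * N = (i : ℕ) + (j : ℕ) by ring] at this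
    exact this
  · ext e
    induction e using Sym2.ind with
    | _ c d =>
    rw [mem_translateEdges]
    constructor
    · rintro ⟨i, hi⟩
      obtain ⟨k, hk1, hk2, hk3⟩ : ∃ k, b ≤ k ∧ k < b + 2 * N ∧
          s(c, d) = s(loopPt t y k, loopPt t y (k + 1)) := by
        refine ⟨b + (i - b) % (2 * N), ?_, ?_, ?_⟩
        · have := Int.emod_nonneg (i - b) (show (2 * N : ℤ) ≠ 0 by omega)
          omega
        · have := Int.emod_lt_of_pos (i - b) (show (0 : ℤ) < 2 * N by omega)
          omega
        · have h5 := Int.emod_add_mul_ediv (i - b) (2 * N)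
          set k := b + (i - b) % (2 * N) with hk
          have h6 : i = k + (i - b) / (2 * N) * (2 * N) := by rw [hk]; linarith
          have h7 : i + 1 = k + 1 + (i - b) / (2 * N) * (2 * N) := by rw [add_right_comm, ← h6]
          have h8 : loopPt t y i = loopPt t y k := by
            rw [loopPt_inj, h6, L.t_add_mul, L.y_add_mul]; exact ⟨rfl, rfl⟩
          have h9 : loopPt t y (i + 1) = loopPt t y (k + 1) := by
            rw [loopPt_inj, h7, L.t_add_mul, L.y_add_mul]; exact ⟨rfl, rfl⟩
          rw [hi, h8, h9]
      have hk4 : s(c - loopPt t y b, d - loopPt t y b) =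
          s(loopPt t y k - loopPt t y b, loopPt t y (k + 1) - loopPt t y b) := by
        have := congrArg (Sym2.map (· - loopPt t y b)) hk3
        simpa using this
      rw [hk4]
      rcases lt_or_ge k (b + N) with hlt | hge
      · refine Or.inl ⟨⟨(k - b).toNat, by omega⟩, ?_⟩
        simp only [Fin.castSucc_mk, Fin.succ_mk]
        rw [Nat.cast_succ, Int.toNat_of_nonneg (by omega), show b + (k - b) = k by ring,
          show b + (k - b + 1) = k + 1 by ring]
      · refine Or.inr ⟨⟨(b + 2 * N - k - 1).toNat, by omega⟩, ?_⟩
        simp only [Fin.castSucc_mk, Fin.succ_mk]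
        rw [Nat.cast_succ, Int.toNat_of_nonneg (by omega),
          show b + 2 * N - (b + 2 * N - k - 1) = k + 1 by ring,
          show b + 2 * N - (b + 2 * N - k - 1 + 1) = k by ring, Sym2.eq_swap]
    · have back : ∀ k, s(c - loopPt t y b, d - loopPt t y b) =
          s(loopPt t y k - loopPt t y b, loopPt t y (k + 1) - loopPt t y b) →
          s(c, d) ∈ loopEdges t y := by
        intro k hk
        refine ⟨k, ?_⟩
        have := congrArg (Sym2.map (· + loopPt t y b)) hk
        simpa using this
      rintro (⟨i, hi⟩ | ⟨i, hi⟩)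
      · refine back (b + (i : ℕ)) (hi.trans ?_)
        beta_reduce
        rw [Fin.val_castSucc, Fin.val_succ, Nat.cast_succ, add_assoc]
      · refine back (b + 2 * N - (i : ℕ) - 1) (hi.trans ?_)
        beta_reduce
        rw [Fin.val_castSucc, Fin.val_succ, Nat.cast_succ, sub_add_cancel, sub_sub, Sym2.eq_swap]

/-- The number of vertical steps in the first `K` steps. -/
def vsteps (K : ℕ) (y : ℤ → ℤ) : ℕ :=
  ((Finset.range K).filter fun i : ℕ => y ((i : ℤ) + 1) ≠ y i).card

theorem Loop.step_cases {M : ℤ} {t y : ℤ → ℤ} (L : Loop M t y) (i : ℤ) :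
    loopPt t y (i + 1) - loopPt t y i ∈
      ({(1, 0), (-1, 0), (0, 1), (0, -1)} : Set (ℤ × ℤ)) := by
  have := L.step i
  simp only [loopPt, Prod.mk_sub_mk, Set.mem_insert_iff, Set.mem_singleton_iff, Prod.mk.injEq]
  omega

/-- A three-choice polygon is a loop. -/
theorem IsThreeChoicePolygon.exists_loop {N : ℕ} (hN : 2 ≤ N) {w : Fin (2 * N + 1) → ℤ × ℤ}
    (h : IsThreeChoicePolygon N w) : ∃ t y, Loop (2 * N) t y ∧ t 0 = 0 ∧ y 0 = 0 ∧
      (∀ i : ℤ, 0 < i → i < 2 * N → GoodAt t y i) ∧ 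
      w = fun i : Fin (2 * N + 1) => loopPt t y (i : ℕ) := by
  obtain ⟨h0, hl, hs, hi, hc⟩ := h
  have hpos : (0 : ℤ) < 2 * N := by omega
  have hb : ∀ i : ℤ, (i % (2 * N)).toNat < 2 * N := by
    intro i
    have := Int.emod_lt_of_pos i hpos
    omega
  set k : ℤ → Fin (2 * N) := fun i => ⟨(i % (2 * N)).toNat, hb i⟩ with hk
  have hkv : ∀ i, ((k i : ℕ) : ℤ) = i % (2 * N) := fun i =>
    Int.toNat_of_nonneg (Int.emod_nonneg _ hpos.ne')
  set P : ℤ → ℤ × ℤ := fun i => w (k i).castSucc with hP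
  have hPsucc : ∀ i, P (i + 1) = w (k i).succ := by
    intro i
    have e1 := hkv i
    have e2 := hkv (i + 1)
    have e3 := (k i).is_lt
    rw [← Int.emod_add_emod, ← e1] at e2
    rcases eq_or_lt_of_le (Nat.succ_le_of_lt e3) with h | h
    · have : (k i).succ = Fin.last _ := Fin.ext h
      rw [this, hl]
      have : (k (i + 1)).castSucc = 0 := by
        apply Fin.ext
        rw [show ((k i : ℕ) : ℤ) + 1 = 2 * N by omega, Int.emod_self] at e2
        rw [Fin.val_castSucc, Fin.val_zero]
        omega
      rw [hP]
      beta_reduce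
      rw [this, h0]
    · have : (k (i + 1)).castSucc = (k i).succ := by
        apply Fin.ext
        rw [Int.emod_eq_of_lt (by omega) (by omega)] at e2
        rw [Fin.val_castSucc, Fin.val_succ]
        omega
      rw [hP]
      beta_reduce
      rw [this]
  have hst : ∀ i, P (i + 1) - P i ∈ ({(1, 0), (-1, 0), (0, 1), (0, -1)} : Set (ℤ × ℤ)) := by
    intro i
    rw [hPsucc]
    exact hs (k i)
  have hper : ∀ i, P (i + 2 * N) = P i := by
    intro i
    have : k (i + 2 * N) = k i := by
      apply Fin.ext
      have e1 := hkv (i + 2 * N)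
      rw [Int.add_emod_right, ← hkv] at e1
      omega
    rw [hP]
    beta_reduce
    rw [this]
  have hinj : ∀ i j, P i = P j → (2 * N : ℤ) ∣ i - j := by
    intro i j hij
    have := hi _ _ hij
    have e1 := hkv i
    rw [this, hkv j] at e1
    exact Int.ModEq.dvd e1
  have hP0 : P 0 = (0, 0) := by
    rw [← h0, hP]
    beta_reduce
    congr 1
  have hpt : ∀ i, loopPt (fun i => (P i).1 + (P i).2) (fun i => (P i).2) i = P i := by
    intro i
    exact Prod.ext (add_sub_cancel_right _ _) rfl
  have hL : Loop (2 * N) (fun i => (P i).1 + (P i).2) (fun i => (P i).2) := by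
    refine ⟨by omega, fun i => by rw [hper], fun i => by rw [hper], fun i j e1 e2 => ?_,
      fun i => ?_⟩
    · exact hinj i j (Prod.ext (by omega) e2)
    · have := hst i
      simp only [Set.mem_insert_iff, Set.mem_singleton_iff, Prod.ext_iff, Prod.fst_sub,
        Prod.snd_sub] at this
      omega
  refine ⟨_, _, hL, by simp [hP0], by simp [hP0], fun i i1 i2 => ?_, ?_⟩
  · have hne : P (i - 1) ≠ P (i + 1) := fun he =>
      not_dvd_of_lt (Or.inr (by omega)) (hinj _ _ he)
    have c := hc (k (i - 1)) (k i) (by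
      have e1 := hkv (i - 1)
      have e2 := hkv i
      rw [Int.emod_eq_of_lt (by omega) (by omega)] at e1 e2
      omega)
    have s1 := hst (i - 1)
    have s2 := hst i
    have w1 : walkStep (2 * N) w (k (i - 1)) = P (i - 1 + 1) - P (i - 1) := by rw [hPsucc]; rfl
    have w2 : walkStep (2 * N) w (k i) = P (i + 1) - P i := by rw [hPsucc]; rfl
    rw [w1, w2] at c
    rw [sub_add_cancel] at s1 c
    rw [Ne, Prod.ext_iff] at hne
    simp only [Set.mem_insert_iff, Set.mem_singleton_iff, Prod.ext_iff, Prod.fst_sub,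
      Prod.snd_sub] at s1 s2 c
    unfold GoodAt
    beta_reduce
    omega
  · funext i
    rw [hpt]
    refine Fin.lastCases ?_ (fun j => ?_) i
    · rw [hl, ← hP0, ← hper 0, Fin.val_last, zero_add]
      push_cast
      rfl
    · rw [hP]
      beta_reduce
      congr 1
      apply Fin.ext
      have := hkv (j : ℕ)
      rw [Int.emod_eq_of_lt (by omega) (by omega)] at this
      rw [Fin.val_castSucc, Fin.val_castSucc]
      omega

/-- A loop without bad turns away from `0` is a three-choice polygon. -/
theorem Loop.isThreeChoicePolygon {N : ℕ} {t y : ℤ → ℤ} (L : Loop (2 * N) t y) (ht : t 0 = 0)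
    (hy : y 0 = 0) (hg : ∀ i : ℤ, 0 < i → i < 2 * N → GoodAt t y i) :
    IsThreeChoicePolygon N fun i => loopPt t y (i : ℕ) := by
  have hst : ∀ i : Fin (2 * N), walkStep (2 * N) (fun i => loopPt t y (i : ℕ)) i =
      loopPt t y ((i : ℕ) + 1) - loopPt t y (i : ℕ) := by
    intro i
    unfold walkStep
    beta_reduce
    rw [Fin.val_succ, Fin.val_castSucc, Nat.cast_succ]
  refine ⟨?_, ?_, fun i => ?_, fun i j hij => ?_, fun i j hij => ⟨?_, ?_⟩⟩
  · simp [loopPt, ht, hy]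
  · have h1 := L.per_t 0
    have h2 := L.per_y 0
    rw [zero_add] at h1 h2
    simp [loopPt, h1, h2, ht, hy]
  · rw [hst]
    exact L.step_cases _
  · rw [loopPt_inj, Fin.val_castSucc, Fin.val_castSucc] at hij
    have := L.inj _ _ hij.1 hij.2
    have hi := i.is_lt
    have hj := j.is_lt
    by_contra hne
    have hne : (i : ℕ) ≠ j := fun h => hne (Fin.ext h)
    exact not_dvd_of_lt (by omega) this
  all_goals
    rw [hst, hst, hij]
    have hj := j.is_lt
    have g := hg (i + 1 : ℕ) (by omega) (by omega)
    have s1 := L.step (i : ℕ)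
    have s2 := L.step ((i : ℕ) + 1)
    unfold GoodAt at g
    push_cast at g ⊢
    rw [add_sub_cancel_right] at g
    simp only [loopPt, Prod.mk_sub_mk, Prod.mk.injEq]
    omega

theorem Loop.exists_rep {N : ℕ} {t y : ℤ → ℤ} (L : Loop (2 * N) t y) (i : ℤ) :
    ∃ j : ℕ, j < 2 * N ∧ loopPt t y i = loopPt t y j ∧ loopPt t y (i + 1) = loopPt t y (j + 1) := by
  have hM := L.big
  have h1 := Int.emod_nonneg i (show (2 * N : ℤ) ≠ 0 by omega)
  have h2 := Int.emod_lt_of_pos i (show (0 : ℤ) < 2 * N by omega)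
  have h3 := Int.emod_add_mul_ediv i (2 * N)
  obtain ⟨j, hj⟩ := Int.eq_ofNat_of_zero_le h1
  have h6 : i = j + i / (2 * N) * (2 * N) := by rw [← hj]; linarith
  have h7 : i + 1 = j + 1 + i / (2 * N) * (2 * N) := by rw [add_right_comm, ← h6]
  refine ⟨j, by omega, ?_, ?_⟩
  · rw [loopPt_inj, h6, L.t_add_mul, L.y_add_mul]; exact ⟨rfl, rfl⟩
  · rw [loopPt_inj, h7, L.t_add_mul, L.y_add_mul]; exact ⟨rfl, rfl⟩

theorem Loop.polygonEdges_eq {N : ℕ} {t y : ℤ → ℤ} (L : Loop (2 * N) t y) :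
    polygonEdges N (fun i => loopPt t y (i : ℕ)) = loopEdges t y := by
  ext e
  constructor
  · rintro ⟨i, rfl⟩
    refine ⟨(i : ℕ), ?_⟩
    beta_reduce
    rw [Fin.val_succ, Fin.val_castSucc, Nat.cast_succ]
  · rintro ⟨i, rfl⟩
    obtain ⟨j, hj, e1, e2⟩ := L.exists_rep i
    refine ⟨⟨j, hj⟩, ?_⟩
    beta_reduce
    rw [Fin.val_succ, Fin.val_castSucc, Nat.cast_succ, e1, e2]

theorem Loop.card_edges {N : ℕ} {t y : ℤ → ℤ} (L : Loop (2 * N) t y) {p : Sym2 (ℤ × ℤ) → Prop}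
    {q : ℤ → Prop} [DecidablePred q] (hpq : ∀ i, p s(loopPt t y i, loopPt t y (i + 1)) ↔ q i)
    (hq : ∀ i j, loopPt t y i = loopPt t y j → loopPt t y (i + 1) = loopPt t y (j + 1) →
      (q i ↔ q j)) :
    Nat.card {e : Sym2 (ℤ × ℤ) // e ∈ loopEdges t y ∧ p e} =
      ((Finset.range (2 * N)).filter fun i : ℕ => q i).card := by
  have hM := L.big
  have himg : {e : Sym2 (ℤ × ℤ) | e ∈ loopEdges t y ∧ p e} =
      (fun i : ℕ => s(loopPt t y i, loopPt t y (i + 1))) ''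
        (((Finset.range (2 * N)).filter fun i : ℕ => q i) : Finset ℕ) := by
    ext e
    simp only [Set.mem_ofPred_eq, Set.mem_image, Finset.mem_coe, Finset.mem_filter,
      Finset.mem_range]
    constructor
    · rintro ⟨⟨i, rfl⟩, h⟩
      obtain ⟨j, hj, e1, e2⟩ := L.exists_rep i
      refine ⟨j, ⟨hj, ?_⟩, by rw [e1, e2]⟩
      rw [← hq i j e1 e2, ← hpq]
      exact h
    · rintro ⟨j, ⟨hj, hqj⟩, rfl⟩
      exact ⟨⟨j, rfl⟩, (hpq _).2 hqj⟩
  have hd : ∀ i j, loopPt t y i = loopPt t y j → (2 * N : ℤ) ∣ i - j := by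
    intro i j h
    rw [loopPt_inj] at h
    exact L.inj i j h.1 h.2
  have hinj : Set.InjOn (fun i : ℕ => s(loopPt t y i, loopPt t y (i + 1)))
      (((Finset.range (2 * N)).filter fun i : ℕ => q i) : Finset ℕ) := by
    intro i hi j hj hij
    rw [Finset.mem_coe, Finset.mem_filter, Finset.mem_range] at hi hj
    beta_reduce at hij
    rw [Sym2.eq_iff] at hij
    rcases hij with ⟨h1, -⟩ | ⟨h1, h2⟩
    · by_contra hne
      exact not_dvd_of_lt (by omega) (hd _ _ h1)
    · have := dvd_sub (hd _ _ h2) (hd _ _ h1)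
      rw [show (i : ℤ) + 1 - j - (i - (j + 1)) = 2 by ring] at this
      exact (not_dvd_of_lt (by omega) this).elim
  have := hinj.ncard_image
  rw [Set.ncard_coe_finset, ← himg] at this
  rw [← this]
  rfl

theorem Loop.vertCount_eq {N : ℕ} {t y : ℤ → ℤ} (L : Loop (2 * N) t y) :
    vertCount (loopEdges t y) = vsteps (2 * N) y := by
  refine L.card_edges (p := IsVerticalEdge) (q := fun i => y (i + 1) ≠ y i) (fun i => ?_)
    (fun i j h1 h2 => ?_)
  · have := L.step i
    unfold IsVerticalEdge
    constructor
    · rintro ⟨a, ha⟩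
      rw [Sym2.eq_iff] at ha
      simp only [loopPt, Prod.ext_iff, Prod.fst_add, Prod.snd_add] at ha
      omega
    · intro h
      beta_reduce at h
      by_cases hlt : y i < y (i + 1)
      · refine ⟨loopPt t y i, ?_⟩
        rw [Sym2.eq_iff]
        simp only [loopPt, Prod.ext_iff, Prod.fst_add, Prod.snd_add, true_and]
        omega
      · refine ⟨loopPt t y (i + 1), ?_⟩
        rw [Sym2.eq_iff]
        simp only [loopPt, Prod.ext_iff, Prod.fst_add, Prod.snd_add, and_true]
        omega
  · rw [loopPt_inj] at h1 h2
    rw [h1.2, h2.2]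

theorem Loop.horizCount_add_vsteps {N : ℕ} {t y : ℤ → ℤ} (L : Loop (2 * N) t y) :
    horizCount (loopEdges t y) + vsteps (2 * N) y = 2 * N := by
  have : horizCount (loopEdges t y) =
      ((Finset.range (2 * N)).filter fun i : ℕ => y ((i : ℤ) + 1) = y i).card := by
    refine L.card_edges (p := IsHorizontalEdge) (q := fun i => y (i + 1) = y i) (fun i => ?_)
      (fun i j h1 h2 => ?_)
    · have := L.step i
      unfold IsHorizontalEdge
      constructor
      · rintro ⟨a, ha⟩
        rw [Sym2.eq_iff] at ha
        simp only [loopPt, Prod.ext_iff, Prod.fst_add, Prod.snd_add] at ha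
        omega
      · intro h
        beta_reduce at h
        by_cases hlt : t i < t (i + 1)
        · refine ⟨loopPt t y i, ?_⟩
          rw [Sym2.eq_iff]
          simp only [loopPt, Prod.ext_iff, Prod.fst_add, Prod.snd_add, true_and]
          omega
        · refine ⟨loopPt t y (i + 1), ?_⟩
          rw [Sym2.eq_iff]
          simp only [loopPt, Prod.ext_iff, Prod.fst_add, Prod.snd_add, and_true]
          omega
    · rw [loopPt_inj] at h1 h2
      rw [h1.2, h2.2]
  rw [this, vsteps, Finset.card_filter_add_card_filter_not, Finset.card_range]

/-- Imperfect staircase polygons are the same as imperfect loops. -/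
theorem imperfectCountAniso_eq_ncard {m n : ℕ} (h : 2 ≤ m + n) :
    imperfectCountAniso m n = Set.ncard {p : (ℤ → ℤ) × (ℤ → ℤ) |
      Imperfect (2 * (m + n : ℕ)) p.1 p.2 ∧ vsteps (2 * (m + n)) p.2 = 2 * n} := by
  have hinj := (loopClass_injOn (2 * (m + n : ℕ))).mono
    (s₁ := {p : (ℤ → ℤ) × (ℤ → ℤ) | Imperfect (2 * (m + n : ℕ)) p.1 p.2 ∧
      vsteps (2 * (m + n)) p.2 = 2 * n})
    (fun p hp => hp.1)
  rw [← hinj.ncard_image, imperfectCountAniso]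
  refine (Nat.card_congr (Equiv.refl _)).trans (congrArg Set.ncard (Set.ext fun C => ?_))
  constructor
  · rintro ⟨w, hw, h1, h2, h3, rfl⟩
    obtain ⟨t, y, L, t0, y0, hg, rfl⟩ := hw.exists_loop h
    rw [L.polygonEdges_eq] at h1 h2 h3 ⊢
    rw [L.vertCount_eq] at h3
    refine ⟨(t, y), ⟨⟨L, t0, y0, hg, fun hb => h1 (L.staircase fun i => ?_)⟩, h3⟩, rfl⟩
    have hM := L.big
    have e1 := Int.emod_add_mul_ediv i (2 * (m + n : ℕ))
    rw [← e1, mul_comm (2 * ((m + n : ℕ) : ℤ)), L.goodAt_add_mul]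
    rcases eq_or_lt_of_le (Int.emod_nonneg i (show (2 * (m + n : ℕ) : ℤ) ≠ 0 by omega)) with h | h
    · rw [← h]; exact hb
    · exact hg _ h (Int.emod_lt_of_pos _ (by omega))
  · rintro ⟨⟨t, y⟩, ⟨hI, h3⟩, rfl⟩
    have L := hI.toLoop
    refine ⟨fun i => loopPt t y (i : ℕ), L.isThreeChoicePolygon hI.t_zero hI.y_zero hI.good, ?_⟩
    have := L.horizCount_add_vsteps
    rw [L.polygonEdges_eq, L.vertCount_eq]
    exact ⟨hI.not_staircase, by omega, h3, rfl⟩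

theorem vsteps_neg (K : ℕ) (y : ℤ → ℤ) : vsteps K (fun i => - y i) = vsteps K y := by
  unfold vsteps
  simp only [ne_eq, neg_inj]

theorem imperfectCountAniso_eq_two_mul {m n : ℕ} (h : 2 ≤ m + n)
    (hfin : {p : (ℤ → ℤ) × (ℤ → ℤ) | (Imperfect (2 * (m + n : ℕ)) p.1 p.2 ∧ ExcAt p.1 p.2) ∧
      vsteps (2 * (m + n)) p.2 = 2 * n}.Finite) :
    imperfectCountAniso m n = 2 * Set.ncard {p : (ℤ → ℤ) × (ℤ → ℤ) |
      (Imperfect (2 * (m + n : ℕ)) p.1 p.2 ∧ ExcAt p.1 p.2) ∧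
        vsteps (2 * (m + n)) p.2 = 2 * n} := by
  set S := {p : (ℤ → ℤ) × (ℤ → ℤ) | (Imperfect (2 * (m + n : ℕ)) p.1 p.2 ∧ ExcAt p.1 p.2) ∧
      vsteps (2 * (m + n)) p.2 = 2 * n} with hS
  have hneg : Function.Injective fun p : (ℤ → ℤ) × (ℤ → ℤ) => -p := neg_injective
  have hU : {p : (ℤ → ℤ) × (ℤ → ℤ) | Imperfect (2 * (m + n : ℕ)) p.1 p.2 ∧
      vsteps (2 * (m + n)) p.2 = 2 * n} = S ∪ (fun p => -p) '' S := by
    ext ⟨t, y⟩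
    constructor
    · rintro ⟨h1, h2⟩
      rcases h1.excAt with hE | hE
      · exact Or.inl ⟨⟨h1, hE⟩, h2⟩
      · refine Or.inr ⟨(fun i => - t i, fun i => - y i), ⟨⟨h1.rot, hE⟩, ?_⟩, ?_⟩
        · exact (vsteps_neg _ _).trans h2
        · exact neg_neg (t, y)
    · rintro (⟨⟨h1, -⟩, h2⟩ | ⟨⟨t', y'⟩, ⟨⟨h1, -⟩, h2⟩, he⟩)
      · exact ⟨h1, h2⟩
      · rw [← he]
        exact ⟨h1.rot, (vsteps_neg _ _).trans h2⟩
  rw [imperfectCountAniso_eq_ncard h, hU, Set.ncard_union_eq _ hfin (hfin.image _),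
    Set.ncard_image_of_injective _ hneg, two_mul]
  rw [Set.disjoint_left]
  rintro _ ⟨⟨-, e1, -⟩, -⟩ ⟨⟨t', y'⟩, ⟨⟨-, e2, -⟩, -⟩, rfl⟩
  simp only [Prod.fst_neg, Pi.neg_apply] at e1
  dsimp only at e2
  omega

/-- The first `k` steps of `f` are constant or decrease by one. -/
def Anti (f : ℕ → ℤ) (k : ℕ) : Prop := ∀ s < k, f (s + 1) = f s ∨ f (s + 1) = f s - 1

/-- The ordinates along a loop made of four runs, with an exceptional turn at the index `0`,
as a function of the sizes of the runs. -/
structure Notch (a h b : ℕ) (y : ℤ → ℤ) : Prop where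
  a_pos : 0 < a
  h_pos : 0 < h
  b_pos : 0 < b
  per : ∀ i, y (i + 2 * (a + h + b : ℕ)) = y i
  zero : y 0 = 0
  anti₁ : Anti (fun s => y s) a
  anti₂ : Anti (fun s => y (2 * a - s)) a
  anti₃ : Anti (fun s => y (2 * a + h - s)) h
  anti₄ : Anti (fun s => y (2 * a + h + s)) h
  anti₅ : Anti (fun s => y (2 * a + 2 * h + s)) b
  anti₆ : Anti (fun s => y (-s)) b
  right : ∀ s : ℕ, 0 < s → s ≤ h → y (2 * a + h - s) < y (2 * a + h + s)
  low : ∀ s : ℕ, s < a → y (2 * a - s) < y s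
  hi : ∀ s : ℕ, s < b → y (-s) < y (2 * a + 2 * h + s)
  mid : ∀ s : ℕ, 0 < s → s ≤ a → s ≤ b → y s < y (-s)

/-- The levels of a loop made of four runs, one period starting at the index `0`. -/
def runLevel (a h b : ℕ) (i : ℤ) : ℤ :=
  if i ≤ a then -i else if i ≤ 2 * a + h then i - 2 * a
    else if i ≤ 2 * a + 2 * h + b then 2 * a + 2 * h - i else i - 2 * (a + h + b)

/-- The levels of a loop made of four runs. -/
def runT (a h b : ℕ) (i : ℤ) : ℤ := runLevel a h b (i % (2 * (a + h + b : ℕ)))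

section

variable {a h b : ℕ} {y : ℤ → ℤ}

theorem runT_add (i : ℤ) : runT a h b (i + 2 * (a + h + b : ℕ)) = runT a h b i := by
  simp [runT]

theorem runT_eq (hh : 0 < a + h + b) {i : ℤ} (h0 : 0 ≤ i) (h1 : i ≤ 2 * (a + h + b : ℕ)) :
    runT a h b i = runLevel a h b i := by
  rcases eq_or_lt_of_le h1 with rfl | h1
  · have : runT a h b (2 * (a + h + b : ℕ)) = runT a h b 0 := by
      have := runT_add (a := a) (h := h) (b := b) 0
      rwa [zero_add] at this
    rw [this, runT, Int.zero_emod]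
    unfold runLevel
    push_cast
    split_ifs <;> omega
  · rw [runT, Int.emod_eq_of_lt h0 h1]

theorem exists_residue {M : ℤ} (hM : 0 < M) (i : ℤ) : ∃ j k, 0 ≤ j ∧ j < M ∧ i = j + k * M :=
  ⟨i % M, i / M, Int.emod_nonneg _ hM.ne', Int.emod_lt_of_pos _ hM,
    by rw [mul_comm]; exact (Int.emod_add_mul_ediv i M).symm⟩

theorem add_mul_of_periodic {f : ℤ → ℤ} {M : ℤ} (hf : ∀ i, f (i + M) = f i) (i k : ℤ) :
    f (i + k * M) = f i :=
  (Function.Periodic.int_mul (f := f) (c := M) hf k) i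

namespace Notch

theorem step_aux (G : Notch a h b y) {i : ℤ} (h0 : 0 ≤ i) (h1 : i < 2 * (a + h + b : ℕ)) :
    (runLevel a h b (i + 1) = runLevel a h b i + 1 ∧ (y (i + 1) = y i ∨ y (i + 1) = y i + 1)) ∨
    (runLevel a h b (i + 1) = runLevel a h b i - 1 ∧ (y (i + 1) = y i ∨ y (i + 1) = y i - 1)) := by
  unfold runLevel
  rcases lt_or_ge i a with k1 | k1
  · have := G.anti₁ i.toNat (by omega)
    dsimp only at this
    rw [show ((i.toNat + 1 : ℕ) : ℤ) = i + 1 by omega, Int.toNat_of_nonneg h0] at this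
    split_ifs <;> omega
  rcases lt_or_ge i (2 * a) with k2 | k2
  · have := G.anti₂ (2 * a - 1 - i).toNat (by omega)
    dsimp only at this
    rw [show (2 * a : ℤ) - ((2 * a - 1 - i).toNat + 1 : ℕ) = i by omega,
      show (2 * a : ℤ) - ((2 * a - 1 - i).toNat : ℕ) = i + 1 by omega] at this
    split_ifs <;> omega
  rcases lt_or_ge i (2 * a + h) with k3 | k3
  · have := G.anti₃ (2 * a + h - 1 - i).toNat (by omega)
    dsimp only at this
    rw [show (2 * a + h : ℤ) - ((2 * a + h - 1 - i).toNat + 1 : ℕ) = i by omega,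
      show (2 * a + h : ℤ) - ((2 * a + h - 1 - i).toNat : ℕ) = i + 1 by omega] at this
    split_ifs <;> omega
  rcases lt_or_ge i (2 * a + 2 * h) with k4 | k4
  · have := G.anti₄ (i - 2 * a - h).toNat (by omega)
    dsimp only at this
    rw [show (2 * a + h : ℤ) + ((i - 2 * a - h).toNat + 1 : ℕ) = i + 1 by omega,
      show (2 * a + h : ℤ) + ((i - 2 * a - h).toNat : ℕ) = i by omega] at this
    split_ifs <;> omega
  rcases lt_or_ge i (2 * a + 2 * h + b) with k5 | k5
  · have := G.anti₅ (i - 2 * a - 2 * h).toNat (by omega)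
    dsimp only at this
    rw [show (2 * a + 2 * h : ℤ) + ((i - 2 * a - 2 * h).toNat + 1 : ℕ) = i + 1 by omega,
      show (2 * a + 2 * h : ℤ) + ((i - 2 * a - 2 * h).toNat : ℕ) = i by omega] at this
    split_ifs <;> omega
  · have := G.anti₆ (2 * (a + h + b) - 1 - i).toNat (by omega)
    dsimp only at this
    rw [← G.per, ← G.per (-((2 * (a + h + b) - 1 - i).toNat : ℕ)),
      show -(((2 * (a + h + b) - 1 - i).toNat + 1 : ℕ) : ℤ) + 2 * (a + h + b : ℕ) = i by omega,
      show -(((2 * (a + h + b) - 1 - i).toNat : ℕ) : ℤ) + 2 * (a + h + b : ℕ) = i + 1 by omega]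
      at this
    split_ifs <;> omega

theorem inj_aux (G : Notch a h b y) {i j : ℤ} (hi0 : 0 ≤ i) (hi1 : i < 2 * (a + h + b : ℕ))
    (hj0 : 0 ≤ j) (hj1 : j < 2 * (a + h + b : ℕ)) (ht : runLevel a h b i = runLevel a h b j)
    (hy : y i = y j) : i = j := by
  have rep : ∀ i : ℤ, 0 ≤ i → i < 2 * (a + h + b : ℕ) →
      (0 < runLevel a h b i ∧ runLevel a h b i ≤ h ∧ (i = 2 * a + runLevel a h b i ∨
        i = 2 * a + 2 * h - runLevel a h b i)) ∨
      runLevel a h b i ≤ 0 ∧ ((i = - runLevel a h b i ∧ i < a) ∨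
        (i = 2 * a + runLevel a h b i ∧ a ≤ i) ∨
        (i = 2 * (a + h + b : ℕ) + runLevel a h b i ∧ - runLevel a h b i < b) ∨
        i = 2 * a + 2 * h - runLevel a h b i ∧ - runLevel a h b i ≤ b) := by
    intro i h0 h1
    unfold runLevel
    split_ifs <;> omega
  have ri := rep i hi0 hi1
  have rj := rep j hj0 hj1
  rw [← ht] at rj
  generalize runLevel a h b i = τ at ri rj
  rcases lt_or_ge 0 τ with hτ | hτ
  · have c := G.right (h - τ).toNat
    have hτ' : τ ≤ h := by omega
    rw [show (2 * a + h : ℤ) - ((h - τ).toNat : ℕ) = 2 * a + τ by omega,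
      show (2 * a + h : ℤ) + ((h - τ).toNat : ℕ) = 2 * a + 2 * h - τ by omega] at c
    have ri' : i = 2 * a + τ ∨ i = 2 * a + 2 * h - τ := by omega
    have rj' : j = 2 * a + τ ∨ j = 2 * a + 2 * h - τ := by omega
    rcases ri' with e | e <;> rcases rj' with e' | e' <;> rw [e, e'] at hy <;> omega
  · have c1 := G.low (-τ).toNat
    have c2 := G.hi (-τ).toNat
    have c3 := G.mid (-τ).toNat
    rw [show ((-τ).toNat : ℤ) = -τ by omega] at c1 c2 c3
    rw [← G.per (- -τ), neg_neg, add_comm τ] at c2 c3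
    rw [sub_neg_eq_add] at c1
    rw [← sub_eq_add_neg] at c2
    have c4 : -τ = a → y (2 * a + τ) = y (-τ) := fun h => by congr 1; omega
    have c5 : -τ = b → y (2 * a + 2 * h - τ) = y (2 * (a + h + b : ℕ) + τ) := fun h => by
      congr 1; push_cast; omega
    have c6 : τ = 0 → y (2 * (a + h + b : ℕ) + τ) = y (-τ) := fun h => by
      rw [h, add_comm, G.per, neg_zero]
    have ri' := ri.resolve_left (by omega)
    have rj' := rj.resolve_left (by omega)
    clear ri rj rep
    rcases ri'.2 with e | e | e | e <;> rcases rj'.2 with e' | e' | e' | e' <;>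
      rw [e.1, e'.1] at hy <;> omega

theorem imperfect (G : Notch a h b y) :
    Imperfect (2 * (a + h + b : ℕ)) (runT a h b) y ∧ ExcAt (runT a h b) y := by
  have a0 := G.a_pos
  have h0 := G.h_pos
  have b0 := G.b_pos
  have hM : 0 < a + h + b := by omega
  have hE : ExcAt (runT a h b) y := by
    have e0 := runT_eq (a := a) (h := h) (b := b) hM (i := 0) le_rfl (by omega)
    have e1 := runT_eq (a := a) (h := h) (b := b) hM (i := 1) (by omega) (by omega)
    have e2 := runT_eq (a := a) (h := h) (b := b) hM (i := 2 * (a + h + b : ℕ) - 1)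
      (by omega) (by omega)
    have e3 := runT_add (a := a) (h := h) (b := b) (-1)
    rw [show -1 + 2 * ((a + h + b : ℕ) : ℤ) = 2 * (a + h + b : ℕ) - 1 by ring] at e3
    have m := G.mid 1 (by omega) (by omega) (by omega)
    have p1 := G.anti₁ 0 a0
    have p2 := G.anti₆ 0 b0
    have z := G.zero
    norm_num at m p1 p2
    unfold ExcAt
    rw [← e3, e0, e1, e2]
    unfold runLevel
    push_cast
    refine ⟨?_, ?_, ?_, ?_⟩
    · split_ifs <;> omega
    · split_ifs <;> omega
    · omega
    · omega
  have L : Loop (2 * (a + h + b : ℕ)) (runT a h b) y := by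
    refine ⟨by omega, runT_add, G.per, ?_, ?_⟩
    · intro i j ht hy
      obtain ⟨i', k, hi0, hi1, rfl⟩ := exists_residue (M := 2 * (a + h + b : ℕ)) (by omega) i
      obtain ⟨j', l, hj0, hj1, rfl⟩ := exists_residue (M := 2 * (a + h + b : ℕ)) (by omega) j
      have pt := add_mul_of_periodic (runT_add (a := a) (h := h) (b := b))
      have py := add_mul_of_periodic G.per
      rw [pt, pt, runT_eq hM hi0 hi1.le, runT_eq hM hj0 hj1.le] at ht
      rw [py, py] at hy
      rw [G.inj_aux hi0 hi1 hj0 hj1 ht hy]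
      exact ⟨k - l, by ring⟩
    · intro i
      obtain ⟨i', k, hi0, hi1, rfl⟩ := exists_residue (M := 2 * (a + h + b : ℕ)) (by omega) i
      have pt := add_mul_of_periodic (runT_add (a := a) (h := h) (b := b))
      have py := add_mul_of_periodic G.per
      rw [show i' + k * (2 * (a + h + b : ℕ)) + 1 = i' + 1 + k * (2 * (a + h + b : ℕ)) by ring,
        pt, pt, py, py, runT_eq hM hi0 hi1.le, runT_eq hM (by omega) (by omega)]
      exact G.step_aux hi0 hi1
  refine ⟨⟨L, ?_, G.zero, ?_, fun h => L.goodAt_zero_iff.1 h (Or.inl hE)⟩, hE⟩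
  · rw [runT_eq hM le_rfl (by omega)]
    unfold runLevel
    rw [if_pos (by omega), neg_zero]
  · intro i hi0 hi1
    unfold GoodAt
    rw [runT_eq hM hi0.le hi1.le, runT_eq hM (by omega) (by omega),
      runT_eq hM (by omega) (by omega)]
    constructor
    · intro k1 k2
      have hi : i = 2 * a + h := by
        unfold runLevel at k1 k2
        split_ifs at k1 k2 <;> omega
      have c1 := G.anti₃ 0 h0
      have c2 := G.anti₄ 0 h0
      have c3 := G.right 1 (by omega) (by omega)
      norm_num at c1 c2 c3
      rw [hi]
      omega
    · intro k1 k2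
      have hi : i = a ∨ i = 2 * a + 2 * h + b := by
        unfold runLevel at k1 k2
        split_ifs at k1 k2 <;> omega
      rcases hi with rfl | rfl
      · have c1 := G.anti₁ (a - 1) (by omega)
        have c2 := G.anti₂ (a - 1) (by omega)
        have c3 := G.low (a - 1) (by omega)
        dsimp only at c1 c2
        rw [Nat.sub_add_cancel a0] at c1 c2
        rw [Nat.cast_pred a0] at c1 c2 c3
        rw [show (2 * a - a : ℤ) = a by ring, show (2 * a - (a - 1) : ℤ) = a + 1 by ring] at c2
        rw [show (2 * a - (a - 1) : ℤ) = a + 1 by ring] at c3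
        omega
      · have c1 := G.anti₅ (b - 1) (by omega)
        have c2 := G.anti₆ (b - 1) (by omega)
        have c3 := G.hi (b - 1) (by omega)
        dsimp only at c1 c2
        rw [Nat.sub_add_cancel b0] at c1 c2
        rw [Nat.cast_pred b0] at c1 c2 c3
        rw [← G.per (-(b : ℤ)), ← G.per (-(b - 1 : ℤ)),
          show (-b + 2 * (a + h + b : ℕ) : ℤ) = 2 * a + 2 * h + b by push_cast; ring,
          show (-(b - 1) + 2 * (a + h + b : ℕ) : ℤ) = 2 * a + 2 * h + b + 1 by
            push_cast; ring] at c2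
        rw [← G.per (-(b - 1 : ℤ)), 
          show (-(b - 1) + 2 * (a + h + b : ℕ) : ℤ) = 2 * a + 2 * h + b + 1 by
            push_cast; ring] at c3
        rw [show (2 * a + 2 * h + (b - 1) : ℤ) = 2 * a + 2 * h + b - 1 by ring] at c1 c3
        omega

end Notch

set_option maxHeartbeats 1000000 in
/-- Every loop through the origin whose only bad turn is an exceptional turn at `0` arises from
four runs. -/
theorem Imperfect.exists_notch {N : ℕ} {t : ℤ → ℤ} (I : Imperfect (2 * N) t y) (hE : ExcAt t y) :
    ∃ a h b, a + h + b = N ∧ Notch a h b y ∧ t = runT a h b := by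
  obtain ⟨A, T, B, hA, hAT, hTB, hBM, D1, U1, D2, U2, hT⟩ := I.exists_fourRuns hE I.good
  have t0 := I.t_zero
  have tM := I.per_t 0
  have yM := I.per_y
  rw [zero_add] at tM
  have eA := D1 A hA.le le_rfl
  have eT := U1 T hAT.le le_rfl
  have eB := D2 B hTB.le le_rfl
  have eM := U2 (2 * N) hBM.le le_rfl
  obtain ⟨e1, e2, e3, e4⟩ := hE
  have stepU : ∀ p q i : ℤ, UpRun t p q → p ≤ i → i < q →
      (y (i + 1) = y i ∨ y (i + 1) = y i + 1) := by
    intro p q i hU h1 h2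
    have := hU i h1 h2.le
    have := hU (i + 1) (by omega) (by omega)
    have := I.step i
    omega
  have stepD : ∀ p q i : ℤ, DownRun t p q → p ≤ i → i < q →
      (y (i + 1) = y i ∨ y (i + 1) = y i - 1) := by
    intro p q i hU h1 h2
    have := hU i h1 h2.le
    have := hU (i + 1) (by omega) (by omega)
    have := I.step i
    omega
  obtain ⟨a, rfl⟩ := Int.eq_ofNat_of_zero_le hA.le
  obtain ⟨h, hh⟩ := Int.eq_ofNat_of_zero_le (show 0 ≤ T - 2 * a by omega)
  obtain ⟨b, hb⟩ := Int.eq_ofNat_of_zero_le (show 0 ≤ 2 * (N : ℤ) - B by omega)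
  obtain rfl : T = 2 * a + h := by omega
  obtain rfl : B = 2 * a + 2 * h + b := by omega
  obtain rfl : N = a + h + b := by omega
  refine ⟨a, h, b, rfl, ?_, ?_⟩
  · have gA := I.good a hA (by omega)
    have gT := I.good (2 * a + h) (by omega) (by omega)
    have gB := I.good (2 * a + 2 * h + b) (by omega) (by omega)
    have tl : ∀ i : ℤ, 0 ≤ i → i ≤ 2 * (a + h + b : ℕ) → t i = runLevel a h b i := by
      intro i h0 h1
      have d1 := D1 i
      have d2 := U1 i
      have d3 := D2 i
      have d4 := U2 i
      unfold runLevel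
      split_ifs <;> omega
    unfold GoodAt at gA gT gB
    rw [tl _ (by omega) (by omega), tl _ (by omega) (by omega), tl _ (by omega) (by omega)]
      at gA gT gB
    unfold runLevel at gA gT gB
    refine ⟨by omega, by omega, by omega, I.per_y, I.y_zero, ?_, ?_, ?_, ?_, ?_, ?_, ?_, ?_, ?_, ?_⟩
    · intro s hs
      have := stepD _ _ s D1 (by omega) (by omega)
      push_cast
      exact this
    · intro s hs
      have := stepU _ _ (2 * a - (s + 1)) U1 (by omega) (by omega)
      push_cast
      rw [show (2 * a - (s + 1) + 1 : ℤ) = 2 * a - s by ring] at this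
      omega
    · intro s hs
      have := stepU _ _ (2 * a + h - (s + 1)) U1 (by omega) (by omega)
      push_cast
      rw [show (2 * a + h - (s + 1) + 1 : ℤ) = 2 * a + h - s by ring] at this
      omega
    · intro s hs
      have := stepD _ _ (2 * a + h + s) D2 (by omega) (by omega)
      push_cast
      rw [← add_assoc]
      exact this
    · intro s hs
      have := stepD _ _ (2 * a + 2 * h + s) D2 (by omega) (by omega)
      push_cast
      rw [← add_assoc]
      exact this
    · intro s hs
      have := stepU _ _ (2 * (a + h + b : ℕ) - (s + 1)) U2 (by omega) (by omega)
      beta_reduce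
      rw [← yM (-((s + 1 : ℕ) : ℤ)), ← yM (-(s : ℤ)), neg_add_eq_sub, neg_add_eq_sub, Nat.cast_succ]
      rw [show (2 * (a + h + b : ℕ) - (s + 1) + 1 : ℤ) = 2 * (a + h + b : ℕ) - s by ring] at this
      omega
    · intro s hs hs'
      refine (I.cross_runs (p := 2 * a) (q := 2 * a + h - 1) (r := 2 * a + h + 1)
        (w := 2 * a + 2 * h) (Or.inl (U1.mono (by omega) (by omega)))
        (Or.inr (D2.mono (by omega) (by omega))) (by omega) (by omega) (i₀ := 2 * a + h - 1)
        (j₀ := 2 * a + h + 1) (by omega) (by omega) (by omega) (by omega) ?_ ?_).1 ?_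
      · rw [tl _ (by omega) (by omega), tl _ (by omega) (by omega)]
        unfold runLevel
        split_ifs <;> omega
      · rw [tl _ (by omega) (by omega), tl _ (by omega) (by omega)]
        unfold runLevel
        split_ifs <;> omega
      · split_ifs at gT <;> omega
    · intro s hs
      refine (I.cross_runs (p := 0) (q := a - 1) (r := a + 1)
        (w := 2 * a) (Or.inr (D1.mono (by omega) (by omega)))
        (Or.inl (U1.mono (by omega) (by omega))) (by omega) (by omega) (i₀ := a - 1)
        (j₀ := a + 1) (by omega) (by omega) (by omega) (by omega) ?_ ?_).2 ?_
      · rw [tl _ (by omega) (by omega), tl _ (by omega) (by omega)]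
        unfold runLevel
        split_ifs <;> omega
      · rw [tl _ (by omega) (by omega), tl _ (by omega) (by omega)]
        unfold runLevel
        split_ifs <;> omega
      · split_ifs at gA <;> omega
    · intro s hs
      rw [← yM (-(s : ℤ)), neg_add_eq_sub]
      refine (I.cross_runs (p := 2 * a + 2 * h) (q := 2 * a + 2 * h + b - 1)
        (r := 2 * a + 2 * h + b + 1)
        (w := 2 * (a + h + b : ℕ)) (Or.inr (D2.mono (by omega) (by omega)))
        (Or.inl (U2.mono (by omega) (by omega))) (by omega) (by omega)
        (i₀ := 2 * a + 2 * h + b - 1) (j₀ := 2 * a + 2 * h + b + 1) (by omega) (by omega)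
        (by omega) (by omega) ?_ ?_).2 ?_
      · rw [tl _ (by omega) (by omega), tl _ (by omega) (by omega)]
        unfold runLevel
        split_ifs <;> omega
      · rw [tl _ (by omega) (by omega), tl _ (by omega) (by omega)]
        unfold runLevel
        split_ifs <;> omega
      · split_ifs at gB <;> omega
    · intro s hs hs1 hs2
      rw [← yM (-(s : ℤ)), neg_add_eq_sub]
      refine (I.cross_runs (p := 1) (q := a) (r := 2 * a + 2 * h + b)
        (w := 2 * (a + h + b : ℕ) - 1) (Or.inr (D1.mono (by omega) (by omega)))
        (Or.inl (U2.mono (by omega) (by omega))) (by omega) (by omega)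
        (i₀ := 1) (j₀ := 2 * (a + h + b : ℕ) - 1) (by omega) (by omega)
        (by omega) (by omega) ?_ ?_).1 ?_
      · rw [tl _ (by omega) (by omega), tl _ (by omega) (by omega)]
        unfold runLevel
        split_ifs <;> omega
      · rw [tl _ (by omega) (by omega), tl _ (by omega) (by omega)]
        unfold runLevel
        split_ifs <;> omega
      · have := yM (-1)
        rw [neg_add_eq_sub] at this
        omega
  · funext i
    obtain ⟨i', k, hi0, hi1, rfl⟩ := exists_residue (M := 2 * (a + h + b : ℕ)) (by omega) i
    have pt := add_mul_of_periodic (runT_add (a := a) (h := h) (b := b))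
    rw [I.t_add_mul, pt, runT_eq (by omega) hi0 hi1.le]
    have d1 := D1 i'
    have d2 := U1 i'
    have d3 := D2 i'
    have d4 := U2 i'
    unfold runLevel
    split_ifs <;> omega

end

/-- The simultaneous moves of `f` and `g` during the first `k` steps. -/
def bits : (ℕ → ℤ) → (ℕ → ℤ) → ℕ → List (Bool × Bool)
  | _, _, 0 => []
  | f, g, k + 1 => (decide (f 0 ≠ f 1), decide (g 0 ≠ g 1)) ::
      bits (fun s => f (s + 1)) (fun s => g (s + 1)) k

theorem bits_succ (f g : ℕ → ℤ) (k : ℕ) : bits f g (k + 1) =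
    (decide (f 0 ≠ f 1), decide (g 0 ≠ g 1)) ::
      bits (fun s => f (s + 1)) (fun s => g (s + 1)) k := rfl

theorem Anti.tail {f : ℕ → ℤ} {k : ℕ} (h : Anti f (k + 1)) : Anti (fun s => f (s + 1)) k :=
  fun s hs => h (s + 1) (by omega)

theorem Anti.head {f : ℕ → ℤ} {k : ℕ} (h : Anti f (k + 1)) :
    f 0 - bz (decide (f 0 ≠ f 1)) = f 1 := by
  have := h 0 (by omega)
  rw [zero_add] at this
  unfold bz
  split_ifs with h1 <;> simp only [ne_eq, decide_eq_true_eq] at h1 <;> omega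

theorem bits_length (k : ℕ) : ∀ f g, (bits f g k).length = k := by
  induction k with
  | zero => intros; rfl
  | succ k ih => intro f g; simp [bits, ih]

theorem bits_congr (k : ℕ) : ∀ {f g f' g' : ℕ → ℤ}, (∀ s ≤ k, f s = f' s) → (∀ s ≤ k, g s = g' s) →
    bits f g k = bits f' g' k := by
  induction k with
  | zero => intros; rfl
  | succ k ih =>
    intro f g f' g' hf hg
    rw [bits_succ, bits_succ]
    rw [hf 0 (by omega), hf 1 (by omega), hg 0 (by omega), hg 1 (by omega),
      ih (fun s hs => hf (s + 1) (by omega)) (fun s hs => hg (s + 1) (by omega))]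

theorem bits_inj (k : ℕ) : ∀ {f g f' g' : ℕ → ℤ}, Anti f k → Anti g k → Anti f' k → Anti g' k →
    bits f g k = bits f' g' k →
    (f 0 = f' 0 → ∀ s ≤ k, f s = f' s) ∧ (g 0 = g' 0 → ∀ s ≤ k, g s = g' s) := by
  induction k with
  | zero =>
    intro f g f' g' _ _ _ _ _
    refine ⟨fun h s hs => ?_, fun h s hs => ?_⟩ <;> obtain rfl : s = 0 := by omega
    exacts [h, h]
  | succ k ih =>
    intro f g f' g' hf hg hf' hg' h
    rw [bits_succ, bits_succ] at h
    rw [List.cons.injEq, Prod.mk.injEq] at h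
    have := ih hf.tail hg.tail hf'.tail hg'.tail h.2
    have e1 := hf.head
    have e2 := hf'.head
    have e3 := hg.head
    have e4 := hg'.head
    rw [h.1.1] at e1
    rw [h.1.2] at e3
    refine ⟨fun h0 s hs => ?_, fun h0 s hs => ?_⟩
    · cases s with
      | zero => exact h0
      | succ s => exact this.1 (by rw [zero_add]; omega) s (by omega)
    · cases s with
      | zero => exact h0
      | succ s => exact this.2 (by rw [zero_add]; omega) s (by omega)

theorem valid2_bits (k : ℕ) : ∀ {f g : ℕ → ℤ}, Anti f k → Anti g k →
    (Valid2 (bits f g k) (f 0) (g 0) ↔ (∀ s < k, f s < g s) ∧ f k = g k) := by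
  induction k with
  | zero => intro f g _ _; simp [bits, Valid2]
  | succ k ih =>
    intro f g hf hg
    unfold bits Valid2
    rw [hf.head, hg.head, ih hf.tail hg.tail, Nat.forall_lt_succ_left]
    tauto

theorem valid4_bits (a : ℕ) : ∀ (b : ℕ) {L I J U : ℕ → ℤ}, Anti L a → Anti I a → Anti J b →
    Anti U b → (Valid4 (bits L I a) (bits J U b) (L 0) (I 0) (J 0) (U 0) ↔
      ((∀ s < a, L s < I s) ∧ L a = I a) ∧ ((∀ s < b, J s < U s) ∧ J b = U b) ∧
        ∀ s ≤ a, s ≤ b → I s < J s) := by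
  induction a with
  | zero =>
    intro b L I J U hL hI hJ hU
    have := valid2_bits b hJ hU
    have h0 : (∀ s ≤ 0, s ≤ b → I s < J s) ↔ I 0 < J 0 := by simp
    rw [h0]
    simp only [bits, Valid4, this, not_lt_zero, false_imp_iff, implies_true, true_and]
    tauto
  | succ a ih =>
    intro b L I J U hL hI hJ hU
    cases b with
    | zero =>
      have := valid2_bits (a + 1) hL hI
      have h0 : (∀ s ≤ a + 1, s ≤ 0 → I s < J s) ↔ I 0 < J 0 := by
        constructor
        · intro h; exact h 0 (by omega) le_rfl
        · intro h s _ hs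
          obtain rfl : s = 0 := by omega
          exact h
      rw [h0]
      have h1 : Valid4 (bits L I (a + 1)) (bits J U 0) (L 0) (I 0) (J 0) (U 0) ↔
          I 0 < J 0 ∧ J 0 = U 0 ∧ Valid2 (bits L I (a + 1)) (L 0) (I 0) := Iff.rfl
      rw [h1, this]
      simp only [not_lt_zero, false_imp_iff, implies_true, true_and]
      tauto
    | succ b =>
      have h0 : (∀ s ≤ a + 1, s ≤ b + 1 → I s < J s) ↔
          I 0 < J 0 ∧ ∀ s ≤ a, s ≤ b → I (s + 1) < J (s + 1) := by
        constructor
        · intro h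
          exact ⟨h 0 (by omega) (by omega), fun s h1 h2 => h (s + 1) (by omega) (by omega)⟩
        · rintro ⟨h, h'⟩ s h1 h2
          cases s with
          | zero => exact h
          | succ s => exact h' s (by omega) (by omega)
      rw [h0]
      unfold bits Valid4
      rw [hL.head, hI.head, hJ.head, hU.head, ih b hL.tail hI.tail hJ.tail hU.tail,
        Nat.forall_lt_succ_left, Nat.forall_lt_succ_left]
      tauto

theorem validE_bits (k : ℕ) (low hi : List (Bool × Bool)) : ∀ {f g : ℕ → ℤ}, Anti f k → Anti g k →
    (ValidE (bits f g k) low hi (f 0) (g 0) ↔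
      (∀ s < k, f s < g s) ∧ ValidE [] low hi (f k) (g k)) := by
  induction k with
  | zero => intro f g _ _; simp [bits]
  | succ k ih =>
    intro f g hf hg
    have h1 : ValidE (bits f g (k + 1)) low hi (f 0) (g 0) ↔ f 0 < g 0 ∧
        ValidE (bits (fun s => f (s + 1)) (fun s => g (s + 1)) k) low hi
          (f 0 - bz (decide (f 0 ≠ f 1))) (g 0 - bz (decide (g 0 ≠ g 1))) := Iff.rfl
    have h2 := ih hf.tail hg.tail
    rw [zero_add] at h2
    rw [h1, hf.head, hg.head, h2, Nat.forall_lt_succ_left, and_assoc]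

theorem validE_nil_bits (a b : ℕ) {L I J U : ℕ → ℤ} (hL : Anti L (a + 1)) (hI : Anti I (a + 1))
    (hJ : Anti J (b + 1)) (hU : Anti U (b + 1)) (hI0 : I 0 = 0) (hJ0 : J 0 = 0) :
    ValidE [] (bits L I (a + 1)) (bits J U (b + 1)) (L 0) (U 0) ↔
      ((∀ s < a + 1, L s < I s) ∧ L (a + 1) = I (a + 1)) ∧
      ((∀ s < b + 1, J s < U s) ∧ J (b + 1) = U (b + 1)) ∧
        ∀ s, 0 < s → s ≤ a + 1 → s ≤ b + 1 → I s < J s := by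
  have h0 : (∀ s, 0 < s → s ≤ a + 1 → s ≤ b + 1 → I s < J s) ↔
      ∀ s ≤ a, s ≤ b → I (s + 1) < J (s + 1) := by
    constructor
    · intro h s h1 h2
      exact h (s + 1) (by omega) (by omega) (by omega)
    · rintro h s h1 h2 h3
      cases s with
      | zero => omega
      | succ s => exact h s (by omega) (by omega)
  have h4 := valid4_bits a b hL.tail hI.tail hJ.tail hU.tail
  simp only [zero_add] at h4
  have s1 := hI 0 (by omega)
  have s2 := hJ 0 (by omega)
  rw [zero_add] at s1 s2
  rw [h0, Nat.forall_lt_succ_left, Nat.forall_lt_succ_left (n := b), hI0, hJ0]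
  constructor
  · rintro ⟨h1, h2, c, c', low', hi', e1, e2, h3⟩
    rw [bits_succ] at e1 e2
    simp only [List.cons.injEq, Prod.mk.injEq, decide_eq_true_eq, decide_eq_false_iff_not,
      not_not] at e1 e2
    obtain ⟨⟨e11, e12⟩, rfl⟩ := e1
    obtain ⟨⟨e21, e22⟩, rfl⟩ := e2
    rw [← e11, ← e22, hL.head, hU.head, show (-1 : ℤ) = I 1 by omega,
      show (0 : ℤ) = J 1 by omega, h4] at h3
    tauto
  · intro h
    have h5 := h.2.2 0 (by omega) (by omega)
    rw [zero_add] at h5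
    refine ⟨h.1.1.1, h.2.1.1.1, decide (L 0 ≠ L 1), decide (U 0 ≠ U 1),
      bits (fun s => L (s + 1)) (fun s => I (s + 1)) a,
      bits (fun s => J (s + 1)) (fun s => U (s + 1)) b, ?_, ?_, ?_⟩
    · rw [bits_succ]
      simp only [List.cons.injEq, Prod.mk.injEq, decide_eq_true_eq, true_and, and_true]
      omega
    · rw [bits_succ]
      simp only [List.cons.injEq, Prod.mk.injEq, decide_eq_false_iff_not, and_true]
      omega
    · rw [hL.head, hU.head, show (-1 : ℤ) = I 1 by omega,
        show (0 : ℤ) = J 1 by omega, h4]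
      tauto

theorem lw_bits (k : ℕ) : ∀ {f g : ℕ → ℤ}, Anti f k → Anti g k →
    ((lw (bits f g k)).1 : ℤ) = f 0 - f k + (g 0 - g k) ∧ (lw (bits f g k)).2 = k := by
  induction k with
  | zero => intro f g _ _; simp [bits, lw]
  | succ k ih =>
    intro f g hf hg
    have := ih hf.tail hg.tail
    have e1 := hf.head
    have e2 := hg.head
    rw [bz_eq_toNat] at e1 e2
    rw [bits, lw_cons, Prod.fst_add, Prod.snd_add, this.2]
    push_cast
    refine ⟨?_, rfl⟩
    rw [this.1]
    simp only [zero_add]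
    omega

/-- The path starting at `c` which follows the moves in a list. -/
def desc (c : ℤ) : List Bool → ℕ → ℤ
  | [], _ => c
  | _ :: _, 0 => c
  | b :: L, s + 1 => desc (c - bz b) L s

theorem desc_zero (c : ℤ) (L : List Bool) : desc c L 0 = c := by cases L <;> rfl

theorem anti_desc (L : List Bool) : ∀ c k, Anti (desc c L) k := by
  induction L with
  | nil => intro c k s _; exact Or.inl rfl
  | cons b L ih =>
    intro c k s hs
    cases s with
    | zero =>
      rw [zero_add, desc, desc, desc_zero]
      cases b <;> simp [bz]
    | succ s => exact ih (c - bz b) (s + 1) s (by omega)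

theorem bits_desc (L : List (Bool × Bool)) : ∀ c d,
    bits (desc c (L.map Prod.fst)) (desc d (L.map Prod.snd)) L.length = L := by
  induction L with
  | nil => intros; rfl
  | cons b L ih =>
    intro c d
    have := ih (c - bz b.1) (d - bz b.2)
    rw [List.length_cons, bits]
    simp only [List.map_cons, desc, desc_zero]
    rw [this, List.cons.injEq]
    refine ⟨?_, rfl⟩
    obtain ⟨b1, b2⟩ := b
    cases b1 <;> cases b2 <;> simp [bz] <;> omega

theorem validE_bits_iff {a b k : ℕ} {I L P Q U J : ℕ → ℤ} {H : ℤ} (hI : Anti I (a + 1))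
    (hL : Anti L (a + 1)) (hP : Anti P (k + 1)) (hQ : Anti Q (k + 1)) (hU : Anti U (b + 1))
    (hJ : Anti J (b + 1)) (eI : I 0 = 0) (eJ : J 0 = 0) (eP : P 0 = H) (eQ : Q 0 = H)
    (eL : P (k + 1) = L 0) (eU : Q (k + 1) = U 0) :
    (P 1 = H - 1 ∧ Q 1 = H) ∧
      ValidE (bits (fun s => P (s + 1)) (fun s => Q (s + 1)) k) (bits L I (a + 1))
        (bits J U (b + 1)) (H - 1) H ↔
    (∀ s, 0 < s → s ≤ k + 1 → P s < Q s) ∧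
      ((∀ s < a + 1, L s < I s) ∧ L (a + 1) = I (a + 1)) ∧
      ((∀ s < b + 1, J s < U s) ∧ J (b + 1) = U (b + 1)) ∧
        ∀ s, 0 < s → s ≤ a + 1 → s ≤ b + 1 → I s < J s := by
  have h1 := validE_bits k (bits L I (a + 1)) (bits J U (b + 1)) hP.tail hQ.tail
  rw [zero_add, eL, eU, validE_nil_bits a b hL hI hJ hU eI eJ] at h1
  have sP := hP 0 (by omega)
  have sQ := hQ 0 (by omega)
  rw [zero_add] at sP sQ
  constructor
  · rintro ⟨⟨h2, h3⟩, h4⟩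
    rw [← h2] at h4
    obtain ⟨h5, h6⟩ := h1.1 (by rw [h3]; exact h4)
    refine ⟨fun s hs1 hs2 => ?_, h6⟩
    rcases Nat.lt_or_ge k s with h7 | h7
    · obtain rfl : s = k + 1 := by omega
      have := h6.1.1 0 (by omega)
      have := h6.2.1.1 0 (by omega)
      omega
    · have := h5 (s - 1) (by omega)
      rwa [Nat.sub_add_cancel hs1] at this
  · rintro ⟨h5, h6⟩
    have h7 := h5 1 (by omega) (by omega)
    have h8 : P 1 = H - 1 ∧ Q 1 = H := by omega
    refine ⟨h8, ?_⟩
    rw [h8.1, h8.2] at h1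
    exact h1.2 ⟨fun s hs => h5 (s + 1) (by omega) (by omega), h6⟩

/-- Six paths with matching ends can be glued to a closed one. -/
theorem exists_glue {a h b : ℕ} (ha : 0 < a) (hh : 0 < h) (hb : 0 < b)
    {I L P Q U J : ℕ → ℤ} (e1 : I a = L a) (e2 : L 0 = P h) (e3 : P 0 = Q 0)
    (e4 : Q h = U 0) (e5 : U b = J b) (e6 : J 0 = I 0) :
    ∃ y : ℤ → ℤ, (∀ i, y (i + 2 * (a + h + b : ℕ)) = y i) ∧ (∀ s ≤ a, y s = I s) ∧
      (∀ s ≤ a, y (2 * a - s) = L s) ∧ (∀ s ≤ h, y (2 * a + h - s) = P s) ∧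
      (∀ s ≤ h, y (2 * a + h + s) = Q s) ∧ (∀ s ≤ b, y (2 * a + 2 * h + s) = U s) ∧
      (∀ s ≤ b, y (-s) = J s) := by
  set g : ℤ → ℤ := fun i => if i ≤ a then I i.toNat else if i ≤ 2 * a then L (2 * a - i).toNat
    else if i ≤ 2 * a + h then P (2 * a + h - i).toNat
    else if i ≤ 2 * a + 2 * h then Q (i - 2 * a - h).toNat
    else if i ≤ 2 * a + 2 * h + b then U (i - 2 * a - 2 * h).toNat
    else J (2 * (a + h + b : ℕ) - i).toNat with hg
  set y : ℤ → ℤ := fun i => g (i % (2 * (a + h + b : ℕ))) with hy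
  have per : ∀ i, y (i + 2 * (a + h + b : ℕ)) = y i := fun i => by simp [hy]
  have key : ∀ i : ℤ, 0 ≤ i → i < 2 * (a + h + b : ℕ) → y i = g i := by
    intro i h0 h1
    simp only [hy]
    rw [Int.emod_eq_of_lt h0 h1]
  refine ⟨y, per, ?_, ?_, ?_, ?_, ?_, ?_⟩
  · intro s hs
    rw [key _ (by omega) (by omega)]
    simp only [hg]
    rw [if_pos (by omega), Int.toNat_natCast]
  · intro s hs
    rw [key _ (by omega) (by omega)]
    simp only [hg]
    rcases eq_or_lt_of_le hs with rfl | hs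
    · rw [if_pos (by omega), ← e1]
      congr 1; omega
    · rw [if_neg (by omega), if_pos (by omega)]
      congr 1; omega
  · intro s hs
    rw [key _ (by omega) (by omega)]
    simp only [hg]
    rcases eq_or_lt_of_le hs with rfl | hs
    · rw [if_neg (by omega), if_pos (by omega), ← e2]
      congr 1; omega
    · rw [if_neg (by omega), if_neg (by omega), if_pos (by omega)]
      congr 1; omega
  · intro s hs
    rw [key _ (by omega) (by omega)]
    simp only [hg]
    rcases Nat.eq_zero_or_pos s with rfl | hs'
    · rw [← e3, if_neg (by omega), if_neg (by omega), if_pos (by omega)]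
      congr 1; omega
    · rw [if_neg (by omega), if_neg (by omega), if_neg (by omega), if_pos (by omega)]
      congr 1; omega
  · intro s hs
    rw [key _ (by omega) (by omega)]
    simp only [hg]
    rcases Nat.eq_zero_or_pos s with rfl | hs'
    · rw [← e4, if_neg (by omega), if_neg (by omega), if_neg (by omega), if_pos (by omega)]
      congr 1; omega
    · rw [if_neg (by omega), if_neg (by omega), if_neg (by omega), if_neg (by omega),
        if_pos (by omega)]
      congr 1; omega
  · intro s hs
    rcases Nat.eq_zero_or_pos s with rfl | hs'
    · rw [Nat.cast_zero, neg_zero, key _ (by omega) (by omega), e6]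
      simp only [hg]
      rw [if_pos (by omega), Int.toNat_zero]
    · rw [← per, key _ (by omega) (by omega)]
      simp only [hg]
      rcases eq_or_lt_of_le hs with rfl | hs
      · rw [← e5, if_neg (by omega), if_neg (by omega), if_neg (by omega), if_neg (by omega),
          if_pos (by omega)]
        congr 1; omega
      · rw [if_neg (by omega), if_neg (by omega), if_neg (by omega), if_neg (by omega),
          if_neg (by omega)]
        congr 1; omega

theorem vsteps_add {c : ℤ} (hc : c = 1 ∨ c = -1) (y : ℤ → ℤ) (p k : ℕ)
    (h : ∀ i : ℤ, p ≤ i → i < p + k → y (i + 1) = y i ∨ y (i + 1) = y i + c) :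
    (vsteps (p + k) y : ℤ) = vsteps p y + c * (y (p + k) - y p) := by
  induction k with
  | zero => simp
  | succ k ih =>
    have e := ih fun i h1 h2 => h i h1 (by push_cast; omega)
    have s := h (p + k) (by omega) (by push_cast; omega)
    have e2 : vsteps (p + (k + 1)) y =
        vsteps (p + k) y + if y (((p + k : ℕ) : ℤ) + 1) ≠ y (p + k : ℕ) then 1 else 0 := by
      unfold vsteps
      rw [← add_assoc, Finset.range_add_one, Finset.filter_insert]
      split_ifs
      · rw [Finset.card_insert_of_notMem (by simp)]
      · rfl
    rw [e2]
    push_cast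
    rw [e, ← add_assoc]
    rcases hc with rfl | rfl <;> split_ifs <;> simp_all <;> omega

section

variable {a h b : ℕ} {y : ℤ → ℤ}

theorem Notch.vsteps_eq (G : Notch a h b y) :
    (vsteps (2 * (a + h + b)) y : ℤ) = 2 * (y (2 * a + h) - y a - y (-b)) := by
  have v1 := vsteps_add (c := -1) (Or.inr rfl) y 0 a (by
    intro i h1 h2
    have := G.step_aux (i := i) (by omega) (by omega)
    unfold runLevel at this
    split_ifs at this <;> omega)
  have v2 := vsteps_add (c := 1) (Or.inl rfl) y (0 + a) (a + h) (by
    intro i h1 h2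
    have := G.step_aux (i := i) (by omega) (by omega)
    unfold runLevel at this
    split_ifs at this <;> omega)
  have v3 := vsteps_add (c := -1) (Or.inr rfl) y (0 + a + (a + h)) (h + b) (by
    intro i h1 h2
    have := G.step_aux (i := i) (by omega) (by omega)
    unfold runLevel at this
    split_ifs at this <;> omega)
  have v4 := vsteps_add (c := 1) (Or.inl rfl) y (0 + a + (a + h) + (h + b)) b (by
    intro i h1 h2
    have := G.step_aux (i := i) (by omega) (by omega)
    unfold runLevel at this
    split_ifs at this <;> omega)
  rw [v3, v2, v1, show 0 + a + (a + h) + (h + b) + b = 2 * (a + h + b) by ring] at v4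
  have p1 := G.per 0
  have p2 := G.per (-b)
  have z := G.zero
  have v0 : vsteps 0 y = 0 := rfl
  rw [show (0 : ℤ) + 2 * (a + h + b : ℕ) = 2 * a + 2 * h + 2 * b by push_cast; ring] at p1
  rw [show -(b : ℤ) + 2 * (a + h + b : ℕ) = 2 * a + 2 * h + b by push_cast; ring] at p2
  rw [v4, v0]
  push_cast
  rw [show (0 : ℤ) + a + (a + h) + (h + b) + b = 2 * a + 2 * h + 2 * b by ring,
    show (0 : ℤ) + a + (a + h) + (h + b) = 2 * a + 2 * h + b by ring,
    show (0 : ℤ) + a + (a + h) = 2 * a + h by ring, zero_add, p1, p2, z]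
  simp only [zero_add]
  ring

/-- The list encoding of a loop made of four runs. -/
def notchData (a h b : ℕ) (y : ℤ → ℤ) :
    ℤ × List (Bool × Bool) × List (Bool × Bool) × List (Bool × Bool) :=
  (y (2 * a + h), bits (fun s => y (2 * a + h - (s + 1 : ℕ))) (fun s => y (2 * a + h + (s + 1 : ℕ)))
    (h - 1), bits (fun s => y (2 * a - s)) (fun s => y s) a,
    bits (fun s => y (-s)) (fun s => y (2 * a + 2 * h + s)) b)

/-- The list encodings of the loops of length `2 * N` made of four runs, with an exceptional turn
at the index `0` and with `2 * n` vertical steps. -/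
def notchLists (N n : ℕ) :
    Set (ℤ × List (Bool × Bool) × List (Bool × Bool) × List (Bool × Bool)) :=
  {d | ValidE d.2.1 d.2.2.1 d.2.2.2 (d.1 - 1) d.1 ∧
    lw d.2.1 + (lw d.2.2.1 + lw d.2.2.2) = (2 * n - 1, N - 1)}

theorem Notch.validE (G : Notch a h b y) :
    (y (2 * a + h - 1) = y (2 * a + h) - 1 ∧ y (2 * a + h + 1) = y (2 * a + h)) ∧
    ValidE (notchData a h b y).2.1 (notchData a h b y).2.2.1 (notchData a h b y).2.2.2
      ((notchData a h b y).1 - 1) (notchData a h b y).1 := by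
  obtain ⟨a, rfl⟩ := Nat.exists_eq_add_one.2 G.a_pos
  obtain ⟨h, rfl⟩ := Nat.exists_eq_add_one.2 G.h_pos
  obtain ⟨b, rfl⟩ := Nat.exists_eq_add_one.2 G.b_pos
  have := (validE_bits_iff (H := y (2 * (a + 1 : ℕ) + (h + 1 : ℕ))) G.anti₁ G.anti₂ G.anti₃ G.anti₄
    G.anti₅ G.anti₆ (by simpa using G.zero) (by simpa using G.zero) (by simp) (by simp)
    (congrArg y (by push_cast; ring)) (congrArg y (by push_cast; ring))).2 ⟨G.right, ⟨G.low, by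
      exact congrArg y (by push_cast; ring)⟩, ⟨G.hi, ?_⟩, G.mid⟩
  · rw [Nat.cast_one] at this
    exact this
  · rw [← G.per]; congr 1; push_cast; ring

theorem Notch.lw_eq (G : Notch a h b y) {n : ℕ} (hn : 0 < n) :
    lw (notchData a h b y).2.1 + (lw (notchData a h b y).2.2.1 + lw (notchData a h b y).2.2.2) =
      (2 * n - 1, a + h + b - 1) ↔ vsteps (2 * (a + h + b)) y = 2 * n := by
  have hv := G.vsteps_eq
  have ht := G.validE.1
  have a0 := G.a_pos
  have h0 := G.h_pos
  have b0 := G.b_pos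
  have z := G.zero
  obtain ⟨k, rfl⟩ := Nat.exists_eq_add_one.2 h0
  have w1 := lw_bits k G.anti₃.tail G.anti₄.tail
  have w2 := lw_bits a G.anti₂ G.anti₁
  have w3 := lw_bits b G.anti₆ G.anti₅
  have p2 := G.per (-b)
  rw [show -(b : ℤ) + 2 * (a + (k + 1) + b : ℕ) = 2 * a + 2 * (k + 1 : ℕ) + b by
    push_cast; ring] at p2
  simp only [zero_add, Nat.cast_one, Nat.cast_zero, sub_zero, add_zero, neg_zero, z] at w1 w2 w3
  rw [show (2 * a + (k + 1 : ℕ) - (k + 1 : ℕ) : ℤ) = 2 * a by ring,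
    show (2 * a + (k + 1 : ℕ) + (k + 1 : ℕ) : ℤ) = 2 * a + 2 * (k + 1 : ℕ) by ring] at w1
  rw [show (2 * a - a : ℤ) = a by ring] at w2
  rw [Prod.ext_iff, Prod.fst_add, Prod.fst_add, Prod.snd_add, Prod.snd_add]
  unfold notchData
  dsimp only
  rw [Nat.add_sub_cancel, w1.2, w2.2, w3.2]
  have w1' := w1.1
  have w2' := w2.1
  have w3' := w3.1
  clear w1 w2 w3
  omega

end

theorem Notch.data_inj {a h b a' h' b' : ℕ} {y y' : ℤ → ℤ} (G : Notch a h b y)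
    (G' : Notch a' h' b' y') (e : notchData a h b y = notchData a' h' b' y') :
    a = a' ∧ h = h' ∧ b = b' ∧ y = y' := by
  unfold notchData at e
  simp only [Prod.mk.injEq] at e
  obtain ⟨e1, e2, e3, e4⟩ := e
  have l2 := congrArg List.length e2
  have l3 := congrArg List.length e3
  have l4 := congrArg List.length e4
  rw [bits_length, bits_length] at l2 l3 l4
  subst l3 l4
  have h0 := G.h_pos
  have h0' := G'.h_pos
  have a0 := G.a_pos
  obtain rfl : h = h' := by omega
  refine ⟨rfl, rfl, rfl, ?_⟩
  have t := G.validE.1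
  have t' := G'.validE.1
  obtain ⟨k, rfl⟩ := Nat.exists_eq_add_one.2 h0
  rw [Nat.add_sub_cancel] at e2
  have i2 := bits_inj k G.anti₃.tail G.anti₄.tail G'.anti₃.tail G'.anti₄.tail e2
  have i3 := bits_inj a G.anti₂ G.anti₁ G'.anti₂ G'.anti₁ e3
  have i4 := bits_inj b G.anti₆ G.anti₅ G'.anti₆ G'.anti₅ e4
  simp only [zero_add, Nat.cast_one, Nat.cast_zero, sub_zero, add_zero, neg_zero, G.zero, G'.zero]
    at i2 i3 i4
  have q1 := i2.1 (by omega)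
  have q2 := i2.2 (by omega)
  have q1k := q1 k le_rfl
  have q2k := q2 k le_rfl
  rw [show (2 * a + (k + 1 : ℕ) - (k + 1 : ℕ) : ℤ) = 2 * a by ring] at q1k
  rw [show (2 * a + (k + 1 : ℕ) + (k + 1 : ℕ) : ℤ) = 2 * a + 2 * (k + 1 : ℕ) by ring] at q2k
  have q3 := i3.1 q1k
  have q4 := i3.2 trivial
  have q5 := i4.1 trivial
  have q6 := i4.2 q2k
  funext i
  obtain ⟨j, c, j0, j1, rfl⟩ := exists_residue (M := 2 * (a + (k + 1) + b : ℕ)) (by omega) i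
  rw [add_mul_of_periodic G.per, add_mul_of_periodic G'.per]
  by_cases c1 : j ≤ a
  · convert q4 j.toNat (by omega) using 2 <;> omega
  by_cases c2 : j ≤ 2 * a
  · convert q3 (2 * a - j).toNat (by omega) using 2 <;> omega
  by_cases c3 : j < 2 * a + (k + 1)
  · convert q1 (2 * a + (k + 1) - j - 1).toNat (by omega) using 2 <;> omega
  by_cases c4 : j = 2 * a + (k + 1)
  · subst c4
    exact_mod_cast e1
  by_cases c5 : j ≤ 2 * a + 2 * (k + 1)
  · convert q2 (j - (2 * a + (k + 1)) - 1).toNat (by omega) using 2 <;> omega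
  by_cases c6 : j ≤ 2 * a + 2 * (k + 1) + b
  · convert q6 (j - (2 * a + 2 * (k + 1))).toNat (by omega) using 2 <;> omega
  · rw [show j = (j - 2 * (a + (k + 1) + b : ℕ)) + 2 * (a + (k + 1) + b : ℕ) by ring, G.per, G'.per]
    convert q5 (2 * (a + (k + 1) + b) - j).toNat (by omega) using 2 <;> push_cast <;> omega

theorem exists_notch_of_mem {N n : ℕ} (hN : 0 < N) (hn : 0 < n)
    {d : ℤ × List (Bool × Bool) × List (Bool × Bool) × List (Bool × Bool)}
    (hd : d ∈ notchLists N n) : ∃ a h b y, a + h + b = N ∧ Notch a h b y ∧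
      vsteps (2 * N) y = 2 * n ∧ notchData a h b y = d := by
  obtain ⟨H, rl, low, hi⟩ := d
  obtain ⟨hv, hl⟩ := hd
  dsimp only at hv hl
  have hne : low ≠ [] ∧ hi ≠ [] := by
    have := (validE_bits rl.length low hi (anti_desc (rl.map Prod.fst) (H - 1) _)
      (anti_desc (rl.map Prod.snd) H _)).1 (by
        rw [bits_desc, desc_zero, desc_zero]; exact hv)
    obtain ⟨-, -, -, c, c', low', hi', rfl, rfl, -⟩ := this
    simp
  obtain ⟨a, ha⟩ := Nat.exists_eq_add_one.2 (List.length_pos_iff.2 hne.1)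
  obtain ⟨b, hb⟩ := Nat.exists_eq_add_one.2 (List.length_pos_iff.2 hne.2)
  set k := rl.length with hk
  set P := desc H (((true, false) :: rl).map Prod.fst) with hP
  set Q := desc H (((true, false) :: rl).map Prod.snd) with hQ
  set L := desc (P (k + 1)) (low.map Prod.fst) with hL
  set I := desc 0 (low.map Prod.snd) with hI
  set J := desc 0 (hi.map Prod.fst) with hJ
  set U := desc (Q (k + 1)) (hi.map Prod.snd) with hU
  have bL : bits L I (a + 1) = low := by rw [← ha]; exact bits_desc _ _ _
  have bU : bits J U (b + 1) = hi := by rw [← hb]; exact bits_desc _ _ _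
  have eP : (fun s => P (s + 1)) = desc (H - 1) (rl.map Prod.fst) := by
    funext s; simp [hP, desc, bz]
  have eQ : (fun s => Q (s + 1)) = desc H (rl.map Prod.snd) := by
    funext s; simp [hQ, desc, bz]
  have bP : bits (fun s => P (s + 1)) (fun s => Q (s + 1)) k = rl := by
    rw [eP, eQ]; exact bits_desc _ _ _
  have P1 : P 1 = H - 1 := by rw [← desc_zero (H - 1) (rl.map Prod.fst), ← eP]
  have Q1 : Q 1 = H := by
    have := desc_zero H (rl.map Prod.snd)
    rwa [← eQ] at this
  have key := (validE_bits_iff (a := a) (b := b) (k := k) (H := H) (anti_desc _ _ _ : Anti I _)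
    (anti_desc _ _ _ : Anti L _) (anti_desc _ _ _ : Anti P _) (anti_desc _ _ _ : Anti Q _)
    (anti_desc _ _ _ : Anti U _) (anti_desc _ _ _ : Anti J _) (desc_zero _ _) (desc_zero _ _)
    (desc_zero _ _) (desc_zero _ _) (desc_zero _ _).symm (desc_zero _ _).symm).1 (by
      rw [bL, bU, bP]; exact ⟨⟨P1, Q1⟩, hv⟩)
  obtain ⟨k1, ⟨k2, k3⟩, ⟨k4, k5⟩, k6⟩ := key
  obtain ⟨y, per, yI, yL, yP, yQ, yU, yJ⟩ := exists_glue (a := a + 1) (h := k + 1) (b := b + 1)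
    (by omega) (by omega) (by omega) (I := I) (L := L) (P := P) (Q := Q) (U := U) (J := J)
    k3.symm (desc_zero _ _) ((desc_zero _ _).trans (desc_zero _ _).symm) (desc_zero _ _).symm
    k5.symm ((desc_zero _ _).trans (desc_zero _ _).symm)
  have anti : ∀ {f g : ℕ → ℤ} {m : ℕ}, (∀ s ≤ m, f s = g s) → Anti g m → Anti f m := by
    intro f g m h hg s hs
    rw [h s (by omega), h (s + 1) (by omega)]
    exact hg s hs
  have G : Notch (a + 1) (k + 1) (b + 1) y :=
    { a_pos := by omega
      h_pos := by omega
      b_pos := by omega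
      per := per
      zero := by simpa using (yI 0 (by omega)).trans (desc_zero _ _)
      anti₁ := anti yI (anti_desc _ _ _)
      anti₂ := anti yL (anti_desc _ _ _)
      anti₃ := anti yP (anti_desc _ _ _)
      anti₄ := anti yQ (anti_desc _ _ _)
      anti₅ := anti yU (anti_desc _ _ _)
      anti₆ := anti yJ (anti_desc _ _ _)
      right := fun s h1 h2 => by rw [yP s h2, yQ s h2]; exact k1 s h1 h2
      low := fun s h1 => by rw [yL s h1.le, yI s h1.le]; exact k2 s h1
      hi := fun s h1 => by rw [yJ s h1.le, yU s h1.le]; exact k4 s h1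
      mid := fun s h1 h2 h3 => by rw [yI s h2, yJ s h3]; exact k6 s h1 h2 h3 }
  have hdata : notchData (a + 1) (k + 1) (b + 1) y = (H, rl, low, hi) := by
    unfold notchData
    rw [Prod.mk.injEq, Prod.mk.injEq, Prod.mk.injEq]
    refine ⟨?_, ?_, ?_, ?_⟩
    · have := (yP 0 (by omega)).trans (desc_zero _ _)
      simpa using this
    · rw [Nat.add_sub_cancel]
      refine (bits_congr k (fun s hs => yP (s + 1) (by omega))
        (fun s hs => yQ (s + 1) (by omega))).trans bP
    · exact (bits_congr _ yL yI).trans bL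
    · exact (bits_congr _ yJ yU).trans bU
  have w1 := lw_bits k (anti_desc (rl.map Prod.fst) 0 k) (anti_desc (rl.map Prod.snd) 0 k)
  have w2 := lw_bits (a + 1) (anti_desc _ _ _ : Anti L _) (anti_desc _ _ _ : Anti I _)
  have w3 := lw_bits (b + 1) (anti_desc _ _ _ : Anti J _) (anti_desc _ _ _ : Anti U _)
  rw [hk, bits_desc, ← hk] at w1
  rw [bL] at w2
  rw [bU] at w3
  have hsum : a + 1 + (k + 1) + (b + 1) = N := by
    have := congrArg Prod.snd hl
    rw [Prod.snd_add, Prod.snd_add, w1.2, w2.2, w3.2] at this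
    dsimp only at this
    omega
  have hvs := G.lw_eq hn
  rw [hdata, hsum] at hvs
  exact ⟨_, _, _, y, hsum, G, hvs.1 hl, hdata⟩

theorem runT_inj {a h b a' h' b' : ℕ} (h0 : 0 < h) (h0' : 0 < h') (b0 : 0 < b) (b0' : 0 < b')
    (e : a + h + b = a' + h' + b') (et : runT a h b = runT a' h' b') :
    a = a' ∧ h = h' ∧ b = b' := by
  have ev : ∀ i : ℤ, 0 ≤ i → i ≤ 2 * (a + h + b : ℕ) → runLevel a h b i = runLevel a' h' b' i := by
    intro i i0 i1
    rw [← runT_eq (by omega) i0 i1, ← runT_eq (by omega) i0 (by omega), et]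
  have ha : a = a' := by
    rcases lt_trichotomy a a' with c | c | c
    · have e1 := ev (a + 1) (by omega) (by omega)
      unfold runLevel at e1
      rw [if_neg (by omega), if_pos (by omega), if_pos (by omega)] at e1
      omega
    · exact c
    · have e1 := ev (a' + 1) (by omega) (by omega)
      unfold runLevel at e1
      rw [if_pos (by omega), if_neg (by omega), if_pos (by omega)] at e1
      omega
  subst ha
  rcases lt_trichotomy h h' with c | c | c
  · have e1 := ev (2 * a + h + 1) (by omega) (by omega)
    unfold runLevel at e1
    rw [if_neg (by omega), if_neg (by omega), if_pos (by omega), if_neg (by omega),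
      if_pos (by omega)] at e1
    omega
  · omega
  · have e1 := ev (2 * a + h' + 1) (by omega) (by omega)
    unfold runLevel at e1
    rw [if_neg (by omega), if_pos (by omega), if_neg (by omega), if_neg (by omega),
      if_pos (by omega)] at e1
    omega

theorem ValidE.bounds (low hi : List (Bool × Bool)) : ∀ (rl : List (Bool × Bool)) {l u : ℤ},
    ValidE rl low hi l u → 0 < u ∧ l < (lw rl).1 := by
  intro rl
  induction rl with
  | nil => rintro l u ⟨h1, h2, -⟩; exact ⟨h2, h1⟩
  | cons c rl ih =>
    rintro l u ⟨-, h⟩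
    have := ih h
    have := bz_nonneg c.2
    have := bz_eq_toNat c.1
    rw [lw_cons, Prod.fst_add]
    push_cast
    omega

theorem mem_Icc_of_mem_notchLists {N n : ℕ}
    {d : ℤ × List (Bool × Bool) × List (Bool × Bool) × List (Bool × Bool)}
    (hd : d ∈ notchLists N n) : d.1 ∈ Set.Icc (0 : ℤ) (2 * n) := by
  have h1 := ValidE.bounds _ _ _ hd.1
  have h2 := congrArg Prod.fst hd.2
  rw [Prod.fst_add, Prod.fst_add] at h2
  dsimp only at h2
  constructor <;> omega

theorem finite_notchLists (N n : ℕ) : (notchLists N n).Finite :=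
  ((Set.finite_Icc (0 : ℤ) (2 * n)).prod (finite_lw3 (2 * n - 1, N - 1))).subset
    fun _ hd => ⟨mem_Icc_of_mem_notchLists hd, hd.2⟩

theorem exists_bijOn_notchLists {N n : ℕ} (hN : 0 < N) (hn : 0 < n) :
    ∃ f, Set.BijOn f {p : (ℤ → ℤ) × (ℤ → ℤ) | (Imperfect (2 * N) p.1 p.2 ∧ ExcAt p.1 p.2) ∧
      vsteps (2 * N) p.2 = 2 * n} (notchLists N n) := by
  have : ∀ p : (ℤ → ℤ) × (ℤ → ℤ), Imperfect (2 * N) p.1 p.2 ∧ ExcAt p.1 p.2 →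
      ∃ a h b, a + h + b = N ∧ Notch a h b p.2 ∧ p.1 = runT a h b := fun p hp =>
    hp.1.exists_notch hp.2
  choose! a h b hs hG ht using this
  refine ⟨fun p => notchData (a p) (h p) (b p) p.2, ?_, ?_, ?_⟩
  · rintro p ⟨hp, hv⟩
    refine ⟨(hG p hp).validE.2, ?_⟩
    rw [← hs p hp] at hv ⊢
    exact ((hG p hp).lw_eq hn).2 hv
  · rintro p ⟨hp, -⟩ q ⟨hq, -⟩ e
    obtain ⟨e1, e2, e3, e4⟩ := (hG p hp).data_inj (hG q hq) e
    refine Prod.ext ?_ e4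
    rw [ht p hp, ht q hq, e1, e2, e3]
  · intro d hd
    obtain ⟨a', h', b', y, rfl, G, hv, rfl⟩ := exists_notch_of_mem hN hn hd
    have hp := G.imperfect
    refine ⟨(runT a' h' b', y), ⟨hp, hv⟩, ?_⟩
    have G' := hG (runT a' h' b', y) hp
    obtain ⟨e1, e2, e3⟩ := runT_inj G.h_pos G'.h_pos G.b_pos G'.b_pos
      (hs (runT a' h' b', y) hp).symm (ht (runT a' h' b', y) hp)
    dsimp only
    rw [← e1, ← e2, ← e3]

theorem imperfectCountAniso_eq_two_mul_notchLists {m n : ℕ} (hn : 2 ≤ n) :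
    imperfectCountAniso m n = 2 * (notchLists (m + n) n).ncard := by
  obtain ⟨f, hf⟩ := exists_bijOn_notchLists (N := m + n) (n := n) (by omega) (by omega)
  rw [imperfectCountAniso_eq_two_mul (by omega)
    (hf.finite_iff_finite.2 (finite_notchLists _ _)), ← hf.image_eq, hf.injOn.ncard_image]

theorem ncard_notchLists (N n : ℕ) : ((notchLists N n).ncard : ℚ) =
    PowerSeries.coeff (N - 1) (∑ H : Fin (2 * n + 1),
      PowerSeries.coeff (2 * n - 1) (VE ((H : ℤ) - 1) H)) := by
  have key := bigf_decomp
    {d : ℤ × List (Bool × Bool) × List (Bool × Bool) × List (Bool × Bool) |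
      d.1 ∈ Set.Icc (0 : ℤ) (2 * n) ∧ ValidE d.2.1 d.2.2.1 d.2.2.2 (d.1 - 1) d.1}
    (fun d => lw d.2.1 + (lw d.2.2.1 + lw d.2.2.2))
    (fun H : Fin (2 * n + 1) =>
      {p : List (Bool × Bool) × List (Bool × Bool) × List (Bool × Bool) |
        ValidE p.1 p.2.1 p.2.2 ((H : ℤ) - 1) H})
    (fun p => lw p.1 + (lw p.2.1 + lw p.2.2)) (fun H p => ((H : ℤ), p)) (fun _ => 0) ?_ ?_ ?_
    finite_lw3
  · have key2 := congrArg (fun F => PowerSeries.coeff (N - 1) (PowerSeries.coeff (2 * n - 1) F)) key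
    simp only [bimon_zero, one_mul, map_sum] at key2
    rw [map_sum]
    refine Eq.trans ?_ key2
    rw [bigf, PowerSeries.coeff_mk, PowerSeries.coeff_mk]
    congr 2
    ext d
    exact ⟨fun hd => ⟨⟨mem_Icc_of_mem_notchLists hd, hd.1⟩, hd.2⟩, fun hd => ⟨hd.1.2, hd.2⟩⟩
  · rintro ⟨H, p⟩
    constructor
    · rintro ⟨⟨h1, h2⟩, h3⟩
      dsimp only at h1 h2 h3
      obtain ⟨k, rfl⟩ := Int.eq_ofNat_of_zero_le h1
      exact ⟨⟨k, by omega⟩, p, h3, rfl⟩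
    · rintro ⟨⟨k, hk⟩, p', h3, e⟩
      rw [Prod.mk.injEq] at e
      obtain ⟨rfl, rfl⟩ := e
      exact ⟨⟨by positivity, by dsimp only; omega⟩, h3⟩
  · intro H H' p p' e
    rw [Prod.mk.injEq] at e
    exact ⟨Fin.ext (by exact_mod_cast e.1), e.2⟩
  · intro H p
    rw [add_zero]

/-- For every `n ≥ 2`, the power series `H_n(x)` is rational with denominator `S_n(x)`:
`S_n(x)·H_n(x)` is a polynomial. -/
theorem Hgf_rational (n : ℕ) (hn : 2 ≤ n) :
    ∃ R : Polynomial ℚ, (Sden n : PowerSeries ℚ) * Hgf n = (R : PowerSeries ℚ) := by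
  set F : PowerSeries ℚ := ∑ H : Fin (2 * n + 1),
    PowerSeries.coeff (2 * n - 1) (VE ((H : ℤ) - 1) H)
  have hD : Den (2 * n - 1) (eE 1 (2 * n - 1)) F := by
    refine Den.sum fun H _ => ?_
    have := den_coeff_VE (2 * n - 1) ((H : ℤ) - 1) H
    rwa [sub_sub_cancel] at this
  have hE : eE 1 (2 * n - 1) = if Even n then 2 * n - 7 else 2 * n - 8 := by
    unfold eE
    simp only [Nat.even_iff]
    split_ifs <;> omega
  obtain ⟨R, hR⟩ := hD
  have hS : (Sden n : PowerSeries ℚ) * F = (R : PowerSeries ℚ) := by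
    rw [← hR, hE, Sden, Polynomial.coe_mul, Polynomial.coe_pow, Polynomial.coe_pow,
      Polynomial.coe_sub, Polynomial.coe_add, Polynomial.coe_one, Polynomial.coe_X]
  have hH : ∀ k, PowerSeries.coeff k (Hgf n) = 2 * PowerSeries.coeff (k + (n - 1)) F := by
    intro k
    rw [Hgf, PowerSeries.coeff_mk, imperfectCountAniso_eq_two_mul_notchLists hn, Nat.cast_mul,
      ncard_notchLists, Nat.cast_two, Nat.add_sub_assoc (by omega)]
  set T := PowerSeries.trunc (n - 1) F
  have hdec : PowerSeries.X ^ (n - 1) * Hgf n + (2 : ℚ) • (T : PowerSeries ℚ) = (2 : ℚ) • F := by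
    ext k
    rw [map_add, PowerSeries.coeff_X_pow_mul', PowerSeries.coeff_smul, PowerSeries.coeff_smul,
      Polynomial.coeff_coe, PowerSeries.coeff_trunc, hH]
    by_cases h : n - 1 ≤ k
    · rw [if_pos h, if_neg (by omega), Nat.sub_add_cancel h]
      simp
    · rw [if_neg h, if_pos (by omega)]
      simp
  set Q := (2 : ℚ) • R - (2 : ℚ) • (Sden n * T)
  have hQ : PowerSeries.X ^ (n - 1) * ((Sden n : PowerSeries ℚ) * Hgf n) = (Q : PowerSeries ℚ) := by
    have h1 : PowerSeries.X ^ (n - 1) * Hgf n = (2 : ℚ) • F - (2 : ℚ) • (T : PowerSeries ℚ) :=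
      eq_sub_of_add_eq hdec
    rw [mul_left_comm, h1, mul_sub, mul_smul_comm, mul_smul_comm, hS]
    simp [Q]
  have hdvd : Polynomial.X ^ (n - 1) ∣ Q := by
    rw [Polynomial.X_pow_dvd_iff]
    intro d hd
    rw [← Polynomial.coeff_coe, ← hQ, PowerSeries.coeff_X_pow_mul', if_neg (by omega)]
  obtain ⟨Q', hQ'⟩ := hdvd
  refine ⟨Q', mul_left_cancel₀ (pow_ne_zero (n - 1) (PowerSeries.X_ne_zero (R := ℚ))) ?_⟩
  rw [hQ, hQ', Polynomial.coe_mul, Polynomial.coe_pow, Polynomial.coe_X]
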